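/- Let 2 < p ≤ (1+√17)/2 and 1 < γ₀ < p−1, and let B > 0. There exists a constant C > 0, depending only on p, γ₀ and B, such that every smooth solution φ of the defocusing semilinear wave equation with E_{0,γ₀}[φ] ≤ B and E_{1,γ₀}[φ] < ∞ satisfies, at every point (t₀, x₀) of the exterior region (i.e. t₀ ≥ 0 and |x₀| ≥ t₀ + 2), |φ(t₀,x₀)| ≤ C |x₀|^{−α_p γ₀} (|x₀| − t₀)^{−(p−1)γ₀/(p+1)} √(E_{1,γ₀}[φ]), where α_p = (3+(p−2)²)/((p+1)(5−p)). -/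

import Mathlib

open MeasureTheory Real
open scoped ENNReal InnerProductSpace

noncomputable section

/-- Three-dimensional Euclidean space. -/
abbrev E3 : Type := EuclideanSpace ℝ (Fin 3)

/-- Second derivative of `f` at `x` in the direction `v`. -/
def der2 (f : E3 → ℝ) (x v : E3) : ℝ := fderiv ℝ (fun y => fderiv ℝ f y v) x v

/-- The (spatial) Laplacian on `ℝ³`. -/
def lap3 (f : E3 → ℝ) (x : E3) : ℝ :=
  ∑ i : Fin 3, der2 f x (EuclideanSpace.single i 1)

/-- First time derivative `∂_t φ`. -/
def dt1 (φ : ℝ → E3 → ℝ) (t : ℝ) (x : E3) : ℝ := deriv (fun s => φ s x) t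

/-- Second time derivative `∂_t² φ`. -/
def dtt (φ : ℝ → E3 → ℝ) (t : ℝ) (x : E3) : ℝ := deriv (fun s => dt1 φ s x) t

/-- `φ` is a smooth solution of the defocusing semilinear wave equation
`∂_t²φ − Δφ + |φ|^{p−1}φ = 0` on `[0,∞) × ℝ³`. -/
def IsNLWSolution (p : ℝ) (φ : ℝ → E3 → ℝ) : Prop :=
  ContDiff ℝ (⊤ : ℕ∞) (fun q : ℝ × E3 => φ q.1 q.2) ∧
    ∀ t : ℝ, 0 ≤ t → ∀ x : E3,
      dtt φ t x - lap3 (φ t) x + |φ t x| ^ (p - 1) * φ t x = 0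

/-- The weighted initial energy `E_{k,γ₀}[φ]`. -/
def wEnergy (p : ℝ) (k : ℕ) (γ₀ : ℝ) (φ : ℝ → E3 → ℝ) : ℝ≥0∞ :=
  (∑ l ∈ Finset.range (k + 1),
    ∫⁻ x : E3, ENNReal.ofReal ((1 + ‖x‖) ^ (γ₀ + 2 * (l : ℝ)) *
      (‖iteratedFDeriv ℝ (l + 1) (φ 0) x‖ ^ 2 + ‖iteratedFDeriv ℝ l (dt1 φ 0) x‖ ^ 2))) +
  ∫⁻ x : E3, ENNReal.ofReal ((1 + ‖x‖) ^ γ₀ * |φ 0 x| ^ (p + 1))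

/-- `u₊ = √(1+((t−r)/2)²)`. -/
def uplus (t r : ℝ) : ℝ := Real.sqrt (1 + ((t - r) / 2) ^ 2)

/-- `v₊ = √(1+((t+r)/2)²)`. -/
def vplus (t r : ℝ) : ℝ := Real.sqrt (1 + ((t + r) / 2) ^ 2)

/-- Surface measure on the unit sphere `S² ⊂ ℝ³` (total mass `4π`). -/
def sphereMeasure : Measure (Metric.sphere (0 : E3) 1) := (volume : Measure E3).toSphere

local notation "S2" => Metric.sphere (0 : E3) 1
local notation "σ" => sphereMeasure

instance : IsFiniteMeasure sphereMeasure := by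
  unfold sphereMeasure; infer_instance

instance : sphereMeasure.IsOpenPosMeasure := by
  unfold sphereMeasure; infer_instance

/-- Integration in polar coordinates on `ℝ³`. -/
theorem lintegral_polar (f : E3 → ℝ≥0∞) (hf : Measurable f) :
    ∫⁻ x, f x = ∫⁻ r in Set.Ioi (0 : ℝ), ENNReal.ofReal (r ^ 2) *
      ∫⁻ ω : S2, f (r • (ω : E3)) ∂sphereMeasure := by
  have h1 := (volume : Measure E3).measurePreserving_homeomorphUnitSphereProd
  have hdim : Module.finrank ℝ E3 - 1 = 2 := by simp [E3]
  rw [hdim] at h1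
  have h2 : ∫⁻ x, f x = ∫⁻ x : ({0}ᶜ : Set E3), f x ∂(volume.comap Subtype.val) := by
    rw [lintegral_subtype_comap (measurableSet_singleton _).compl,
      restrict_compl_singleton]
  have h3 : ∀ x : ({0}ᶜ : Set E3), f x =
      (fun q : S2 × Set.Ioi (0 : ℝ) => f ((q.2 : ℝ) • (q.1 : E3)))
        (homeomorphUnitSphereProd E3 x) := by
    intro x
    have hx : ‖(x : E3)‖ ≠ 0 := norm_ne_zero_iff.2 x.2
    simp [smul_smul, mul_inv_cancel₀ hx]
  have hm : Measurable (fun q : S2 × Set.Ioi (0 : ℝ) => f ((q.2 : ℝ) • (q.1 : E3))) := by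
    apply hf.comp; fun_prop
  rw [h2, lintegral_congr h3, h1.lintegral_comp hm, lintegral_prod_symm' _ hm]
  rw [Measure.volumeIoiPow, lintegral_withDensity_eq_lintegral_mul]
  · simp only [Pi.mul_apply]
    unfold sphereMeasure
    rw [← lintegral_subtype_comap measurableSet_Ioi (fun r : ℝ => ENNReal.ofReal (r ^ 2) *
      ∫⁻ ω : S2, f (r • (ω : E3)) ∂(volume : Measure E3).toSphere)]
  · fun_prop
  · exact hm.lintegral_prod_left'

/-- Polar coordinates around an arbitrary centre, restricted to a range of radii. -/
theorem lintegral_polar_shell (f : E3 → ℝ≥0∞) (hf : Measurable f) (c : E3) (A : Set ℝ)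
    (hA : MeasurableSet A) (hA0 : A ⊆ Set.Ioi 0) :
    ∫⁻ r in A, ENNReal.ofReal (r ^ 2) * ∫⁻ ω : S2, f (c + r • (ω : E3)) ∂sphereMeasure
      = ∫⁻ x in {x : E3 | ‖x - c‖ ∈ A}, f x := by
  have hmA : MeasurableSet {x : E3 | ‖x‖ ∈ A} := measurable_norm hA
  have hmA' : MeasurableSet {x : E3 | ‖x - c‖ ∈ A} :=
    (measurable_norm.comp (measurable_id.sub_const c)) hA
  rw [← lintegral_indicator hmA', ← lintegral_add_left_eq_self _ c]
  have : (fun x => Set.indicator {x : E3 | ‖x - c‖ ∈ A} f (c + x)) =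
      Set.indicator {x : E3 | ‖x‖ ∈ A} (fun x => f (c + x)) := by
    funext x; simp only [Set.indicator, Set.mem_ofPred_eq, add_sub_cancel_left]
    by_cases h : ‖x‖ ∈ A <;> simp [h]
  rw [this, lintegral_polar _ (by
    apply Measurable.indicator _ hmA
    fun_prop)]
  rw [← lintegral_indicator hA, ← lintegral_indicator measurableSet_Ioi]
  refine lintegral_congr fun r => ?_
  by_cases hr : 0 < r
  · have : ∀ ω : S2, ‖r • (ω : E3)‖ = r := fun ω => by simp [norm_smul, abs_of_pos hr]
    by_cases hrA : r ∈ A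
    · simp [Set.indicator, hr, hrA, this]
    · simp [Set.indicator, hr, hrA, this]
  · have hrA : r ∉ A := fun h => hr (hA0 h)
    simp [Set.indicator, hr, hrA]

/-- The action of a linear isometry on the unit sphere. -/
def sphereMap (L : E3 ≃ₗᵢ[ℝ] E3) (ω : S2) : S2 := ⟨L ω, by simp⟩

theorem continuous_sphereMap (L : E3 ≃ₗᵢ[ℝ] E3) : Continuous (sphereMap L) := by
  unfold sphereMap
  exact Continuous.subtype_mk (L.continuous.comp continuous_subtype_val) _

open scoped Pointwise in
/-- The surface measure is invariant under linear isometries. -/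
theorem measurePreserving_sphereMap (L : E3 ≃ₗᵢ[ℝ] E3) :
    MeasurePreserving (sphereMap L) sphereMeasure sphereMeasure := by
  refine ⟨(continuous_sphereMap L).measurable, ?_⟩
  ext s hs
  rw [Measure.map_apply (continuous_sphereMap L).measurable hs]
  unfold sphereMeasure
  rw [Measure.toSphere_apply' _ hs,
    Measure.toSphere_apply' _ ((continuous_sphereMap L).measurable hs)]
  congr 1
  have : Set.Ioo (0 : ℝ) 1 • ((↑) '' (sphereMap L ⁻¹' s) : Set E3) =
      L ⁻¹' (Set.Ioo (0 : ℝ) 1 • ((↑) '' s : Set E3)) := by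
    ext x
    simp only [Set.mem_smul, Set.mem_image, Set.mem_preimage]
    constructor
    · rintro ⟨r, hr, _, ⟨ω, hω, rfl⟩, rfl⟩
      exact ⟨r, hr, _, ⟨_, hω, rfl⟩, by simp [sphereMap]⟩
    · rintro ⟨r, hr, _, ⟨ω, hω, rfl⟩, h⟩
      refine ⟨r, hr, _, ⟨⟨L.symm ω, by simp⟩, ?_, rfl⟩, ?_⟩
      · simpa [sphereMap] using hω
      · apply L.injective; simp [h]
  rw [this]
  exact L.measurePreserving.measure_preimage_emb L.toMeasurableEquiv.measurableEmbedding _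

theorem integral_sphere_comp_isometry (L : E3 ≃ₗᵢ[ℝ] E3) (f : E3 → ℝ) (hf : Continuous f) :
    ∫ ω : S2, f (L ω) ∂sphereMeasure = ∫ ω : S2, f ω ∂sphereMeasure := by
  have h := (measurePreserving_sphereMap L)
  have hc : Continuous fun ω : S2 => f ω := hf.comp continuous_subtype_val
  rw [← h.map_eq] 
  rw [integral_map h.measurable.aemeasurable hc.aestronglyMeasurable, h.map_eq]
  rfl

open scoped Pointwise in
theorem sphereMeasure_polar_cap_le (ε : ℝ) (hε : 0 ≤ ε) :
    sphereMeasure {ω : S2 | 1 + (ω : E3) 0 ≤ ε} ≤ ENNReal.ofReal (48 * ε) := by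
  have hm : MeasurableSet {ω : S2 | 1 + (ω : E3) 0 ≤ ε} := by
    apply IsClosed.measurableSet
    apply isClosed_le <;> fun_prop
  unfold sphereMeasure
  rw [Measure.toSphere_apply' _ hm]
  set δ := √(2 * ε) with hδ
  have hδ0 : 0 ≤ δ := Real.sqrt_nonneg _
  have hδ2 : δ ^ 2 = 2 * ε := Real.sq_sqrt (by positivity)
  have hsub : Set.Ioo (0 : ℝ) 1 • ((↑) '' {ω : S2 | 1 + (ω : E3) 0 ≤ ε} : Set E3) ⊆
      (WithLp.ofLp : E3 → Fin 3 → ℝ) ⁻¹' (Set.Icc ![-1, -δ, -δ] ![1, δ, δ]) := by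
    intro x hx
    obtain ⟨r, ⟨hr0, hr1⟩, _, ⟨ω, hω, rfl⟩, rfl⟩ := Set.mem_smul.1 hx
    have hω1 : (ω : E3) 0 ^ 2 + (ω : E3) 1 ^ 2 + (ω : E3) 2 ^ 2 = 1 := by
      have := EuclideanSpace.norm_sq_eq (ω : E3)
      simpa [Fin.sum_univ_three] using this.symm
    have hω' : 1 + (ω : E3) 0 ≤ ε := hω
    have h0 : (ω : E3) 0 ^ 2 ≤ 1 := by nlinarith [sq_nonneg ((ω : E3) 1), sq_nonneg ((ω : E3) 2)]
    have h0' : |(ω : E3) 0| ≤ 1 := by rwa [sq_le_one_iff_abs_le_one] at h0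
    have h0'' := abs_le.1 h0'
    have h12 : (ω : E3) 1 ^ 2 + (ω : E3) 2 ^ 2 ≤ δ ^ 2 := by
      rw [hδ2]; nlinarith
    have h1 : |(ω : E3) 1| ≤ δ := abs_le_of_sq_le_sq (by nlinarith [sq_nonneg ((ω : E3) 2)]) hδ0
    have h2 : |(ω : E3) 2| ≤ δ := abs_le_of_sq_le_sq (by nlinarith [sq_nonneg ((ω : E3) 1)]) hδ0
    have key : ∀ (z d : ℝ), |z| ≤ d → -d ≤ r * z ∧ r * z ≤ d := by
      intro z d hz
      rw [← abs_le, abs_mul, abs_of_pos hr0]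
      calc r * |z| ≤ 1 * |z| := by gcongr
        _ ≤ d := by simpa using hz
    rw [Set.mem_preimage, Set.mem_Icc, Pi.le_def, Pi.le_def]
    constructor
    · intro i; fin_cases i
      · simpa using (key _ _ h0').1
      · simpa using (key _ _ h1).1
      · simpa using (key _ _ h2).1
    · intro i; fin_cases i
      · simpa using (key _ _ h0').2
      · simpa using (key _ _ h1).2
      · simpa using (key _ _ h2).2
  have hvol : (volume : Measure E3) ((WithLp.ofLp : E3 → Fin 3 → ℝ) ⁻¹'
      (Set.Icc ![-1, -δ, -δ] ![1, δ, δ])) = ENNReal.ofReal (16 * ε) := by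
    rw [(PiLp.volume_preserving_ofLp (Fin 3)).measure_preimage
      measurableSet_Icc.nullMeasurableSet, Real.volume_Icc_pi, Fin.prod_univ_three]
    simp only [Matrix.cons_val]
    rw [← ENNReal.ofReal_mul (by norm_num), ← ENNReal.ofReal_mul (by nlinarith)]
    congr 1
    nlinarith
  have hfin : Module.finrank ℝ E3 = 3 := by simp [E3]
  calc _ ≤ ((Module.finrank ℝ E3 : ℕ) : ℝ≥0∞) * ENNReal.ofReal (16 * ε) := by
        gcongr
        exact (measure_mono hsub).trans hvol.le
    _ = _ := by
        rw [hfin, show (48 * ε) = 3 * (16 * ε) by ring, ENNReal.ofReal_mul (by norm_num)]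
        norm_num

theorem exists_isometry_map (e f : E3) (h : ‖e‖ = ‖f‖) : ∃ L : E3 ≃ₗᵢ[ℝ] E3, L e = f :=
  ⟨_, Submodule.reflection_sub h⟩

theorem sphereMeasure_cap_le (e : E3) (he : ‖e‖ = 1) (ε : ℝ) (hε : 0 ≤ ε) :
    sphereMeasure {ω : S2 | 1 + ⟪(ω : E3), e⟫_ℝ ≤ ε} ≤ ENNReal.ofReal (48 * ε) := by
  obtain ⟨L, hL⟩ := exists_isometry_map e (EuclideanSpace.single 0 1) (by simp [he])
  have hm : MeasurableSet {ω : S2 | 1 + (ω : E3) 0 ≤ ε} := by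
    apply IsClosed.measurableSet
    apply isClosed_le <;> fun_prop
  have : {ω : S2 | 1 + ⟪(ω : E3), e⟫_ℝ ≤ ε} = sphereMap L ⁻¹' {ω : S2 | 1 + (ω : E3) 0 ≤ ε} := by
    ext ω
    simp only [Set.mem_preimage, Set.mem_ofPred_eq, sphereMap]
    rw [← L.inner_map_map, hL, EuclideanSpace.inner_single_right]
    simp
  rw [this, (measurePreserving_sphereMap L).measure_preimage hm.nullMeasurableSet]
  exact sphereMeasure_polar_cap_le ε hε

theorem one_add_inner_mem (e : E3) (he : ‖e‖ = 1) (ω : S2) :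
    1 + ⟪(ω : E3), e⟫_ℝ ∈ Set.Icc (0 : ℝ) 2 := by
  have h := abs_real_inner_le_norm (ω : E3) e
  have hω : ‖(ω : E3)‖ = 1 := by simp
  rw [he, hω, one_mul, abs_le] at h
  constructor <;> linarith [h.1, h.2]

/-- Integrals of decreasing zonal functions on the sphere. -/
theorem lintegral_zonal_le (e : E3) (he : ‖e‖ = 1) (h : ℝ → ℝ) (hh : Measurable h)
    (h0 : ∀ x ∈ Set.Icc (0 : ℝ) 2, 0 ≤ h x) (ha : AntitoneOn h (Set.Icc 0 2)) :
    ∫⁻ ω : S2, ENNReal.ofReal (h (1 + ⟪(ω : E3), e⟫_ℝ)) ∂sphereMeasure ≤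
      48 * ∫⁻ x in Set.Ioc (0 : ℝ) 2, ENNReal.ofReal (h x) := by
  have hm : Measurable fun ω : S2 => h (1 + ⟪(ω : E3), e⟫_ℝ) := by
    apply hh.comp
    exact Continuous.measurable (by fun_prop)
  rw [lintegral_eq_lintegral_meas_le _ (ae_of_all _ fun ω => h0 _ (one_add_inner_mem e he ω))
    hm.aemeasurable]
  rw [lintegral_eq_lintegral_meas_le (volume.restrict (Set.Ioc (0 : ℝ) 2))
    ((ae_restrict_iff' measurableSet_Ioc).2
      (ae_of_all _ fun x hx => h0 x ⟨hx.1.le, hx.2⟩)) hh.aemeasurable]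
  rw [← lintegral_const_mul' _ _ (by norm_num)]
  refine lintegral_mono fun t => ?_
  set T := {x : ℝ | t ≤ h x} with hT
  have hTm : MeasurableSet T := measurableSet_le measurable_const hh
  rw [Measure.restrict_apply hTm]
  have hfin : volume (T ∩ Set.Ioc (0 : ℝ) 2) ≠ ⊤ :=
    ((measure_mono Set.inter_subset_right).trans_lt (by simp)).ne
  set l := (volume (T ∩ Set.Ioc (0 : ℝ) 2)).toReal with hl
  have hsub : {ω : S2 | t ≤ h (1 + ⟪(ω : E3), e⟫_ℝ)} ⊆ {ω : S2 | 1 + ⟪(ω : E3), e⟫_ℝ ≤ l} := by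
    intro ω hω
    have hb := one_add_inner_mem e he ω
    set s := 1 + ⟪(ω : E3), e⟫_ℝ
    have h1 : Set.Ioc 0 s ⊆ T ∩ Set.Ioc (0 : ℝ) 2 := fun x hx =>
      ⟨le_trans hω (ha ⟨hx.1.le, hx.2.trans hb.2⟩ hb hx.2), hx.1, hx.2.trans hb.2⟩
    have h2 := ENNReal.toReal_mono hfin (measure_mono (μ := volume) h1)
    rw [Real.volume_Ioc, ENNReal.toReal_ofReal (by linarith [hb.1])] at h2
    change s ≤ l
    linarith
  calc _ ≤ sphereMeasure {ω : S2 | 1 + ⟪(ω : E3), e⟫_ℝ ≤ l} := measure_mono hsub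
    _ ≤ ENNReal.ofReal (48 * l) := sphereMeasure_cap_le e he l ENNReal.toReal_nonneg
    _ = _ := by
      rw [ENNReal.ofReal_mul (by norm_num), hl, ENNReal.ofReal_toReal hfin]
      norm_num

theorem lintegral_zonal_rpow_le_of_lt_one (e : E3) (he : ‖e‖ = 1) {q A b : ℝ}
    (hq0 : 0 < q) (hq : q < 1) (hA : 0 < A) (hb : 0 < b) :
    ∫⁻ ω : S2, ENNReal.ofReal (((1 + ⟪(ω : E3), e⟫_ℝ) * A + b) ^ (-q)) ∂sphereMeasure ≤
      ENNReal.ofReal (48 * (2 ^ (1 - q) / (1 - q)) * A ^ (-q)) := by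
  refine (lintegral_zonal_le e he (fun x => (x * A + b) ^ (-q)) (by fun_prop) ?_ ?_).trans ?_
  · intro x hx; have := hx.1; positivity
  · intro x hx y hy hxy
    have := hx.1
    exact rpow_le_rpow_of_nonpos (by positivity) (by gcongr) (by linarith)
  · have h_integ : IntervalIntegrable (fun x : ℝ => x ^ (-q) * A ^ (-q)) volume 0 2 :=
      (intervalIntegral.intervalIntegrable_rpow' (by linarith)).mul_const _
    calc _ ≤ 48 * ∫⁻ x in Set.Ioc (0 : ℝ) 2, ENNReal.ofReal (x ^ (-q) * A ^ (-q)) := by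
          gcongr 48 * ?_
          refine setLIntegral_mono (by fun_prop) fun x hx => ?_
          apply ENNReal.ofReal_le_ofReal
          have := hx.1
          rw [← mul_rpow this.le hA.le]
          exact rpow_le_rpow_of_nonpos (by positivity) (by linarith) (by linarith)
      _ = _ := by
          rw [← ofReal_integral_eq_lintegral_ofReal]
          · rw [← intervalIntegral.integral_of_le (by norm_num), intervalIntegral.integral_mul_const,
              integral_rpow (Or.inl (by linarith)), zero_rpow (by linarith), mul_assoc,
              ENNReal.ofReal_mul (by norm_num : (0:ℝ) ≤ 48)]
            norm_num [neg_add_eq_sub]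
          · exact (intervalIntegrable_iff_integrableOn_Ioc_of_le (by norm_num)).1 h_integ
          · refine (ae_restrict_iff' measurableSet_Ioc).2 (ae_of_all _ fun x hx => ?_)
            have := hx.1
            change 0 ≤ x ^ (-q) * A ^ (-q)
            positivity

theorem lintegral_zonal_rpow_le_of_one_lt (e : E3) (he : ‖e‖ = 1) {q A b : ℝ}
    (hq : 1 < q) (hA : 0 < A) (hb : 0 < b) :
    ∫⁻ ω : S2, ENNReal.ofReal (((1 + ⟪(ω : E3), e⟫_ℝ) * A + b) ^ (-q)) ∂sphereMeasure ≤
      ENNReal.ofReal (48 / (q - 1) * (A⁻¹ * b ^ (1 - q))) := by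
  refine (lintegral_zonal_le e he (fun x => (x * A + b) ^ (-q)) (by fun_prop) ?_ ?_).trans ?_
  · intro x hx; have := hx.1; positivity
  · intro x hx y hy hxy
    have := hx.1
    exact rpow_le_rpow_of_nonpos (by positivity) (by gcongr) (by linarith)
  · have hd : ∀ x ∈ Set.uIcc (0 : ℝ) 2, HasDerivAt
        (fun x : ℝ => (x * A + b) ^ (1 - q) / (A * (1 - q))) ((x * A + b) ^ (-q)) x := by
      intro x hx
      rw [Set.uIcc_of_le (by norm_num)] at hx
      have := hx.1
      have h1 : HasDerivAt (fun x : ℝ => x * A + b) A x := by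
        simpa using ((hasDerivAt_id x).mul_const A).add_const b
      have h2 := (h1.rpow_const (p := 1 - q) (Or.inl (by positivity))).div_const (A * (1 - q))
      refine h2.congr_deriv ?_
      rw [show 1 - q - 1 = -q by ring]
      have : 1 - q ≠ 0 := by linarith
      field_simp
    have hc : ContinuousOn (fun x : ℝ => (x * A + b) ^ (-q)) (Set.uIcc 0 2) := by
      rw [Set.uIcc_of_le (by norm_num)]
      apply ContinuousOn.rpow_const (by fun_prop)
      intro x hx
      have := hx.1
      exact Or.inl (by positivity)
    have h_integ := hc.intervalIntegrable (μ := volume)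
    have hftc := intervalIntegral.integral_eq_sub_of_hasDerivAt hd h_integ
    rw [← ofReal_integral_eq_lintegral_ofReal]
    · rw [← intervalIntegral.integral_of_le (by norm_num), hftc]
      rw [show (48 : ℝ≥0∞) = ENNReal.ofReal 48 by norm_num, ← ENNReal.ofReal_mul (by norm_num)]
      apply ENNReal.ofReal_le_ofReal
      have h3 : 0 ≤ (2 * A + b) ^ (1 - q) := by positivity
      have h4 : 0 < q - 1 := by linarith
      have h5 : ∀ z : ℝ, z / (A * (1 - q)) = -(z / (A * (q - 1))) := by
        intro z
        rw [← div_neg]; congr 1; ring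
      rw [h5, h5, zero_mul, zero_add]
      have h6 : 0 ≤ (2 * A + b) ^ (1 - q) / (A * (q - 1)) := by positivity
      have h7 : 48 / (q - 1) * (A⁻¹ * b ^ (1 - q)) = 48 * (b ^ (1 - q) / (A * (q - 1))) := by
        field_simp
      rw [h7]
      linarith
    · exact (intervalIntegrable_iff_integrableOn_Ioc_of_le (by norm_num)).1 h_integ
    · refine (ae_restrict_iff' measurableSet_Ioc).2 (ae_of_all _ fun x hx => ?_)
      have := hx.1
      change 0 ≤ (x * A + b) ^ (-q)
      positivity

theorem Continuous.integrable_sphere {f : S2 → ℝ} (hf : Continuous f) : Integrable f σ :=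
  hf.integrable_of_hasCompactSupport (HasCompactSupport.of_compactSpace f)

/-- Differentiation under the integral sign over the sphere. -/
theorem hasDerivAt_integral_sphere {F F' : ℝ → S2 → ℝ}
    (hF : ∀ r, Continuous (F r)) (hF' : Continuous (Function.uncurry F'))
    (h : ∀ r ω, HasDerivAt (fun s => F s ω) (F' r ω) r) (r : ℝ) :
    HasDerivAt (fun s => ∫ ω, F s ω ∂σ) (∫ ω, F' r ω ∂σ) r := by
  obtain ⟨C, hC⟩ := ((isCompact_closedBall r 1).prod (isCompact_univ (X := S2))).exists_bound_of_continuousOn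
    hF'.continuousOn
  refine (hasDerivAt_integral_of_dominated_loc_of_deriv_le (μ := σ) (bound := fun _ => C)
    (Metric.closedBall_mem_nhds r one_pos) ?_ ?_ ?_ ?_ ?_ ?_).2
  · exact Filter.Eventually.of_forall fun s => (hF s).aestronglyMeasurable
  · exact (hF r).integrable_sphere
  · exact (hF'.comp (by fun_prop : Continuous fun ω : S2 => (r, ω))).aestronglyMeasurable
  · exact ae_of_all _ fun ω s hs => hC (s, ω) ⟨hs, trivial⟩
  · exact integrable_const _
  · exact ae_of_all _ fun ω s _ => h s ω

theorem continuous_integral_sphere {X : Type*} [TopologicalSpace X] [FirstCountableTopology X]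
    [LocallyCompactSpace X] {F : X → S2 → ℝ}
    (hF : Continuous (Function.uncurry F)) : Continuous fun r => ∫ ω, F r ω ∂σ := by
  have := continuous_parametric_integral_of_continuous (μ := σ) hF isCompact_univ
  simpa using this

/-- Rotation by the angle `θ` in the oriented plane spanned by the orthonormal vectors `a`, `b`. -/
def planeRotation (a b : E3) (ha : ‖a‖ = 1) (hb : ‖b‖ = 1) (hab : ⟪a, b⟫_ℝ = 0) (θ : ℝ) :
    E3 →ₗᵢ[ℝ] E3 where
  toFun x := x + (((cos θ - 1) * ⟪a, x⟫_ℝ - sin θ * ⟪b, x⟫_ℝ) • a +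
    ((cos θ - 1) * ⟪b, x⟫_ℝ + sin θ * ⟪a, x⟫_ℝ) • b)
  map_add' x y := by simp only [inner_add_right]; module
  map_smul' c x := by simp only [inner_smul_right, RingHom.id_apply]; module
  norm_map' x := by
    rw [← sq_eq_sq₀ (norm_nonneg _) (norm_nonneg _)]
    have h := sin_sq_add_cos_sq θ
    have haa : ⟪a, a⟫_ℝ = 1 := by rw [real_inner_self_eq_norm_sq, ha]; norm_num
    have hbb : ⟪b, b⟫_ℝ = 1 := by rw [real_inner_self_eq_norm_sq, hb]; norm_num
    have hba : ⟪b, a⟫_ℝ = 0 := by rw [real_inner_comm, hab]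
    simp only [LinearMap.coe_mk, AddHom.coe_mk]
    rw [← real_inner_self_eq_norm_sq, ← real_inner_self_eq_norm_sq]
    simp only [inner_add_left, inner_add_right, inner_smul_left, inner_smul_right, haa, hbb,
      hab, hba, conj_trivial, real_inner_comm a x, real_inner_comm b x]
    linear_combination (⟪a, x⟫_ℝ ^ 2 + ⟪b, x⟫_ℝ ^ 2) * h

theorem planeRotation_apply (a b : E3) (ha : ‖a‖ = 1) (hb : ‖b‖ = 1) (hab : ⟪a, b⟫_ℝ = 0)
    (θ : ℝ) (x : E3) : planeRotation a b ha hb hab θ x =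
      x + (((cos θ - 1) * ⟪a, x⟫_ℝ - sin θ * ⟪b, x⟫_ℝ) • a +
        ((cos θ - 1) * ⟪b, x⟫_ℝ + sin θ * ⟪a, x⟫_ℝ) • b) := rfl

theorem hasDerivAt_planeRotation (a b : E3) (ha : ‖a‖ = 1) (hb : ‖b‖ = 1) (hab : ⟪a, b⟫_ℝ = 0)
    (θ : ℝ) (x : E3) : HasDerivAt (fun t => planeRotation a b ha hb hab t x)
      (((-sin θ) * ⟪a, x⟫_ℝ - cos θ * ⟪b, x⟫_ℝ) • a +
        ((-sin θ) * ⟪b, x⟫_ℝ + cos θ * ⟪a, x⟫_ℝ) • b) θ := by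
  simp only [planeRotation_apply]
  apply HasDerivAt.const_add
  apply HasDerivAt.add
  · apply HasDerivAt.smul_const
    exact (((hasDerivAt_cos θ).sub_const 1).mul_const _).sub ((hasDerivAt_sin θ).mul_const _)
  · apply HasDerivAt.smul_const
    exact (((hasDerivAt_cos θ).sub_const 1).mul_const _).add ((hasDerivAt_sin θ).mul_const _)

theorem continuous_planeRotation (a b : E3) (ha : ‖a‖ = 1) (hb : ‖b‖ = 1)
    (hab : ⟪a, b⟫_ℝ = 0) :
    Continuous fun q : ℝ × E3 => planeRotation a b ha hb hab q.1 q.2 := by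
  simp only [planeRotation_apply]
  fun_prop

/-- Infinitesimal rotations integrate to zero over the sphere. -/
theorem integral_sphere_rotation_eq_zero (a b : E3) (ha : ‖a‖ = 1) (hb : ‖b‖ = 1)
    (hab : ⟪a, b⟫_ℝ = 0) (H : E3 → ℝ) (hH : ContDiff ℝ 1 H) :
    ∫ ω : S2, fderiv ℝ H ω (⟪a, (ω : E3)⟫_ℝ • b - ⟪b, (ω : E3)⟫_ℝ • a) ∂σ = 0 := by
  have hRd := hasDerivAt_planeRotation a b ha hb hab
  have hRc := continuous_planeRotation a b ha hb hab
  have hconst : ∀ θ, ∫ ω : S2, H (planeRotation a b ha hb hab θ ω) ∂σ = ∫ ω : S2, H ω ∂σ :=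
    fun θ => integral_sphere_comp_isometry
      ((planeRotation a b ha hb hab θ).toLinearIsometryEquiv rfl) H hH.continuous
  have hR0 : ∀ x, planeRotation a b ha hb hab 0 x = x := fun x => by
    simp [planeRotation_apply]
  generalize hR : (fun θ x => planeRotation a b ha hb hab θ x) = R at *
  have hR1 : ∀ θ x, planeRotation a b ha hb hab θ x = R θ x := fun θ x => by rw [← hR]
  simp only [hR1] at hRd hRc hconst hR0
  clear hR1 hR
  have hd := hasDerivAt_integral_sphere (F := fun θ ω => H (R θ ω))
    (F' := fun θ ω => fderiv ℝ H (R θ ω) (((-sin θ) * ⟪a, (ω : E3)⟫_ℝ - cos θ * ⟪b, (ω : E3)⟫_ℝ) • a +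
      ((-sin θ) * ⟪b, (ω : E3)⟫_ℝ + cos θ * ⟪a, (ω : E3)⟫_ℝ) • b))
    (fun r => hH.continuous.comp (hRc.comp (by fun_prop : Continuous fun ω : S2 => (r, (ω : E3)))))
    (by
      have h1 : Continuous fun q : ℝ × S2 => R q.1 q.2 :=
        hRc.comp (by fun_prop : Continuous fun q : ℝ × S2 => (q.1, (q.2 : E3)))
      have h2 := (hH.continuous_fderiv (by norm_num)).comp h1
      simp only [Function.uncurry_def]
      exact h2.clm_apply (by fun_prop))
    (fun r ω => ((hH.differentiable (by norm_num) _).hasFDerivAt).comp_hasDerivAt r (hRd r ω)) 0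
  simp only [hconst] at hd
  have h0 := hd.unique (hasDerivAt_const _ _)
  rw [← h0]
  refine integral_congr_ae (ae_of_all _ fun ω => ?_)
  simp [hR0, sub_eq_neg_add]

/-- The coordinate vectors. -/
abbrev ee (i : Fin 3) : E3 := EuclideanSpace.single i 1

theorem clm_eq_sum (D : E3 →L[ℝ] ℝ) (v : E3) : D v = ∑ k, v k * D (ee k) := by
  have : v = ∑ k, v k • ee k := by
    have := (EuclideanSpace.basisFun (Fin 3) ℝ).sum_repr v
    simpa using this.symm
  conv_lhs => rw [this]
  simp [map_sum]

theorem sphere_sum_sq (ω : S2) : (ω : E3) 0 ^ 2 + (ω : E3) 1 ^ 2 + (ω : E3) 2 ^ 2 = 1 := by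
  have := EuclideanSpace.norm_sq_eq (ω : E3)
  simpa [Fin.sum_univ_three] using this.symm

/-- Infinitesimal divergence theorem on a sphere of radius `ρ` centred at `c`. -/
theorem integral_sphere_div (V : Fin 3 → E3 → ℝ) (hV : ∀ i, ContDiff ℝ 1 (V i)) (c : E3)
    (ρ : ℝ) :
    ∫ ω : S2, (ρ * ∑ i, fderiv ℝ (V i) (c + ρ • (ω : E3)) (ee i)
      - ρ * ∑ i, (ω : E3) i * fderiv ℝ (V i) (c + ρ • (ω : E3)) ω
      - 2 * ∑ i, (ω : E3) i * V i (c + ρ • (ω : E3))) ∂σ = 0 := by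
  set H : Fin 3 → Fin 3 → E3 → ℝ := fun i j z => z i * V j (c + ρ • z) - z j * V i (c + ρ • z)
    with hHdef
  have hH : ∀ i j, ContDiff ℝ 1 (H i j) := by
    intro i j
    have := hV i; have := hV j
    simp only [hHdef]; fun_prop
  have hHd : ∀ i j (z v : E3), fderiv ℝ (H i j) z v =
      v i * V j (c + ρ • z) + z i * (ρ * fderiv ℝ (V j) (c + ρ • z) v)
      - (v j * V i (c + ρ • z) + z j * (ρ * fderiv ℝ (V i) (c + ρ • z) v)) := by
    intro i j z v
    have hc : ∀ k, HasFDerivAt (fun z : E3 => z k) (EuclideanSpace.proj k : E3 →L[ℝ] ℝ) z :=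
      fun k => (EuclideanSpace.proj k : E3 →L[ℝ] ℝ).hasFDerivAt
    have hVd : ∀ k, HasFDerivAt (fun z : E3 => V k (c + ρ • z))
        ((fderiv ℝ (V k) (c + ρ • z)).comp (ρ • ContinuousLinearMap.id ℝ E3)) z := by
      intro k
      have h1 : HasFDerivAt (fun z : E3 => c + ρ • z) (ρ • ContinuousLinearMap.id ℝ E3) z :=
        ((hasFDerivAt_id z).const_smul ρ).const_add c
      exact (((hV k).differentiable (by norm_num) _).hasFDerivAt).comp z h1
    have hd : HasFDerivAt (H i j) _ z := ((hc i).mul (hVd j)).sub ((hc j).mul (hVd i))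
    rw [hd.fderiv]
    simp [smul_eq_mul]
    ring
  have hrot : ∀ i j : Fin 3, i ≠ j → ∫ ω : S2, fderiv ℝ (H i j) ω
      ((ω : E3) i • ee j - (ω : E3) j • ee i) ∂σ = 0 := by
    intro i j hij
    have := integral_sphere_rotation_eq_zero (ee i) (ee j) (by simp) (by simp)
      (by simp [EuclideanSpace.inner_single_left, hij]) (H i j) (hH i j)
    simpa [EuclideanSpace.inner_single_left] using this
  have hcont : ∀ i j : Fin 3, Integrable (fun ω : S2 => fderiv ℝ (H i j) ω
      ((ω : E3) i • ee j - (ω : E3) j • ee i)) σ := by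
    intro i j
    apply Continuous.integrable_sphere
    exact (((hH i j).continuous_fderiv (by norm_num)).comp continuous_subtype_val).clm_apply
      (by fun_prop)
  have hsum : ∫ ω : S2, (fderiv ℝ (H 0 1) ω ((ω : E3) 0 • ee 1 - (ω : E3) 1 • ee 0) +
      fderiv ℝ (H 0 2) ω ((ω : E3) 0 • ee 2 - (ω : E3) 2 • ee 0) +
      fderiv ℝ (H 1 2) ω ((ω : E3) 1 • ee 2 - (ω : E3) 2 • ee 1)) ∂σ = 0 := by
    rw [integral_add _ (hcont 1 2), integral_add (hcont 0 1) (hcont 0 2), hrot _ _ (by decide),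
      hrot _ _ (by decide),
      hrot _ _ (by decide)]
    · norm_num
    · exact (hcont 0 1).add (hcont 0 2)
  rw [← hsum]
  refine integral_congr_ae (ae_of_all _ fun ω => ?_)
  have hs := sphere_sum_sq ω
  simp only [hHd, map_sub, map_smul, smul_eq_mul, Fin.sum_univ_three,
    clm_eq_sum _ (ω : E3)]
  simp
  generalize (ω : E3) 0 = a at *
  generalize (ω : E3) 1 = b at *
  generalize (ω : E3) 2 = d at *
  have hs' : a ^ 2 = 1 - b ^ 2 - d ^ 2 := by linarith
  generalize fderiv ℝ (V 0) (c + ρ • (ω : E3)) = D0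
  generalize fderiv ℝ (V 1) (c + ρ • (ω : E3)) = D1
  generalize fderiv ℝ (V 2) (c + ρ • (ω : E3)) = D2
  linear_combination (-ρ * (D0 (ee 0) + D1 (ee 1) + D2 (ee 2))) * hs

/-- Derivative of a function on spacetime along a constant vector. -/
def pd (v : ℝ × E3) (f : ℝ × E3 → ℝ) (q : ℝ × E3) : ℝ := fderiv ℝ f q v

/-- The unit vector in the time direction. -/
abbrev et : ℝ × E3 := (1, 0)

/-- The coordinate unit vectors in the space directions. -/
abbrev es (i : Fin 3) : ℝ × E3 := (0, ee i)

theorem ContDiff.pd {f : ℝ × E3 → ℝ} (hf : ContDiff ℝ (⊤ : ℕ∞) f) (v : ℝ × E3) :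
    ContDiff ℝ (⊤ : ℕ∞) (pd v f) :=
  (hf.fderiv_right (m := (⊤ : ℕ∞)) (by simp)).clm_apply contDiff_const

theorem pd_comm {f : ℝ × E3 → ℝ} (hf : ContDiff ℝ (⊤ : ℕ∞) f) (v w : ℝ × E3) (q : ℝ × E3) :
    pd v (pd w f) q = pd w (pd v f) q := by
  have hd : DifferentiableAt ℝ (fderiv ℝ f) q :=
    ((hf.fderiv_right (m := (⊤ : ℕ∞)) (by simp)).differentiable (by simp)) q
  have h : ∀ v w, pd v (pd w f) q = fderiv ℝ (fderiv ℝ f) q v w := by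
    intro v w
    have : HasFDerivAt (pd w f) ((ContinuousLinearMap.apply ℝ ℝ w).comp (fderiv ℝ (fderiv ℝ f) q)) q :=
      (ContinuousLinearMap.apply ℝ ℝ w).hasFDerivAt.comp q hd.hasFDerivAt
    rw [_root_.pd, this.fderiv]; rfl
  rw [h, h]
  exact (hf.contDiffAt.isSymmSndFDerivAt
    (by simp only [minSmoothness_of_isRCLikeNormedField]; exact WithTop.coe_le_coe.2 le_top)).eq v w

theorem fderiv_prod_eq (f : ℝ × E3 → ℝ) (q : ℝ × E3) (a : ℝ) (v : E3) :
    fderiv ℝ f q (a, v) = a * pd et f q + ∑ i, v i * pd (es i) f q := by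
  have h1 : (a, v) = a • et + (0, v) := by simp [et]
  rw [h1, map_add, map_smul, smul_eq_mul]
  congr 1
  have := clm_eq_sum ((fderiv ℝ f q).comp (ContinuousLinearMap.inr ℝ ℝ E3)) v
  simpa [pd] using this

theorem hasDerivAt_cone {f : ℝ × E3 → ℝ} (hf : ContDiff ℝ 1 f) (T : ℝ) (c v : E3) (ρ : ℝ) :
    HasDerivAt (fun s => f (T - s, c + s • v))
      (-pd et f (T - ρ, c + ρ • v) + ∑ i, v i * pd (es i) f (T - ρ, c + ρ • v)) ρ := by
  have h1 : HasDerivAt (fun s : ℝ => (T - s, c + s • v)) (-1, v) ρ := by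
    refine HasDerivAt.prodMk ((hasDerivAt_id ρ).const_sub T) ?_
    simpa using ((hasDerivAt_id ρ).smul_const v).const_add c
  have h2 := ((hf.differentiable (by norm_num) (T - ρ, c + ρ • v)).hasFDerivAt).comp_hasDerivAt ρ h1
  rw [fderiv_prod_eq] at h2
  exact h2.congr_deriv (by ring)

theorem fderiv_slice {f : ℝ × E3 → ℝ} (hf : ContDiff ℝ 1 f) (t : ℝ) (x v : E3) :
    fderiv ℝ (fun y => f (t, y)) x v = ∑ i, v i * pd (es i) f (t, x) := by
  have h1 : HasFDerivAt (fun y : E3 => (t, y)) (ContinuousLinearMap.inr ℝ ℝ E3) x :=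
    hasFDerivAt_prodMk_right t x
  have h2 := ((hf.differentiable (by norm_num) (t, x)).hasFDerivAt).comp x h1
  have h3 := fderiv_prod_eq f (t, x) 0 v
  have h4 : fderiv ℝ (fun y => f (t, y)) x = _ := h2.fderiv
  rw [h4]
  simpa using h3

/-- The spherical-means functional appearing in Kirchhoff's formula. -/
def kirchhoff (f : ℝ × E3 → ℝ) (T : ℝ) (c : E3) (ρ : ℝ) : ℝ :=
  ∫ ω : S2, (ρ * pd et f (T - ρ, c + ρ • (ω : E3)) + f (T - ρ, c + ρ • (ω : E3)) +
    ρ * ∑ i, (ω : E3) i * pd (es i) f (T - ρ, c + ρ • (ω : E3))) ∂σ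

theorem hasDerivAt_kirchhoff {f : ℝ × E3 → ℝ} (hf : ContDiff ℝ (⊤ : ℕ∞) f) (T : ℝ) (c : E3)
    (ρ : ℝ) : HasDerivAt (kirchhoff f T c)
      (ρ * ∫ ω : S2, (∑ i, pd (es i) (pd (es i) f) (T - ρ, c + ρ • (ω : E3)) -
        pd et (pd et f) (T - ρ, c + ρ • (ω : E3))) ∂σ) ρ := by
  have hc : ∀ g : ℝ × E3 → ℝ, ContDiff ℝ (⊤ : ℕ∞) g → Continuous fun q : ℝ × S2 =>
      g (T - q.1, c + q.1 • (q.2 : E3)) := fun g hg => hg.continuous.comp (by fun_prop)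
  have hc' : ∀ g : ℝ × E3 → ℝ, ContDiff ℝ (⊤ : ℕ∞) g → ∀ ρ, Continuous fun ω : S2 =>
      g (T - ρ, c + ρ • (ω : E3)) := fun g hg ρ => hg.continuous.comp (by fun_prop)
  have hcoord : ∀ i : Fin 3, Continuous fun ω : S2 => (ω : E3) i := fun i => by fun_prop
  have hcoord' : ∀ i : Fin 3, Continuous fun q : ℝ × S2 => (q.2 : E3) i := fun i => by fun_prop
  have hd := hasDerivAt_integral_sphere
    (F := fun ρ ω => ρ * pd et f (T - ρ, c + ρ • (ω : E3)) + f (T - ρ, c + ρ • (ω : E3)) +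
      ρ * ∑ i, (ω : E3) i * pd (es i) f (T - ρ, c + ρ • (ω : E3)))
    (F' := fun ρ ω => -(ρ * pd et (pd et f) (T - ρ, c + ρ • (ω : E3)))
      + 2 * ∑ i, (ω : E3) i * pd (es i) f (T - ρ, c + ρ • (ω : E3))
      + ρ * ∑ i, (ω : E3) i * ∑ j, (ω : E3) j * pd (es j) (pd (es i) f) (T - ρ, c + ρ • (ω : E3)))
    (by
      intro ρ
      have h1 := hc' _ (hf.pd et) ρ
      have h2 := hc' _ hf ρ
      have h3 := fun i => hc' _ (hf.pd (es i)) ρ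
      fun_prop)
    (by
      have h1 := hc _ ((hf.pd et).pd et)
      have h3 := fun i => hc _ (hf.pd (es i))
      have h4 := fun i j => hc _ ((hf.pd (es i)).pd (es j))
      simp only [Function.uncurry_def]
      fun_prop)
    (by
      intro ρ ω
      have h1 := hasDerivAt_cone (hf.of_le (by exact_mod_cast le_top) : ContDiff ℝ 1 f) T c ω ρ
      have h2 := hasDerivAt_cone
        ((hf.pd et).of_le (by exact_mod_cast le_top) : ContDiff ℝ 1 (pd et f)) T c ω ρ
      have h3 := fun i => hasDerivAt_cone
        ((hf.pd (es i)).of_le (by exact_mod_cast le_top) : ContDiff ℝ 1 (pd (es i) f)) T c ω ρ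
      have h4 := HasDerivAt.fun_sum (u := Finset.univ)
        (fun i _ => (h3 i).const_mul ((ω : E3) i))
      refine ((((hasDerivAt_id ρ).mul h2).add h1).add ((hasDerivAt_id ρ).mul h4)).congr_deriv ?_
      simp only [pd_comm hf (es _) et, Fin.sum_univ_three, id]
      ring) ρ
  refine hd.congr_deriv ?_
  have hV : ∀ i, ContDiff ℝ 1 (fun x => pd (es i) f (T - ρ, x)) := fun i =>
    ((hf.pd (es i)).of_le (by exact_mod_cast le_top) : ContDiff ℝ 1 (pd (es i) f)).comp
      (contDiff_prodMk_right (T - ρ))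
  have hdiv := integral_sphere_div (fun i x => pd (es i) f (T - ρ, x)) hV c ρ
  simp only [fun i x v => fderiv_slice ((hf.pd (es i)).of_le (by exact_mod_cast le_top) :
    ContDiff ℝ 1 (pd (es i) f)) (T - ρ) x v] at hdiv
  rw [← integral_const_mul, ← sub_eq_zero, ← integral_sub, ← neg_eq_zero, ← integral_neg, ← hdiv]
  · refine integral_congr_ae (ae_of_all _ fun ω => ?_)
    simp [Fin.sum_univ_three, ee]
    ring
  · apply Continuous.integrable_sphere
    have h1 := hc' _ ((hf.pd et).pd et) ρ
    have h3 := fun i => hc' _ (hf.pd (es i)) ρ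
    have h4 := fun i j => hc' _ ((hf.pd (es i)).pd (es j)) ρ
    fun_prop
  · apply Continuous.integrable_sphere
    have h1 := hc' _ ((hf.pd et).pd et) ρ
    have h4 := fun i j => hc' _ ((hf.pd (es i)).pd (es j)) ρ
    fun_prop

/-- Kirchhoff's representation formula. -/
theorem kirchhoff_formula {f : ℝ × E3 → ℝ} (hf : ContDiff ℝ (⊤ : ℕ∞) f) (T : ℝ) (c : E3) :
    (σ : Measure S2).real Set.univ * f (T, c) = kirchhoff f T c T -
      ∫ ρ in (0 : ℝ)..T, ρ * ∫ ω : S2, (∑ i, pd (es i) (pd (es i) f) (T - ρ, c + ρ • (ω : E3)) -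
        pd et (pd et f) (T - ρ, c + ρ • (ω : E3))) ∂σ := by
  have hc : ∀ g : ℝ × E3 → ℝ, ContDiff ℝ (⊤ : ℕ∞) g → Continuous fun q : ℝ × S2 =>
      g (T - q.1, c + q.1 • (q.2 : E3)) := fun g hg => hg.continuous.comp (by fun_prop)
  rw [intervalIntegral.integral_eq_sub_of_hasDerivAt
    (fun ρ _ => hasDerivAt_kirchhoff hf T c ρ)]
  · have : kirchhoff f T c 0 = (σ : Measure S2).real Set.univ * f (T, c) := by
      simp [kirchhoff]
    rw [this]; ring
  · apply Continuous.intervalIntegrable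
    apply continuous_id.mul
    apply continuous_integral_sphere
    have h1 := hc _ ((hf.pd et).pd et)
    have h4 := fun i j => hc _ ((hf.pd (es i)).pd (es j))
    simp only [Function.uncurry_def]
    fun_prop

/-- Exchange of the order of integration over a triangle. -/
theorem integral_triangle_swap {f : ℝ → ℝ → ℝ} (hf : Continuous (Function.uncurry f)) {T : ℝ}
    (hT : 0 ≤ T) : ∫ r in (0 : ℝ)..T, ∫ t in (0 : ℝ)..(T - r), f t r =
      ∫ t in (0 : ℝ)..T, ∫ r in (0 : ℝ)..(T - t), f t r := by
  have key : ∀ g : ℝ → ℝ, ∀ s ∈ Set.Ioc 0 T, ∫ t in (0 : ℝ)..(T - s), g t =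
      ∫ t in Set.Ioc 0 T, if t + s ≤ T then g t else 0 := by
    intro g s hs
    rw [intervalIntegral.integral_of_le (by linarith [hs.2])]
    have h1 : Set.Ioc 0 (T - s) = Set.Ioc 0 T ∩ {t | t + s ≤ T} := by
      ext t; simp only [Set.mem_Ioc, Set.mem_inter_iff, Set.mem_ofPred_eq]
      constructor
      · intro h; refine ⟨⟨h.1, ?_⟩, ?_⟩ <;> linarith [h.2, hs.1]
      · intro h; exact ⟨h.1.1, by linarith [h.2]⟩
    have hm : MeasurableSet {t : ℝ | t + s ≤ T} := measurableSet_le (by fun_prop) (by fun_prop)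
    rw [h1, ← setIntegral_indicator hm]
    rfl
  rw [intervalIntegral.integral_of_le hT, intervalIntegral.integral_of_le hT,
    setIntegral_congr_fun measurableSet_Ioc (fun r hr => key (fun t => f t r) r hr),
    setIntegral_congr_fun measurableSet_Ioc (fun t ht => key (fun r => f t r) t ht)]
  have hswap := integral_integral_swap (μ := volume.restrict (Set.Ioc 0 T))
    (ν := volume.restrict (Set.Ioc 0 T)) (f := fun r t => if t + r ≤ T then f t r else 0) ?_
  · rw [hswap]; simp only [add_comm]
  · obtain ⟨C, hC⟩ := ((isCompact_Icc (a := (0:ℝ)) (b := T)).prod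
      (isCompact_Icc (a := (0:ℝ)) (b := T))).exists_bound_of_continuousOn hf.continuousOn
    have hm : MeasurableSet {q : ℝ × ℝ | q.2 + q.1 ≤ T} :=
      measurableSet_le (by fun_prop) (by fun_prop)
    have hf' : Continuous fun q : ℝ × ℝ => f q.2 q.1 := hf.comp continuous_swap
    rw [Measure.prod_restrict]
    refine Measure.integrableOn_of_bounded (M := C) ?_ ?_ ?_
    · rw [← Measure.volume_eq_prod, Measure.volume_eq_prod, Measure.prod_prod]
      exact ENNReal.mul_ne_top (by simp) (by simp)
    · exact (Measurable.ite hm hf'.measurable measurable_const).aestronglyMeasurable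
    · refine ae_restrict_of_forall_mem (measurableSet_Ioc.prod measurableSet_Ioc) ?_
      rintro ⟨r, t⟩ ⟨hr, ht⟩
      have h := hC (t, r) ⟨⟨ht.1.le, ht.2⟩, ⟨hr.1.le, hr.2⟩⟩
      simp only [Function.uncurry_def]
      split_ifs
      · exact h
      · simpa using (norm_nonneg _).trans h

/-- The flux of a current with nonpositive divergence through a backward light cone is bounded by
its initial density. -/
theorem cone_flux_le {J0 : ℝ × E3 → ℝ} {J : Fin 3 → ℝ × E3 → ℝ} (hJ0 : ContDiff ℝ 1 J0)
    (hJ : ∀ i, ContDiff ℝ 1 (J i)) {T : ℝ} (hT : 0 ≤ T) (c : E3)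
    (hdiv : ∀ t r : ℝ, 0 ≤ t → 0 ≤ r → t + r ≤ T → ∀ ω : S2,
      pd et J0 (t, c + r • (ω : E3)) + ∑ i, pd (es i) (J i) (t, c + r • (ω : E3)) ≤ 0) :
    ∫ r in (0 : ℝ)..T, r ^ 2 * ∫ ω : S2, (J0 (T - r, c + r • (ω : E3)) +
        ∑ i, (ω : E3) i * J i (T - r, c + r • (ω : E3))) ∂σ ≤
      ∫ r in (0 : ℝ)..T, r ^ 2 * ∫ ω : S2, J0 (0, c + r • (ω : E3)) ∂σ := by
  have hpd : ∀ g : ℝ × E3 → ℝ, ContDiff ℝ 1 g → ∀ v, Continuous (pd v g) := fun g hg v =>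
    (hg.continuous_fderiv (by norm_num)).clm_apply continuous_const
  have hc3 : ∀ g : ℝ × E3 → ℝ, Continuous g → Continuous fun q : (ℝ × ℝ) × S2 =>
      g (q.1.1, c + q.1.2 • (q.2 : E3)) := fun g hg => hg.comp (by fun_prop)
  have hct : ∀ g : ℝ × E3 → ℝ, Continuous g → ∀ r : ℝ, Continuous fun q : ℝ × S2 =>
      g (q.1, c + r • (q.2 : E3)) := fun g hg r => hg.comp (by fun_prop)
  have hcr : ∀ g : ℝ × E3 → ℝ, Continuous g → ∀ t : ℝ, Continuous fun q : ℝ × S2 =>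
      g (t, c + q.1 • (q.2 : E3)) := fun g hg r => hg.comp (by fun_prop)
  have hcω : ∀ g : ℝ × E3 → ℝ, Continuous g → ∀ t r : ℝ, Continuous fun ω : S2 =>
      g (t, c + r • (ω : E3)) := fun g hg t r => hg.comp (by fun_prop)
  have hcoord : ∀ i : Fin 3, Continuous fun ω : S2 => (ω : E3) i := fun i => by fun_prop
  let a : ℝ → ℝ → ℝ := fun t r => r ^ 2 * ∫ ω : S2, J0 (t, c + r • (ω : E3)) ∂σ
  let b : ℝ → ℝ → ℝ := fun t r => r ^ 2 * ∫ ω : S2, ∑ i, (ω : E3) i * J i (t, c + r • (ω : E3)) ∂σ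
  let a' : ℝ → ℝ → ℝ := fun t r => r ^ 2 * ∫ ω : S2, pd et J0 (t, c + r • (ω : E3)) ∂σ
  let b' : ℝ → ℝ → ℝ := fun t r => r ^ 2 * ∫ ω : S2, ∑ i, pd (es i) (J i) (t, c + r • (ω : E3)) ∂σ
  have hac : Continuous (Function.uncurry a) := by
    have h1 := hc3 _ hJ0.continuous
    exact (by fun_prop : Continuous fun q : ℝ × ℝ => q.2 ^ 2).mul
      (continuous_integral_sphere (X := ℝ × ℝ) h1)
  have hbc : Continuous (Function.uncurry b) := by
    have h1 := fun i => hc3 _ (hJ i).continuous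
    refine (by fun_prop : Continuous fun q : ℝ × ℝ => q.2 ^ 2).mul
      (continuous_integral_sphere (X := ℝ × ℝ)
        (F := fun q ω => ∑ i, (ω : E3) i * J i (q.1, c + q.2 • (ω : E3))) ?_)
    simp only [Function.uncurry_def]
    fun_prop
  have ha'c : Continuous (Function.uncurry a') := by
    have h1 := hc3 _ (hpd _ hJ0 et)
    exact (by fun_prop : Continuous fun q : ℝ × ℝ => q.2 ^ 2).mul
      (continuous_integral_sphere (X := ℝ × ℝ) h1)
  have hb'c : Continuous (Function.uncurry b') := by
    have h1 := fun i => hc3 _ (hpd _ (hJ i) (es i))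
    refine (by fun_prop : Continuous fun q : ℝ × ℝ => q.2 ^ 2).mul
      (continuous_integral_sphere (X := ℝ × ℝ)
        (F := fun q ω => ∑ i, pd (es i) (J i) (q.1, c + q.2 • (ω : E3))) ?_)
    simp only [Function.uncurry_def]
    fun_prop
  have had : ∀ t r, HasDerivAt (fun t => a t r) (a' t r) t := by
    intro t r
    refine HasDerivAt.const_mul _ (hasDerivAt_integral_sphere
      (F := fun t ω => J0 (t, c + r • (ω : E3)))
      (F' := fun t ω => pd et J0 (t, c + r • (ω : E3)))
      (fun t => hcω _ hJ0.continuous t r) (hct _ (hpd _ hJ0 et) r) (fun t ω => ?_) t)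
    have h1 : HasDerivAt (fun s : ℝ => (s, c + r • (ω : E3))) et t :=
      (hasDerivAt_id t).prodMk (hasDerivAt_const _ _)
    exact ((hJ0.differentiable (by norm_num) _).hasFDerivAt).comp_hasDerivAt t h1
  have hbd : ∀ t r, HasDerivAt (fun r => b t r) (b' t r) r := by
    intro t r
    have h := hasDerivAt_integral_sphere
      (F := fun r ω => ∑ i, (ω : E3) i * J i (t, c + r • (ω : E3)))
      (F' := fun r ω => ∑ i, (ω : E3) i * ∑ j, (ω : E3) j * pd (es j) (J i) (t, c + r • (ω : E3)))
      (fun r => by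
        have h1 := fun i => hcω _ (hJ i).continuous t r
        fun_prop)
      (by
        have h1 := fun i j => hcr _ (hpd _ (hJ i) (es j)) t
        simp only [Function.uncurry_def]
        fun_prop)
      (fun r ω => by
        refine HasDerivAt.fun_sum fun i _ => HasDerivAt.const_mul _ ?_
        have h1 : HasDerivAt (fun s : ℝ => (t, c + s • (ω : E3))) (0, (ω : E3)) r := by
          refine (hasDerivAt_const _ _).prodMk ?_
          simpa using ((hasDerivAt_id r).smul_const (ω : E3)).const_add c
        have h2 := (((hJ i).differentiable (by norm_num)
          (t, c + r • (ω : E3))).hasFDerivAt).comp_hasDerivAt r h1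
        rw [fderiv_prod_eq] at h2
        exact h2.congr_deriv (by ring)) r
    refine ((hasDerivAt_pow 2 r).mul h).congr_deriv ?_
    have hV : ∀ i, ContDiff ℝ 1 (fun x => J i (t, x)) := fun i =>
      (hJ i).comp (contDiff_prodMk_right t)
    have hd := integral_sphere_div (fun i x => J i (t, x)) hV c r
    simp only [fun i x v => fderiv_slice (hJ i) t x v] at hd
    have hd' := congrArg (fun z => -r * z) hd
    simp only [mul_zero] at hd'
    have e1 : Continuous fun ω : S2 => ∑ i, (ω : E3) i * J i (t, c + r • (ω : E3)) := by
      have h1 := fun i => hcω _ (hJ i).continuous t r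
      fun_prop
    have e2 : Continuous fun ω : S2 =>
        ∑ i, (ω : E3) i * ∑ j, (ω : E3) j * pd (es j) (J i) (t, c + r • (ω : E3)) := by
      have h1 := fun i j => hcω _ (hpd _ (hJ i) (es j)) t r
      fun_prop
    have e3 : Continuous fun ω : S2 => ∑ i, pd (es i) (J i) (t, c + r • (ω : E3)) := by
      have h1 := fun i j => hcω _ (hpd _ (hJ i) (es j)) t r
      fun_prop
    rw [← sub_eq_zero, ← hd']
    simp only [b']
    rw [← integral_const_mul, ← integral_const_mul, ← integral_const_mul, ← integral_const_mul,
      ← integral_add, ← integral_sub]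
    · refine integral_congr_ae (ae_of_all _ fun ω => ?_)
      simp [Fin.sum_univ_three, ee]
      ring
    · exact ((continuous_const.mul e1).add (continuous_const.mul e2)).integrable_sphere
    · exact (continuous_const.mul e3).integrable_sphere
    · exact (continuous_const.mul e1).integrable_sphere
    · exact (continuous_const.mul e2).integrable_sphere
  have hFa : ∫ r in (0 : ℝ)..T, (a (T - r) r - a 0 r) =
      ∫ r in (0 : ℝ)..T, ∫ t in (0 : ℝ)..(T - r), a' t r := by
    refine intervalIntegral.integral_congr fun r _ => ?_
    rw [intervalIntegral.integral_eq_sub_of_hasDerivAt (fun t _ => had t r)]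
    exact (ha'c.comp (by fun_prop : Continuous fun t : ℝ => (t, r))).intervalIntegrable _ _
  have hFb : ∫ r in (0 : ℝ)..T, b (T - r) r =
      ∫ t in (0 : ℝ)..T, ∫ r in (0 : ℝ)..(T - t), b' t r := by
    have h1 := intervalIntegral.integral_comp_sub_left (a := 0) (b := T) (fun t => b t (T - t)) T
    simp only [sub_sub_cancel, sub_self, sub_zero] at h1
    rw [h1]
    refine intervalIntegral.integral_congr fun t _ => ?_
    rw [intervalIntegral.integral_eq_sub_of_hasDerivAt (fun r _ => hbd t r)]
    · simp [b]
    · exact (hb'c.comp (by fun_prop : Continuous fun r : ℝ => (t, r))).intervalIntegrable _ _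
  rw [← integral_triangle_swap hb'c hT] at hFb
  have hneg : ∫ r in (0 : ℝ)..T, ∫ t in (0 : ℝ)..(T - r), (a' t r + b' t r) ≤ 0 := by
    have hle : ∀ r ∈ Set.Icc (0:ℝ) T, ∫ t in (0 : ℝ)..(T - r), (a' t r + b' t r) ≤ 0 := by
      intro r hr
      have : 0 ≤ ∫ t in (0 : ℝ)..(T - r), -(a' t r + b' t r) := by
        refine intervalIntegral.integral_nonneg (by linarith [hr.2]) fun t ht => ?_
        simp only [a', b']
        rw [← mul_add, ← integral_add]
        · rw [← mul_neg, ← integral_neg]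
          refine mul_nonneg (sq_nonneg r) (integral_nonneg fun ω => ?_)
          have := hdiv t r ht.1 hr.1 (by linarith [ht.2]) ω
          simp only [Pi.zero_apply]
          linarith
        · exact (hcω _ (hpd _ hJ0 et) t r).integrable_sphere
        · have h1 := fun i => hcω _ (hpd _ (hJ i) (es i)) t r
          exact Continuous.integrable_sphere (by fun_prop)
      rw [intervalIntegral.integral_neg] at this
      linarith
    rw [intervalIntegral.integral_of_le hT]
    exact setIntegral_nonpos measurableSet_Ioc fun r hr => hle r ⟨hr.1.le, hr.2⟩
  have hi1 : ∀ r, IntervalIntegrable (fun t => a' t r) volume 0 (T - r) := fun r =>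
    (ha'c.comp (by fun_prop : Continuous fun t : ℝ => (t, r))).intervalIntegrable _ _
  have hi2 : ∀ r, IntervalIntegrable (fun t => b' t r) volume 0 (T - r) := fun r =>
    (hb'c.comp (by fun_prop : Continuous fun t : ℝ => (t, r))).intervalIntegrable _ _
  have hcI : ∀ f : ℝ → ℝ → ℝ, Continuous (Function.uncurry f) →
      Continuous fun r : ℝ => ∫ t in (0 : ℝ)..(T - r), f t r := by
    intro f hf
    exact intervalIntegral.continuous_parametric_intervalIntegral_of_continuous
      (f := fun r t => f t r) (hf.comp continuous_swap) (by fun_prop)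
  simp only [fun r => intervalIntegral.integral_add (hi1 r) (hi2 r)] at hneg
  rw [intervalIntegral.integral_add ((hcI _ ha'c).intervalIntegrable _ _)
    ((hcI _ hb'c).intervalIntegrable _ _), ← hFa, ← hFb] at hneg
  have i1 : IntervalIntegrable (fun r => a (T - r) r) volume 0 T :=
    (hac.comp (by fun_prop : Continuous fun r : ℝ => (T - r, r))).intervalIntegrable _ _
  have i2 : IntervalIntegrable (fun r => a 0 r) volume 0 T :=
    (hac.comp (by fun_prop : Continuous fun r : ℝ => ((0 : ℝ), r))).intervalIntegrable _ _
  have i3 : IntervalIntegrable (fun r => b (T - r) r) volume 0 T :=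
    (hbc.comp (by fun_prop : Continuous fun r : ℝ => (T - r, r))).intervalIntegrable _ _
  rw [intervalIntegral.integral_sub i1 i2] at hneg
  have hsum : ∫ r in (0 : ℝ)..T, r ^ 2 * ∫ ω : S2, (J0 (T - r, c + r • (ω : E3)) +
        ∑ i, (ω : E3) i * J i (T - r, c + r • (ω : E3))) ∂σ =
      (∫ r in (0 : ℝ)..T, a (T - r) r) + ∫ r in (0 : ℝ)..T, b (T - r) r := by
    rw [← intervalIntegral.integral_add i1 i3]
    refine intervalIntegral.integral_congr fun r _ => ?_
    simp only [a, b]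
    rw [← mul_add, ← integral_add]
    · exact (hcω _ hJ0.continuous _ r).integrable_sphere
    · have h1 := fun i => hcω _ (hJ i).continuous (T - r) r
      exact Continuous.integrable_sphere (by fun_prop)
  rw [hsum]
  have : ∫ r in (0 : ℝ)..T, r ^ 2 * ∫ ω : S2, J0 (0, c + r • (ω : E3)) ∂σ =
    ∫ r in (0 : ℝ)..T, a 0 r := rfl
  rw [this]
  linarith

theorem hasDerivAt_line {f : ℝ × E3 → ℝ} {q : ℝ × E3} (hf : DifferentiableAt ℝ f q)
    (v : ℝ × E3) : HasDerivAt (fun s : ℝ => f (q + s • v)) (pd v f q) 0 := by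
  have h1 : HasDerivAt (fun s : ℝ => q + s • v) v 0 := by
    simpa using ((hasDerivAt_id (0 : ℝ)).smul_const v).const_add q
  have h2 : HasFDerivAt f (fderiv ℝ f q) (q + (0 : ℝ) • v) := by simpa using hf.hasFDerivAt
  exact h2.comp_hasDerivAt 0 h1

theorem pd_eq_of_hasDerivAt_line {f : ℝ × E3 → ℝ} {q v : ℝ × E3} {d : ℝ}
    (hf : DifferentiableAt ℝ f q) (h : HasDerivAt (fun s : ℝ => f (q + s • v)) d 0) :
    pd v f q = d :=
  (hasDerivAt_line hf v).unique h

theorem dt1_eq_pd {φ : ℝ → E3 → ℝ} (hφ : ContDiff ℝ (⊤ : ℕ∞) fun q : ℝ × E3 => φ q.1 q.2)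
    (t : ℝ) (x : E3) : dt1 φ t x = pd et (fun q : ℝ × E3 => φ q.1 q.2) (t, x) := by
  have h1 : HasDerivAt (fun s : ℝ => (s, x)) et t :=
    (hasDerivAt_id t).prodMk (hasDerivAt_const _ _)
  exact (((hφ.differentiable (by simp) (t, x)).hasFDerivAt).comp_hasDerivAt t h1).deriv

theorem dtt_eq_pd {φ : ℝ → E3 → ℝ} (hφ : ContDiff ℝ (⊤ : ℕ∞) fun q : ℝ × E3 => φ q.1 q.2)
    (t : ℝ) (x : E3) : dtt φ t x = pd et (pd et fun q : ℝ × E3 => φ q.1 q.2) (t, x) := by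
  have h := hφ.pd et
  have h1 : HasDerivAt (fun s : ℝ => (s, x)) et t :=
    (hasDerivAt_id t).prodMk (hasDerivAt_const _ _)
  simp only [dtt, dt1_eq_pd hφ]
  exact (((h.differentiable (by simp) (t, x)).hasFDerivAt).comp_hasDerivAt t h1).deriv

theorem fderiv_slice_ee {f : ℝ × E3 → ℝ} (hf : ContDiff ℝ (⊤ : ℕ∞) f) (t : ℝ) (x : E3)
    (i : Fin 3) : fderiv ℝ (fun y => f (t, y)) x (ee i) = pd (es i) f (t, x) := by
  have h1 : HasFDerivAt (fun y : E3 => (t, y)) (ContinuousLinearMap.inr ℝ ℝ E3) x :=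
    hasFDerivAt_prodMk_right t x
  have h2 := ((hf.differentiable (by simp) (t, x)).hasFDerivAt).comp x h1
  have h4 : fderiv ℝ (fun y => f (t, y)) x = _ := h2.fderiv
  rw [h4]; rfl

theorem lap3_eq_pd {φ : ℝ → E3 → ℝ} (hφ : ContDiff ℝ (⊤ : ℕ∞) fun q : ℝ × E3 => φ q.1 q.2)
    (t : ℝ) (x : E3) :
    lap3 (φ t) x = ∑ i, pd (es i) (pd (es i) fun q : ℝ × E3 => φ q.1 q.2) (t, x) := by
  unfold lap3 der2
  refine Finset.sum_congr rfl fun i _ => ?_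
  rw [← fderiv_slice_ee (hφ.pd (es i))]
  simp only [← fderiv_slice_ee hφ]

/-- The nonlinear wave equation in terms of derivatives on spacetime. -/
def SolvesNLW (p : ℝ) (f : ℝ × E3 → ℝ) : Prop :=
  ∀ q : ℝ × E3, 0 ≤ q.1 →
    pd et (pd et f) q - ∑ i, pd (es i) (pd (es i) f) q + |f q| ^ (p - 1) * f q = 0

theorem IsNLWSolution.solvesNLW {p : ℝ} {φ : ℝ → E3 → ℝ} (h : IsNLWSolution p φ) :
    SolvesNLW p fun q => φ q.1 q.2 := by
  rintro ⟨t, x⟩ hq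
  rw [← dtt_eq_pd h.1, ← lap3_eq_pd h.1]
  exact h.2 t hq x

/-- The potential energy density. -/
def pot (p : ℝ) (f : ℝ × E3 → ℝ) (q : ℝ × E3) : ℝ := |f q| ^ (p + 1) / (p + 1)

theorem contDiff_pot {p : ℝ} (hp : 2 < p) {f : ℝ × E3 → ℝ} (hf : ContDiff ℝ (⊤ : ℕ∞) f) :
    ContDiff ℝ 1 (pot p f) :=
  ((contDiff_norm_rpow (E := ℝ) (p := p + 1) (by linarith)).comp
    (hf.of_le (by exact_mod_cast le_top))).div_const _

theorem pot_nonneg {p : ℝ} (hp : 2 < p) (f : ℝ × E3 → ℝ) (q : ℝ × E3) : 0 ≤ pot p f q := by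
  unfold pot; positivity

theorem pot_eq {p : ℝ} (hp : 2 < p) (f : ℝ × E3 → ℝ) (q : ℝ × E3) :
    (p + 1) * pot p f q = |f q| ^ (p - 1) * f q * f q := by
  have h : |f q| ^ (p + 1) = |f q| ^ (p - 1) * |f q| ^ (2 : ℝ) := by
    rw [← rpow_add_of_nonneg (abs_nonneg _) (by linarith) (by norm_num)]; ring_nf
  rw [pot, mul_div_cancel₀ _ (by linarith), h, rpow_two, sq_abs]
  ring

theorem hasDerivAt_pot_line {p : ℝ} (hp : 2 < p) {f : ℝ × E3 → ℝ}
    (hf : ContDiff ℝ (⊤ : ℕ∞) f) (q v : ℝ × E3) :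
    HasDerivAt (fun s : ℝ => pot p f (q + s • v)) (|f q| ^ (p - 1) * f q * pd v f q) 0 := by
  have h1 := hasDerivAt_line (hf.differentiable (by simp) q) v
  have h2 := hasDerivAt_abs_rpow (f (q + (0:ℝ) • v)) (p := p + 1) (by linarith)
  have h3 := (HasDerivAt.scomp (0 : ℝ) h2 h1).div_const (p + 1)
  refine h3.congr_deriv ?_
  have : p + 1 ≠ 0 := by linarith
  simp only [zero_smul, add_zero, smul_eq_mul]
  rw [show p + 1 - 2 = p - 1 by ring]
  field_simp

/-- Energy density. -/
def enDen (p : ℝ) (f : ℝ × E3 → ℝ) (q : ℝ × E3) : ℝ :=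
  pd et f q ^ 2 / 2 + (∑ i, pd (es i) f q ^ 2) / 2 + pot p f q

/-- Energy flux. -/
def enFlux (f : ℝ × E3 → ℝ) (i : Fin 3) (q : ℝ × E3) : ℝ := -(pd et f q * pd (es i) f q)

theorem contDiff_enDen {p : ℝ} (hp : 2 < p) {f : ℝ × E3 → ℝ} (hf : ContDiff ℝ (⊤ : ℕ∞) f) :
    ContDiff ℝ 1 (enDen p f) := by
  have h1 : ∀ v, ContDiff ℝ 1 (pd v f) := fun v => (hf.pd v).of_le (by exact_mod_cast le_top)
  have h2 := contDiff_pot hp hf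
  unfold enDen
  fun_prop

theorem contDiff_enFlux {f : ℝ × E3 → ℝ} (hf : ContDiff ℝ (⊤ : ℕ∞) f) (i : Fin 3) :
    ContDiff ℝ 1 (enFlux f i) := by
  have h1 : ∀ v, ContDiff ℝ 1 (pd v f) := fun v => (hf.pd v).of_le (by exact_mod_cast le_top)
  unfold enFlux
  fun_prop

theorem en_div {p : ℝ} (hp : 2 < p) {f : ℝ × E3 → ℝ} (hf : ContDiff ℝ (⊤ : ℕ∞) f)
    (h : SolvesNLW p f) (q : ℝ × E3) (hq : 0 ≤ q.1) :
    pd et (enDen p f) q + ∑ i, pd (es i) (enFlux f i) q = 0 := by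
  have hl : ∀ u v, HasDerivAt (fun s : ℝ => pd u f (q + s • v)) (pd v (pd u f) q) 0 :=
    fun u v => hasDerivAt_line ((hf.pd u).differentiable (by simp) q) v
  have h0 : pd et (enDen p f) q = pd et f q * pd et (pd et f) q +
      ∑ i, pd (es i) f q * pd (es i) (pd et f) q + |f q| ^ (p - 1) * f q * pd et f q := by
    refine pd_eq_of_hasDerivAt_line ((contDiff_enDen hp hf).differentiable (by simp) q) ?_
    refine (((((hl et et).pow 2).div_const 2)).add
      ((HasDerivAt.fun_sum (u := Finset.univ) fun i _ => (hl (es i) et).pow 2).div_const 2) |>.add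
      (hasDerivAt_pot_line hp hf q et)).congr_deriv ?_
    simp [Fin.sum_univ_three, pd_comm hf et (es _)]
    ring
  have hi : ∀ i, pd (es i) (enFlux f i) q = -(pd (es i) (pd et f) q * pd (es i) f q +
      pd et f q * pd (es i) (pd (es i) f) q) := by
    intro i
    refine pd_eq_of_hasDerivAt_line ((contDiff_enFlux hf i).differentiable (by simp) q) ?_
    refine ((hl et (es i)).mul (hl (es i) (es i))).neg.congr_deriv ?_
    simp
  have := h q hq
  rw [h0]
  simp only [hi, Fin.sum_univ_three] at this ⊢
  linear_combination (pd et f q) * this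

/-- The components of the outward radial unit vector. -/
def nn (i : Fin 3) (q : ℝ × E3) : ℝ := q.2 i * ‖q.2‖⁻¹

/-- The radial derivative. -/
def prad (f : ℝ × E3 → ℝ) (q : ℝ × E3) : ℝ := ∑ i, nn i q * pd (es i) f q

/-- The outgoing derivative of `r f`, divided by `r`. -/
def outg (f : ℝ × E3 → ℝ) (q : ℝ × E3) : ℝ := pd et f q + prad f q + ‖q.2‖⁻¹ * f q

/-- The components of the angular gradient. -/
def angd (f : ℝ × E3 → ℝ) (i : Fin 3) (q : ℝ × E3) : ℝ := pd (es i) f q - nn i q * prad f q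

/-- Density of the `r`-weighted energy. -/
def rwDen (p γ : ℝ) (f : ℝ × E3 → ℝ) (q : ℝ × E3) : ℝ :=
  ‖q.2‖ ^ γ * (outg f q ^ 2 / 2 + (∑ i, angd f i q ^ 2) / 2 + pot p f q)

/-- Flux of the `r`-weighted energy. -/
def rwFlux (p γ : ℝ) (f : ℝ × E3 → ℝ) (i : Fin 3) (q : ℝ × E3) : ℝ :=
  ‖q.2‖ ^ γ * (nn i q * (-(outg f q ^ 2 / 2) + (∑ i, angd f i q ^ 2) / 2 + pot p f q) -
    outg f q * angd f i q)

theorem norm_sq_fin_three (x : E3) : ‖x‖ ^ 2 = x 0 ^ 2 + x 1 ^ 2 + x 2 ^ 2 := by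
  have := EuclideanSpace.norm_sq_eq x
  simpa [Fin.sum_univ_three] using this

theorem nn_sq {q : ℝ × E3} (hq : q.2 ≠ 0) : nn 0 q ^ 2 + nn 1 q ^ 2 + nn 2 q ^ 2 = 1 := by
  have h := norm_sq_fin_three q.2
  have h0 : ‖q.2‖ ≠ 0 := norm_ne_zero_iff.2 hq
  simp only [nn]
  field_simp
  linarith

section regularity

variable {p γ : ℝ} {f : ℝ × E3 → ℝ} {q : ℝ × E3}

theorem contDiffAt_norm_snd (hq : q.2 ≠ 0) : ContDiffAt ℝ 1 (fun q : ℝ × E3 => ‖q.2‖) q :=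
  contDiffAt_snd.norm ℝ hq

theorem contDiffAt_inv_norm_snd (hq : q.2 ≠ 0) :
    ContDiffAt ℝ 1 (fun q : ℝ × E3 => ‖q.2‖⁻¹) q :=
  (contDiffAt_norm_snd hq).inv (norm_ne_zero_iff.2 hq)

theorem contDiffAt_nn (hq : q.2 ≠ 0) (i : Fin 3) : ContDiffAt ℝ 1 (nn i) q := by
  have := contDiffAt_inv_norm_snd hq
  unfold nn
  fun_prop

theorem contDiffAt_prad (hf : ContDiff ℝ (⊤ : ℕ∞) f) (hq : q.2 ≠ 0) :
    ContDiffAt ℝ 1 (prad f) q := by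
  have h1 : ∀ v, ContDiff ℝ 1 (pd v f) := fun v => (hf.pd v).of_le (by exact_mod_cast le_top)
  have := contDiffAt_nn hq
  unfold prad
  fun_prop

theorem contDiffAt_outg (hf : ContDiff ℝ (⊤ : ℕ∞) f) (hq : q.2 ≠ 0) :
    ContDiffAt ℝ 1 (outg f) q := by
  have h1 : ∀ v, ContDiff ℝ 1 (pd v f) := fun v => (hf.pd v).of_le (by exact_mod_cast le_top)
  have h2 : ContDiff ℝ 1 f := hf.of_le (by exact_mod_cast le_top)
  have := contDiffAt_prad hf hq
  have := contDiffAt_inv_norm_snd hq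
  unfold outg
  fun_prop

theorem contDiffAt_angd (hf : ContDiff ℝ (⊤ : ℕ∞) f) (hq : q.2 ≠ 0) (i : Fin 3) :
    ContDiffAt ℝ 1 (angd f i) q := by
  have h1 : ∀ v, ContDiff ℝ 1 (pd v f) := fun v => (hf.pd v).of_le (by exact_mod_cast le_top)
  have := contDiffAt_prad hf hq
  have := contDiffAt_nn hq
  unfold angd
  fun_prop

theorem contDiffAt_norm_rpow (hq : q.2 ≠ 0) (γ : ℝ) :
    ContDiffAt ℝ 1 (fun q : ℝ × E3 => ‖q.2‖ ^ γ) q :=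
  (contDiffAt_norm_snd hq).rpow_const_of_ne (norm_ne_zero_iff.2 hq)

theorem contDiffAt_rwDen (hp : 2 < p) (hf : ContDiff ℝ (⊤ : ℕ∞) f) (hq : q.2 ≠ 0) :
    ContDiffAt ℝ 1 (rwDen p γ f) q := by
  have h1 := contDiffAt_norm_rpow hq γ
  have h2 := contDiffAt_outg hf hq
  have h3 := contDiffAt_angd hf hq
  have h4 := (contDiff_pot hp hf).contDiffAt (x := q)
  unfold rwDen
  fun_prop

theorem contDiffAt_rwFlux (hp : 2 < p) (hf : ContDiff ℝ (⊤ : ℕ∞) f) (hq : q.2 ≠ 0) (i : Fin 3) :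
    ContDiffAt ℝ 1 (rwFlux p γ f i) q := by
  have h1 := contDiffAt_norm_rpow hq γ
  have h2 := contDiffAt_outg hf hq
  have h3 := contDiffAt_angd hf hq
  have h4 := (contDiff_pot hp hf).contDiffAt (x := q)
  have h5 := contDiffAt_nn hq
  unfold rwFlux
  fun_prop

end regularity

section divergence

variable {p γ : ℝ} {f : ℝ × E3 → ℝ} {q : ℝ × E3}

theorem hasDerivAt_norm_line (hq : q.2 ≠ 0) (k : Fin 3) :
    HasDerivAt (fun s : ℝ => ‖(q + s • es k).2‖) (nn k q) 0 := by
  have h0 : ‖q.2‖ ≠ 0 := norm_ne_zero_iff.2 hq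
  have h1 : HasDerivAt (fun s : ℝ => (q.2 + s • ee k)) (ee k) 0 := by
    simpa using ((hasDerivAt_id (0 : ℝ)).smul_const (ee k)).const_add q.2
  have h2 := h1.norm_sq.sqrt (by simp [hq])
  refine (h2.congr_deriv ?_).congr_of_eventuallyEq (Filter.Eventually.of_forall fun s => ?_)
  · simp [nn, EuclideanSpace.inner_single_right]
    field_simp
  · simp [Real.sqrt_sq]

theorem hasDerivAt_coord_line (i k : Fin 3) :
    HasDerivAt (fun s : ℝ => (q + s • es k).2 i) (ee k i) 0 := by
  simpa using ((hasDerivAt_id (0 : ℝ)).mul_const (ee k i)).const_add (q.2 i)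

theorem hasDerivAt_inv_norm_line (hq : q.2 ≠ 0) (k : Fin 3) :
    HasDerivAt (fun s : ℝ => ‖(q + s • es k).2‖⁻¹) (-(‖q.2‖⁻¹ ^ 2 * nn k q)) 0 := by
  refine ((hasDerivAt_norm_line hq k).fun_inv (by simpa using hq)).congr_deriv ?_
  simp
  ring

theorem hasDerivAt_norm_rpow_line (hq : q.2 ≠ 0) (γ : ℝ) (k : Fin 3) :
    HasDerivAt (fun s : ℝ => ‖(q + s • es k).2‖ ^ γ) (‖q.2‖ ^ γ * (γ * ‖q.2‖⁻¹ * nn k q)) 0 := by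
  refine ((hasDerivAt_norm_line hq k).rpow_const (p := γ) (Or.inl (by simpa using hq))).congr_deriv ?_
  have h0 : 0 < ‖q.2‖ := norm_pos_iff.2 hq
  simp [rpow_sub_one h0.ne']
  field_simp

theorem hasDerivAt_nn_line (hq : q.2 ≠ 0) (i k : Fin 3) :
    HasDerivAt (fun s : ℝ => nn i (q + s • es k)) (‖q.2‖⁻¹ * (ee k i - nn i q * nn k q)) 0 := by
  refine ((hasDerivAt_coord_line i k).mul (hasDerivAt_inv_norm_line hq k)).congr_deriv ?_
  simp only [nn, zero_smul, add_zero]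
  ring

theorem hasDerivAt_prad_line (hf : ContDiff ℝ (⊤ : ℕ∞) f) (hq : q.2 ≠ 0) (k : Fin 3) :
    HasDerivAt (fun s : ℝ => prad f (q + s • es k))
      (∑ j, nn j q * pd (es k) (pd (es j) f) q + ‖q.2‖⁻¹ * angd f k q) 0 := by
  have hl : ∀ u v, HasDerivAt (fun s : ℝ => pd u f (q + s • v)) (pd v (pd u f) q) 0 :=
    fun u v => hasDerivAt_line ((hf.pd u).differentiable (by simp) q) v
  refine (HasDerivAt.fun_sum (u := Finset.univ)
    fun j _ => (hasDerivAt_nn_line hq j k).mul (hl (es j) (es k))).congr_deriv ?_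
  simp [Fin.sum_univ_three, angd, prad]
  fin_cases k <;> simp <;> ring

theorem hasDerivAt_outg_line (hf : ContDiff ℝ (⊤ : ℕ∞) f) (hq : q.2 ≠ 0) (k : Fin 3) :
    HasDerivAt (fun s : ℝ => outg f (q + s • es k))
      (pd (es k) (pd et f) q +
        (∑ j, nn j q * pd (es k) (pd (es j) f) q + ‖q.2‖⁻¹ * angd f k q) +
        (‖q.2‖⁻¹ * pd (es k) f q - ‖q.2‖⁻¹ ^ 2 * nn k q * f q)) 0 := by
  have hl : ∀ u v, HasDerivAt (fun s : ℝ => pd u f (q + s • v)) (pd v (pd u f) q) 0 :=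
    fun u v => hasDerivAt_line ((hf.pd u).differentiable (by simp) q) v
  refine (((hl et (es k)).add (hasDerivAt_prad_line hf hq k)).add
    ((hasDerivAt_inv_norm_line hq k).mul
      (hasDerivAt_line (hf.differentiable (by simp) q) (es k)))).congr_deriv ?_
  simp
  ring

theorem hasDerivAt_angd_line (hf : ContDiff ℝ (⊤ : ℕ∞) f) (hq : q.2 ≠ 0) (i k : Fin 3) :
    HasDerivAt (fun s : ℝ => angd f i (q + s • es k))
      (pd (es k) (pd (es i) f) q - (‖q.2‖⁻¹ * (ee k i - nn i q * nn k q) * prad f q + nn i q *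
        (∑ j, nn j q * pd (es k) (pd (es j) f) q + ‖q.2‖⁻¹ * angd f k q))) 0 := by
  have hl : ∀ u v, HasDerivAt (fun s : ℝ => pd u f (q + s • v)) (pd v (pd u f) q) 0 :=
    fun u v => hasDerivAt_line ((hf.pd u).differentiable (by simp) q) v
  refine ((hl (es i) (es k)).sub ((hasDerivAt_nn_line hq i k).mul
    (hasDerivAt_prad_line hf hq k))).congr_deriv ?_
  simp

theorem nn_line_et (i : Fin 3) (s : ℝ) : nn i (q + s • et) = nn i q := by simp [nn]

theorem hasDerivAt_prad_line_et (hf : ContDiff ℝ (⊤ : ℕ∞) f) :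
    HasDerivAt (fun s : ℝ => prad f (q + s • et)) (prad (pd et f) q) 0 := by
  have hl : ∀ u v, HasDerivAt (fun s : ℝ => pd u f (q + s • v)) (pd v (pd u f) q) 0 :=
    fun u v => hasDerivAt_line ((hf.pd u).differentiable (by simp) q) v
  simp only [prad, nn_line_et, ← pd_comm hf et (es _)]
  exact HasDerivAt.fun_sum fun j _ => (hl (es j) et).const_mul _

theorem hasDerivAt_outg_line_et (hf : ContDiff ℝ (⊤ : ℕ∞) f) :
    HasDerivAt (fun s : ℝ => outg f (q + s • et)) (outg (pd et f) q) 0 := by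
  have hl : ∀ u v, HasDerivAt (fun s : ℝ => pd u f (q + s • v)) (pd v (pd u f) q) 0 :=
    fun u v => hasDerivAt_line ((hf.pd u).differentiable (by simp) q) v
  refine (((hl et et).add (hasDerivAt_prad_line_et hf)).add
    ((hasDerivAt_line (hf.differentiable (by simp) q) et).const_mul ‖q.2‖⁻¹)).congr_of_eventuallyEq
    (Filter.Eventually.of_forall fun s => ?_)
  simp [outg]

theorem hasDerivAt_angd_line_et (hf : ContDiff ℝ (⊤ : ℕ∞) f) (i : Fin 3) :
    HasDerivAt (fun s : ℝ => angd f i (q + s • et)) (angd (pd et f) i q) 0 := by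
  have hl : ∀ u v, HasDerivAt (fun s : ℝ => pd u f (q + s • v)) (pd v (pd u f) q) 0 :=
    fun u v => hasDerivAt_line ((hf.pd u).differentiable (by simp) q) v
  simp only [angd, nn_line_et, ← pd_comm hf et (es _)]
  exact (hl (es i) et).sub ((hasDerivAt_prad_line_et hf).const_mul _)

theorem nn_angd (hq : q.2 ≠ 0) :
    nn 0 q * angd f 0 q + nn 1 q * angd f 1 q + nn 2 q * angd f 2 q = 0 := by
  have h := nn_sq hq
  simp only [angd, prad, Fin.sum_univ_three]
  linear_combination (-(nn 0 q * pd (es 0) f q + nn 1 q * pd (es 1) f q + nn 2 q * pd (es 2) f q)) * h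

theorem pd_rwDen (hp : 2 < p) (hf : ContDiff ℝ (⊤ : ℕ∞) f) (hq : q.2 ≠ 0) :
    pd et (rwDen p γ f) q = ‖q.2‖ ^ γ * (outg f q * outg (pd et f) q +
      ∑ i, angd f i q * angd (pd et f) i q + |f q| ^ (p - 1) * f q * pd et f q) := by
  refine pd_eq_of_hasDerivAt_line ((contDiffAt_rwDen hp hf hq).differentiableAt (by simp)) ?_
  refine HasDerivAt.congr_of_eventuallyEq (HasDerivAt.congr_deriv
    (((((hasDerivAt_outg_line_et (q := q) hf).pow 2).div_const 2).add
    ((HasDerivAt.fun_sum (u := Finset.univ)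
      fun i _ => (hasDerivAt_angd_line_et (q := q) hf i).pow 2).div_const 2)).add
    (hasDerivAt_pot_line hp hf q et) |>.const_mul (‖q.2‖ ^ γ)) ?_)
    (Filter.Eventually.of_forall fun s => ?_)
  · simp only [zero_smul, add_zero, Fin.sum_univ_three]
    push_cast
    ring
  · simp [rwDen]

theorem pd_rwFlux (hp : 2 < p) (hf : ContDiff ℝ (⊤ : ℕ∞) f) (hq : q.2 ≠ 0) (k : Fin 3) :
    pd (es k) (rwFlux p γ f k) q = ‖q.2‖ ^ γ * (γ * ‖q.2‖⁻¹ * nn k q *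
        (nn k q * (-(outg f q ^ 2 / 2) + (∑ i, angd f i q ^ 2) / 2 + pot p f q) -
          outg f q * angd f k q) +
      (‖q.2‖⁻¹ * (1 - nn k q * nn k q) *
          (-(outg f q ^ 2 / 2) + (∑ i, angd f i q ^ 2) / 2 + pot p f q) +
        nn k q * (-(outg f q * (pd (es k) (pd et f) q +
          (∑ j, nn j q * pd (es k) (pd (es j) f) q + ‖q.2‖⁻¹ * angd f k q) +
          (‖q.2‖⁻¹ * pd (es k) f q - ‖q.2‖⁻¹ ^ 2 * nn k q * f q))) +
          ∑ i, angd f i q * (pd (es k) (pd (es i) f) q -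
            (‖q.2‖⁻¹ * (ee k i - nn i q * nn k q) * prad f q + nn i q *
            (∑ j, nn j q * pd (es k) (pd (es j) f) q + ‖q.2‖⁻¹ * angd f k q))) +
          |f q| ^ (p - 1) * f q * pd (es k) f q)) -
      ((pd (es k) (pd et f) q +
        (∑ j, nn j q * pd (es k) (pd (es j) f) q + ‖q.2‖⁻¹ * angd f k q) +
        (‖q.2‖⁻¹ * pd (es k) f q - ‖q.2‖⁻¹ ^ 2 * nn k q * f q)) * angd f k q +
      outg f q * (pd (es k) (pd (es k) f) q - (‖q.2‖⁻¹ * (1 - nn k q * nn k q) * prad f q +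
        nn k q * (∑ j, nn j q * pd (es k) (pd (es j) f) q + ‖q.2‖⁻¹ * angd f k q))))) := by
  refine pd_eq_of_hasDerivAt_line ((contDiffAt_rwFlux hp hf hq k).differentiableAt (by simp)) ?_
  have ho := hasDerivAt_outg_line hf hq k
  have ha := fun i => hasDerivAt_angd_line hf hq i k
  have h1 : ee k k = 1 := by simp
  refine HasDerivAt.congr_deriv ((hasDerivAt_norm_rpow_line hq γ k).mul
    (((hasDerivAt_nn_line hq k k).mul (((ho.pow 2).div_const 2).neg.add
      ((HasDerivAt.fun_sum (u := Finset.univ) fun i _ => (ha i).pow 2).div_const 2) |>.add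
      (hasDerivAt_pot_line hp hf q (es k)))).sub (ho.mul (ha k)))) ?_
  rw [h1]
  simp only [zero_smul, add_zero, Fin.sum_univ_three, Pi.add_apply,
    Pi.neg_apply, Pi.pow_apply]
  push_cast
  ring

theorem rw_div (hp : 2 < p) (hf : ContDiff ℝ (⊤ : ℕ∞) f) (h : SolvesNLW p f) (ht : 0 ≤ q.1)
    (hq : q.2 ≠ 0) :
    pd et (rwDen p γ f) q + ∑ i, pd (es i) (rwFlux p γ f i) q =
      -(‖q.2‖ ^ γ * ‖q.2‖⁻¹ * (γ * (outg f q ^ 2 / 2) +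
        (2 - γ) * ((∑ i, angd f i q ^ 2) / 2) + (p - 1 - γ) * pot p f q)) := by
  have hN := h q ht
  have hnn := nn_sq hq
  have hnm := nn_angd (f := f) hq
  have hP := pot_eq hp f q
  have hc : ∀ i j, pd (es i) (pd (es j) f) q = pd (es j) (pd (es i) f) q :=
    fun i j => pd_comm hf (es i) (es j) q
  have hct : ∀ i, pd et (pd (es i) f) q = pd (es i) (pd et f) q :=
    fun i => pd_comm hf et (es i) q
  rw [pd_rwDen hp hf hq]
  simp only [pd_rwFlux hp hf hq]
  have ho : outg f q = pd et f q + prad f q + ‖q.2‖⁻¹ * f q := rfl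
  have ho' : outg (pd et f) q = pd et (pd et f) q + prad (pd et f) q + ‖q.2‖⁻¹ * pd et f q := rfl
  have hm : ∀ i, pd (es i) f q = angd f i q + nn i q * prad f q := fun i => by simp [angd]
  have hm' : ∀ i, angd (pd et f) i q = pd (es i) (pd et f) q - nn i q * prad (pd et f) q :=
    fun i => rfl
  have hZ : prad (pd et f) q = ∑ i, nn i q * pd (es i) (pd et f) q := rfl
  have h00 : ee 0 0 = 1 := by simp
  have h11 : ee 1 1 = 1 := by simp
  have h22 : ee 2 2 = 1 := by simp
  have h01 : ee 0 1 = 0 := by simp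
  have h02 : ee 0 2 = 0 := by simp
  have h10 : ee 1 0 = 0 := by simp
  have h12 : ee 1 2 = 0 := by simp
  have h20 : ee 2 0 = 0 := by simp
  have h21 : ee 2 1 = 0 := by simp
  simp only [Fin.sum_univ_three, hm', hZ, ho', hm, h00, h11, h22, h01, h02, h10, h12, h20, h21,
    hc 1 0, hc 2 0, hc 2 1] at hN ⊢
  generalize ‖q.2‖⁻¹ = h at *
  generalize ‖q.2‖ ^ γ = G at *
  generalize nn 0 q = n0 at *
  generalize nn 1 q = n1 at *
  generalize nn 2 q = n2 at *
  generalize angd f 0 q = m0 at *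
  generalize angd f 1 q = m1 at *
  generalize angd f 2 q = m2 at *
  generalize pd (es 0) (pd et f) q = Z0 at *
  generalize pd (es 1) (pd et f) q = Z1 at *
  generalize pd (es 2) (pd et f) q = Z2 at *
  generalize pd (es 0) (pd (es 0) f) q = f00 at *
  generalize pd (es 0) (pd (es 1) f) q = f01 at *
  generalize pd (es 0) (pd (es 2) f) q = f02 at *
  generalize pd (es 1) (pd (es 1) f) q = f11 at *
  generalize pd (es 1) (pd (es 2) f) q = f12 at *
  generalize pd (es 2) (pd (es 2) f) q = f22 at *
  generalize pd et (pd et f) q = Zt at *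
  generalize prad f q = F at *
  generalize outg f q = l at *
  generalize pot p f q = P at *
  generalize |f q| ^ (p - 1) = N at *
  generalize pd et f q = Z at *
  generalize f q = u at *
  obtain rfl : Z = l - F - h * u := by linarith
  set D := -(l ^ 2 / 2) + (m0 ^ 2 + m1 ^ 2 + m2 ^ 2) / 2 + P with hD
  linear_combination G * ((γ * h * D - h * D - 2 * l * h * F + l * h ^ 2 * u + F * u * N) * hnn +
    (-(n0 * Z0 + n1 * Z1 + n2 * Z2) - γ * h * l - l * h - h * F +
      h * F * (n0 ^ 2 + n1 ^ 2 + n2 ^ 2) - h * (n0 * m0 + n1 * m1 + n2 * m2) -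
      (n0 * n0 * f00 + n1 * n1 * f11 + n2 * n2 * f22 +
        2 * (n0 * n1 * f01 + n0 * n2 * f02 + n1 * n2 * f12)) - h * F + h ^ 2 * u + u * N) * hnm +
    l * hN + h * hP + h * (γ + 2) * hD)

end divergence

/-- Spherical-shell integrals are dominated by volume integrals. -/
theorem shell_integral_le {a b : ℝ} (ha : 0 ≤ a) (hab : a ≤ b) (c : E3) (f : ℝ → S2 → ℝ)
    {G : E3 → ℝ} (hG : Measurable G)
    (h : ∀ r ∈ Set.Ioc a b, ∀ ω : S2, |f r ω| ≤ r ^ 2 * G (c + r • (ω : E3))) :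
    ENNReal.ofReal |∫ r in a..b, ∫ ω : S2, f r ω ∂σ| ≤
      ∫⁻ x in {x : E3 | ‖x - c‖ ∈ Set.Ioc a b}, ENNReal.ofReal (G x) := by
  rw [intervalIntegral.integral_of_le hab, ← Real.norm_eq_abs, ofReal_norm,
    ← lintegral_polar_shell _ hG.ennreal_ofReal c _ measurableSet_Ioc
      (fun r hr => ha.trans_lt hr.1)]
  refine (enorm_integral_le_lintegral_enorm _).trans ?_
  refine setLIntegral_mono' measurableSet_Ioc fun r hr => ?_
  refine (enorm_integral_le_lintegral_enorm _).trans ?_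
  rw [← lintegral_const_mul' _ _ ENNReal.ofReal_ne_top]
  refine lintegral_mono fun ω => ?_
  rw [← ENNReal.ofReal_mul (sq_nonneg r), Real.enorm_eq_ofReal_abs]
  exact ENNReal.ofReal_le_ofReal (h r hr ω)

/-- A current that is regular away from the spatial origin agrees, away from a neighbourhood of
the origin, with a globally regular one. -/
theorem exists_contDiff_eq_of_norm {J : ℝ × E3 → ℝ}
    (hJ : ∀ q : ℝ × E3, q.2 ≠ 0 → ContDiffAt ℝ 1 J q) :
    ∃ K : ℝ × E3 → ℝ, ContDiff ℝ 1 K ∧ ∀ q : ℝ × E3, 3 / 2 ≤ ‖q.2‖ → K q = J q := by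
  let χ : ContDiffBump (0 : E3) := ⟨1, 3 / 2, by norm_num, by norm_num⟩
  refine ⟨fun q => (1 - χ q.2) * J q, ?_, ?_⟩
  · rw [contDiff_iff_contDiffAt]
    intro q
    by_cases hq : q.2 = 0
    · have : (fun q : ℝ × E3 => (1 - χ q.2) * J q) =ᶠ[nhds q] fun _ => 0 := by
        have h1 : ∀ᶠ q' : ℝ × E3 in nhds q, ‖q'.2‖ < 1 := by
          refine ContinuousAt.eventually_lt (by fun_prop) continuousAt_const ?_
          simp [hq]
        filter_upwards [h1] with q' hq'
        rw [χ.one_of_mem_closedBall (by simpa using hq'.le)]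
        ring
      exact contDiffAt_const.congr_of_eventuallyEq this
    · have h1 : ContDiffAt ℝ 1 (fun q : ℝ × E3 => χ q.2) q :=
        (χ.contDiff.comp contDiff_snd).contDiffAt
      exact (contDiffAt_const.sub h1).mul (hJ q hq)
  · intro q hq
    have : χ q.2 = 0 := χ.zero_of_le_dist (by simpa using hq)
    simp [this]

theorem norm_add_smul_ge (c : E3) (ω : S2) {r : ℝ} (hr : 0 ≤ r) :
    ‖c‖ - r ≤ ‖c + r • (ω : E3)‖ := by
  have h := norm_sub_norm_le c (-(r • (ω : E3)))
  have h2 : ‖r • (ω : E3)‖ = r := by simp [norm_smul, abs_of_nonneg hr]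
  rw [norm_neg, h2, sub_neg_eq_add] at h
  exact h

/-- `cone_flux_le` for currents that are regular away from the spatial origin, on cones which stay
away from it. -/
theorem cone_flux_le_of_exterior {J0 : ℝ × E3 → ℝ} {J : Fin 3 → ℝ × E3 → ℝ}
    (hJ0 : ∀ q : ℝ × E3, q.2 ≠ 0 → ContDiffAt ℝ 1 J0 q)
    (hJ : ∀ i, ∀ q : ℝ × E3, q.2 ≠ 0 → ContDiffAt ℝ 1 (J i) q) {T : ℝ} (hT : 0 ≤ T) {c : E3}
    (hc : T + 2 ≤ ‖c‖)
    (hdiv : ∀ q : ℝ × E3, 0 ≤ q.1 → q.2 ≠ 0 → pd et J0 q + ∑ i, pd (es i) (J i) q ≤ 0) :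
    ∫ r in (0 : ℝ)..T, r ^ 2 * ∫ ω : S2, (J0 (T - r, c + r • (ω : E3)) +
        ∑ i, (ω : E3) i * J i (T - r, c + r • (ω : E3))) ∂σ ≤
      ∫ r in (0 : ℝ)..T, r ^ 2 * ∫ ω : S2, J0 (0, c + r • (ω : E3)) ∂σ := by
  obtain ⟨K0, hK0, hK0'⟩ := exists_contDiff_eq_of_norm hJ0
  choose K hK hK' using fun i => exists_contDiff_eq_of_norm (hJ i)
  have hfar : ∀ r ∈ Set.Icc 0 T, ∀ ω : S2, 2 ≤ ‖c + r • (ω : E3)‖ := fun r hr ω => by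
    have := norm_add_smul_ge c ω hr.1
    linarith [hr.2]
  have hpd : ∀ {A A' : ℝ × E3 → ℝ}, (∀ q : ℝ × E3, 3 / 2 ≤ ‖q.2‖ → A q = A' q) →
      ∀ q : ℝ × E3, 2 ≤ ‖q.2‖ → ∀ v, pd v A q = pd v A' q := by
    intro A A' hA q hq v
    have h1 : ∀ᶠ q' : ℝ × E3 in nhds q, 3 / 2 < ‖q'.2‖ :=
      continuousAt_const.eventually_lt (by fun_prop) (by linarith)
    have h2 : A =ᶠ[nhds q] A' := by
      filter_upwards [h1] with q' hq' using hA q' hq'.le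
    rw [pd, h2.fderiv_eq]; rfl
  have key := cone_flux_le hK0 hK hT c (fun t r ht hr htr ω => by
    have h2 := hfar r ⟨hr, by linarith⟩ ω
    rw [hpd hK0' (t, c + r • (ω : E3)) h2]
    simp only [fun i => hpd (hK' i) (t, c + r • (ω : E3)) h2 (es i)]
    exact hdiv _ ht (norm_pos_iff.1 (by linarith : 0 < ‖c + r • (ω : E3)‖)))
  have e1 : ∀ r ∈ Set.uIcc 0 T, ∀ (t : ℝ) (ω : S2),
      K0 (t, c + r • (ω : E3)) = J0 (t, c + r • (ω : E3)) := by
    intro r hr t ω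
    rw [Set.uIcc_of_le hT] at hr
    exact hK0' _ (by linarith [hfar r hr ω] : (3:ℝ) / 2 ≤ ‖c + r • (ω : E3)‖)
  have e2 : ∀ i, ∀ r ∈ Set.uIcc 0 T, ∀ (t : ℝ) (ω : S2),
      K i (t, c + r • (ω : E3)) = J i (t, c + r • (ω : E3)) := by
    intro i r hr t ω
    rw [Set.uIcc_of_le hT] at hr
    exact hK' i _ (by linarith [hfar r hr ω] : (3:ℝ) / 2 ≤ ‖c + r • (ω : E3)‖)
  rw [intervalIntegral.integral_congr (g := fun r => r ^ 2 * ∫ ω : S2,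
      (J0 (T - r, c + r • (ω : E3)) + ∑ i, (ω : E3) i * J i (T - r, c + r • (ω : E3))) ∂σ)
      (fun r hr => by simp only [e1 r hr, e2 _ r hr]),
    intervalIntegral.integral_congr (f := fun r => r ^ 2 * ∫ ω : S2, K0 (0, c + r • (ω : E3)) ∂σ)
      (g := fun r => r ^ 2 * ∫ ω : S2, J0 (0, c + r • (ω : E3)) ∂σ)
      (fun r hr => by simp only [e1 r hr])] at key
  exact key

theorem pot_le_en_flux {p : ℝ} (f : ℝ × E3 → ℝ) (q : ℝ × E3) (ω : S2) :
    pot p f q ≤ enDen p f q + ∑ i, (ω : E3) i * enFlux f i q := by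
  have hs := sphere_sum_sq ω
  simp only [enDen, enFlux, Fin.sum_univ_three]
  generalize pd et f q = Z
  generalize pd (es 0) f q = a
  generalize pd (es 1) f q = b
  generalize pd (es 2) f q = d
  generalize (ω : E3) 0 = x at *
  generalize (ω : E3) 1 = y at *
  generalize (ω : E3) 2 = z at *
  nlinarith [sq_nonneg (Z * x - a), sq_nonneg (Z * y - b), sq_nonneg (Z * z - d)]

theorem rw_pot_le_rw_flux {p γ : ℝ} (f : ℝ × E3 → ℝ) {q : ℝ × E3} (hq : q.2 ≠ 0) (ω : S2) :
    ‖q.2‖ ^ γ * ((1 + ∑ i, (ω : E3) i * nn i q) * pot p f q) ≤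
      rwDen p γ f q + ∑ i, (ω : E3) i * rwFlux p γ f i q := by
  have hs := sphere_sum_sq ω
  have hn := nn_sq hq
  have hm := nn_angd (f := f) hq
  have hG : 0 ≤ ‖q.2‖ ^ γ := by positivity
  simp only [rwDen, rwFlux, Fin.sum_univ_three]
  generalize ‖q.2‖ ^ γ = G at *
  generalize outg f q = l
  generalize pot p f q = P
  generalize angd f 0 q = a at *
  generalize angd f 1 q = b at *
  generalize angd f 2 q = d at *
  generalize nn 0 q = u at *
  generalize nn 1 q = v at *
  generalize nn 2 q = w at *
  generalize (ω : E3) 0 = x at *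
  generalize (ω : E3) 1 = y at *
  generalize (ω : E3) 2 = z at *
  obtain ⟨τ, hτ⟩ : ∃ τ, τ = x * u + y * v + z * w := ⟨_, rfl⟩
  obtain ⟨W, hW⟩ : ∃ W, W = x * a + y * b + z * d := ⟨_, rfl⟩
  obtain ⟨M, hM⟩ : ∃ M, M = a ^ 2 + b ^ 2 + d ^ 2 := ⟨_, rfl⟩
  have h1 : 0 ≤ 1 - τ := by
    nlinarith [sq_nonneg (x - u), sq_nonneg (y - v), sq_nonneg (z - w)]
  have h2 : 0 ≤ 1 + τ := by
    nlinarith [sq_nonneg (x + u), sq_nonneg (y + v), sq_nonneg (z + w)]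
  have hM0 : 0 ≤ M := by rw [hM]; positivity
  have hWM : W ^ 2 ≤ M * ((1 - τ) * (1 + τ)) := by
    have e1 : W = a * (x - τ * u) + b * (y - τ * v) + d * (z - τ * w) := by
      rw [hW]; linear_combination τ * hm
    have e2 : (1 - τ) * (1 + τ) = (x - τ * u) ^ 2 + (y - τ * v) ^ 2 + (z - τ * w) ^ 2 := by
      linear_combination (-τ ^ 2) * hn - hs - 2 * τ * hτ
    rw [e2, e1, hM]
    generalize x - τ * u = x'
    generalize y - τ * v = y'
    generalize z - τ * w = z'
    nlinarith [sq_nonneg (a * y' - b * x'), sq_nonneg (a * z' - d * x'),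
      sq_nonneg (b * z' - d * y')]
  have hlW : l * W ≤ (1 - τ) * l ^ 2 / 2 + (1 + τ) * M / 2 := by
    refine le_of_abs_le (abs_le_of_sq_le_sq ?_ (by positivity))
    have : (l * W) ^ 2 ≤ l ^ 2 * (M * ((1 - τ) * (1 + τ))) := by
      rw [mul_pow]; exact mul_le_mul_of_nonneg_left hWM (sq_nonneg l)
    nlinarith [sq_nonneg ((1 - τ) * l ^ 2 - (1 + τ) * M)]
  have := mul_le_mul_of_nonneg_left hlW hG
  rw [hM] at this
  subst hτ hW
  nlinarith

theorem intervalIntegral_sphere_mono {T : ℝ} (hT : 0 ≤ T) {f g : ℝ → S2 → ℝ}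
    (hf : ContinuousOn (Function.uncurry f) (Set.Icc 0 T ×ˢ Set.univ))
    (hg : ContinuousOn (Function.uncurry g) (Set.Icc 0 T ×ˢ Set.univ))
    (h : ∀ r ∈ Set.Icc 0 T, ∀ ω, f r ω ≤ g r ω) :
    ∫ r in (0 : ℝ)..T, r ^ 2 * ∫ ω, f r ω ∂σ ≤ ∫ r in (0 : ℝ)..T, r ^ 2 * ∫ ω, g r ω ∂σ := by
  have hc : ∀ {f : ℝ → S2 → ℝ}, ContinuousOn (Function.uncurry f) (Set.Icc 0 T ×ˢ Set.univ) →
      ContinuousOn (fun r => ∫ ω, f r ω ∂σ) (Set.Icc 0 T) := by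
    intro f hf
    have := continuousOn_integral_of_compact_support (μ := σ) (k := Set.univ) isCompact_univ hf
      (fun _ _ _ h => (h trivial).elim)
    exact this
  have hs : ∀ {f : ℝ → S2 → ℝ}, ContinuousOn (Function.uncurry f) (Set.Icc 0 T ×ˢ Set.univ) →
      ∀ r ∈ Set.Icc 0 T, Integrable (f r) σ := by
    intro f hf r hr
    refine Continuous.integrable_sphere ?_
    exact hf.comp_continuous (by fun_prop : Continuous fun ω : S2 => (r, ω)) fun ω => ⟨hr, trivial⟩
  have hi : ∀ {f : ℝ → S2 → ℝ}, ContinuousOn (Function.uncurry f) (Set.Icc 0 T ×ˢ Set.univ) →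
      IntervalIntegrable (fun r => r ^ 2 * ∫ ω, f r ω ∂σ) volume 0 T := by
    intro f hf
    refine ContinuousOn.intervalIntegrable ?_
    rw [Set.uIcc_of_le hT]
    exact (by fun_prop : ContinuousOn (fun r : ℝ => r ^ 2) (Set.Icc 0 T)).mul (hc hf)
  refine intervalIntegral.integral_mono_on hT (hi hf) (hi hg) fun r hr => ?_
  exact mul_le_mul_of_nonneg_left (integral_mono (hs hf r hr) (hs hg r hr) (h r hr)) (sq_nonneg r)

section

variable {p γ : ℝ} {f : ℝ × E3 → ℝ} {T : ℝ} {c : E3}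

theorem en_cone_le (hp : 2 < p) (hf : ContDiff ℝ (⊤ : ℕ∞) f) (h : SolvesNLW p f) (hT : 0 ≤ T)
    (hc : T + 2 ≤ ‖c‖) :
    ∫ r in (0 : ℝ)..T, r ^ 2 * ∫ ω : S2, pot p f (T - r, c + r • (ω : E3)) ∂σ ≤
      ∫ r in (0 : ℝ)..T, r ^ 2 * ∫ ω : S2, enDen p f (0, c + r • (ω : E3)) ∂σ := by
  refine le_trans (intervalIntegral_sphere_mono hT ?_ ?_ fun r _ ω => pot_le_en_flux f _ ω)
    (cone_flux_le_of_exterior (fun q _ => (contDiff_enDen hp hf).contDiffAt)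
      (fun i q _ => (contDiff_enFlux hf i).contDiffAt) hT hc fun q hq _ => (en_div hp hf h q hq).le)
  · refine ((contDiff_pot hp hf).continuous.comp ?_).continuousOn
    fun_prop
  · have h1 := (contDiff_enDen hp hf).continuous
    have h2 := fun i => (contDiff_enFlux hf i).continuous
    refine Continuous.continuousOn ?_
    simp only [Function.uncurry_def]
    refine (h1.comp (by fun_prop)).add (continuous_finsetSum _ fun i _ => ?_)
    exact Continuous.mul (by fun_prop) ((h2 i).comp (by fun_prop))

theorem rw_cone_le (hp : 2 < p) (hγ : 1 ≤ γ) (hγ2 : γ ≤ 2) (hγp : γ ≤ p - 1)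
    (hf : ContDiff ℝ (⊤ : ℕ∞) f) (h : SolvesNLW p f) (hT : 0 ≤ T) (hc : T + 2 ≤ ‖c‖) :
    ∫ r in (0 : ℝ)..T, r ^ 2 * ∫ ω : S2, (1 + ⟪(ω : E3), ‖c‖⁻¹ • c⟫_ℝ) *
        (‖c‖ * (‖c‖ - r) ^ (γ - 1)) * pot p f (T - r, c + r • (ω : E3)) ∂σ ≤
      ∫ r in (0 : ℝ)..T, r ^ 2 * ∫ ω : S2, rwDen p γ f (0, c + r • (ω : E3)) ∂σ := by
  have hne : ∀ r ∈ Set.Icc 0 T, ∀ ω : S2, c + r • (ω : E3) ≠ 0 := fun r hr ω => by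
    have := norm_add_smul_ge c ω hr.1
    rw [← norm_pos_iff]
    linarith [hr.2]
  refine le_trans (intervalIntegral_sphere_mono hT ?_ ?_ ?_)
    (cone_flux_le_of_exterior (J0 := rwDen p γ f) (J := rwFlux p γ f)
      (fun q hq => contDiffAt_rwDen hp hf hq)
      (fun i q hq => contDiffAt_rwFlux hp hf hq i) hT hc ?_)
  · have h1 := (contDiff_pot hp hf).continuous
    refine ContinuousOn.mul (ContinuousOn.mul (by fun_prop) ?_) ?_
    · refine continuousOn_const.mul (ContinuousOn.rpow_const (by fun_prop) ?_)
      rintro ⟨r, ω⟩ ⟨hr, -⟩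
      left
      simp only
      linarith [hr.2]
    · exact (h1.comp (by fun_prop)).continuousOn
  · have hd : ∀ {A : ℝ × E3 → ℝ}, (∀ q : ℝ × E3, q.2 ≠ 0 → ContDiffAt ℝ 1 A q) →
        ContinuousOn (fun z : ℝ × S2 => A (T - z.1, c + z.1 • (z.2 : E3)))
          (Set.Icc 0 T ×ˢ Set.univ) := by
      intro A hA z hz
      have h1 : ContinuousAt A (T - z.1, c + z.1 • (z.2 : E3)) :=
        (hA _ (hne z.1 hz.1 z.2)).continuousAt
      exact (ContinuousAt.comp (f := fun z : ℝ × S2 => (T - z.1, c + z.1 • (z.2 : E3))) h1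
        (by fun_prop)).continuousWithinAt
    refine (hd fun q hq => contDiffAt_rwDen hp hf hq).add (continuousOn_finsetSum _ fun i _ => ?_)
    exact ContinuousOn.mul (by fun_prop) (hd fun q hq => contDiffAt_rwFlux hp hf hq i)
  · intro r hr ω
    refine le_trans ?_ (rw_pot_le_rw_flux f (q := (T - r, c + r • (ω : E3))) (hne r hr ω) ω)
    rw [← mul_assoc (‖(T - r, c + r • (ω : E3)).2‖ ^ γ)]
    refine mul_le_mul_of_nonneg_right ?_ (pot_nonneg hp f _)
    have hge := norm_add_smul_ge c ω hr.1
    have hle : ‖c‖ ≤ ‖c + r • (ω : E3)‖ + r := by linarith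
    have hpos : 0 < ‖c‖ - r := by linarith [hr.2]
    have hx : 0 < ‖c + r • (ω : E3)‖ := by linarith
    have hc0 : 0 < ‖c‖ := by linarith
    have e1 : (1 + ⟪(ω : E3), ‖c‖⁻¹ • c⟫_ℝ) * ‖c‖ = ‖c‖ + ⟪(ω : E3), c⟫_ℝ := by
      rw [inner_smul_right]; field_simp
    have hsum : ∑ i, (ω : E3) i * (c + r • (ω : E3)) i = ⟪(ω : E3), c⟫_ℝ + r := by
      have hs := sphere_sum_sq ω
      simp only [PiLp.inner_apply, Fin.sum_univ_three, PiLp.add_apply, PiLp.smul_apply, smul_eq_mul,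
        RCLike.inner_apply, conj_trivial]
      linear_combination r * hs
    have e2 : (1 + ∑ i, (ω : E3) i * nn i (T - r, c + r • (ω : E3))) * ‖c + r • (ω : E3)‖ =
        ‖c + r • (ω : E3)‖ + (⟪(ω : E3), c⟫_ℝ + r) := by
      rw [add_mul, one_mul, ← hsum, Finset.sum_mul]
      congr 1
      refine Finset.sum_congr rfl fun i _ => ?_
      simp only [nn]
      field_simp
    have e3 : (‖c‖ - r) ^ (γ - 1) ≤ ‖c + r • (ω : E3)‖ ^ (γ - 1) :=
      rpow_le_rpow hpos.le hge (by linarith)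
    have e4 : 0 ≤ ‖c‖ + ⟪(ω : E3), c⟫_ℝ := by
      have h1 := abs_real_inner_le_norm (ω : E3) c
      have h2 : ‖(ω : E3)‖ = 1 := by simp
      rw [h2, one_mul] at h1
      linarith [neg_abs_le ⟪(ω : E3), c⟫_ℝ]
    have e5 : ‖c + r • (ω : E3)‖ ^ γ = ‖c + r • (ω : E3)‖ ^ (γ - 1) * ‖c + r • (ω : E3)‖ := by
      rw [← rpow_add_one hx.ne']; ring_nf
    rw [← mul_assoc (1 + _), e1]
    simp only
    rw [e5, mul_assoc, mul_comm ‖c + r • (ω : E3)‖ (1 + _), e2, mul_comm]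
    exact mul_le_mul e3 (by linarith) e4 (by positivity)
  · intro q hq hq0
    rw [rw_div hp hf h hq hq0, neg_nonpos]
    have := pot_nonneg hp f q
    have h1 : 0 ≤ 2 - γ := by linarith
    have h2 : 0 ≤ p - 1 - γ := by linarith
    positivity

end

theorem shell_integral_le_of_lintegral_le {a b K : ℝ} (ha : 0 ≤ a) (hab : a ≤ b) (hK : 0 ≤ K)
    (c : E3) (f : ℝ → S2 → ℝ) {G : E3 → ℝ} (hG : Measurable G)
    (hGK : ∫⁻ x, ENNReal.ofReal (G x) ≤ ENNReal.ofReal K)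
    (h : ∀ r ∈ Set.Ioc a b, ∀ ω : S2, |f r ω| ≤ r ^ 2 * G (c + r • (ω : E3))) :
    |∫ r in a..b, ∫ ω, f r ω ∂σ| ≤ K :=
  (ENNReal.ofReal_le_ofReal_iff hK).1
    (((shell_integral_le ha hab c f hG h).trans (setLIntegral_le_lintegral _ _)).trans hGK)

theorem norm_smul_sphere (ω : S2) {r : ℝ} (hr : 0 ≤ r) : ‖r • (ω : E3)‖ = r := by
  rw [norm_smul, norm_eq_of_mem_sphere, mul_one, norm_of_nonneg hr]

section

variable {p γ K : ℝ} {a D : E3 → ℝ}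

def sphSq (a : E3 → ℝ) (r : ℝ) : ℝ := ∫ ω : S2, a (r • (ω : E3)) ^ 2 ∂σ

theorem sphSq_nonneg (a : E3 → ℝ) (r : ℝ) : 0 ≤ sphSq a r := integral_nonneg fun _ => sq_nonneg _

theorem continuous_radial (ha : ContDiff ℝ 1 a) :
    Continuous fun z : ℝ × S2 => fderiv ℝ a (z.1 • (z.2 : E3)) (z.2 : E3) := by
  have h1 : Continuous (fderiv ℝ a) := ha.continuous_fderiv one_ne_zero
  fun_prop

theorem hasDerivAt_radial (ha : ContDiff ℝ 1 a) (ω : E3) (r : ℝ) :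
    HasDerivAt (fun s : ℝ => a (s • ω)) (fderiv ℝ a (r • ω) ω) r := by
  have h1 := (ha.differentiable one_ne_zero (r • ω)).hasFDerivAt
  have h2 : HasDerivAt (fun s : ℝ => s • ω) ω r := by
    simpa using (hasDerivAt_id r).smul_const ω
  exact h1.comp_hasDerivAt r h2

theorem hasDerivAt_sphSq (ha : ContDiff ℝ 1 a) (r : ℝ) :
    HasDerivAt (sphSq a)
      (∫ ω : S2, 2 * a (r • (ω : E3)) * fderiv ℝ a (r • (ω : E3)) ω ∂σ) r := by
  refine hasDerivAt_integral_sphere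
    (F' := fun r ω => 2 * a (r • (ω : E3)) * fderiv ℝ a (r • (ω : E3)) ω) ?_ ?_ ?_ r
  · intro r
    have := ha.continuous
    fun_prop
  · have h1 := continuous_radial ha
    have h2 := ha.continuous
    simp only [Function.uncurry_def]
    fun_prop
  · intro r ω
    exact ((hasDerivAt_radial ha ω r).pow 2).congr_deriv (by push_cast; ring)

theorem continuous_sphSq_deriv (ha : ContDiff ℝ 1 a) :
    Continuous fun r : ℝ => ∫ ω : S2, 2 * a (r • (ω : E3)) * fderiv ℝ a (r • (ω : E3)) ω ∂σ := by
  refine continuous_integral_sphere ?_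
  have h1 := continuous_radial ha
  have h2 := ha.continuous
  simp only [Function.uncurry_def]
  fun_prop

theorem continuous_sphSq (ha : ContDiff ℝ 1 a) : Continuous (sphSq a) :=
  continuous_iff_continuousAt.2 fun r => (hasDerivAt_sphSq ha r).continuousAt

theorem mul_sphSq_le_add (ha : ContDiff ℝ 1 a) (hD : Continuous D)
    (haD : ∀ x v, fderiv ℝ a x v ^ 2 ≤ D x * ‖v‖ ^ 2) (hγ : 0 ≤ γ) (hK : 0 ≤ K)
    (hDK : ∫⁻ x, ENNReal.ofReal ((1 + ‖x‖) ^ γ * D x) ≤ ENNReal.ofReal K)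
    {r s : ℝ} (hr : 0 < r) (hrs : r ≤ s) :
    r * sphSq a r ≤ s * sphSq a s + r ^ (-γ) * K := by
  have hc := ha.continuous
  have hr1 := continuous_radial ha
  have hd : ∀ t, HasDerivAt (fun t => t * sphSq a t)
      (sphSq a t + t * ∫ ω : S2, 2 * a (t • (ω : E3)) * fderiv ℝ a (t • (ω : E3)) ω ∂σ) t :=
    fun t => ((hasDerivAt_id t).mul (hasDerivAt_sphSq ha t)).congr_deriv (by simp)
  have hcont : Continuous fun t => sphSq a t +
      t * ∫ ω : S2, 2 * a (t • (ω : E3)) * fderiv ℝ a (t • (ω : E3)) ω ∂σ :=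
    (continuous_sphSq ha).add (continuous_id.mul (continuous_sphSq_deriv ha))
  have hF := intervalIntegral.integral_eq_sub_of_hasDerivAt (fun t _ => hd t)
    (hcont.intervalIntegrable r s)
  have hsq : Continuous fun t : ℝ => ∫ ω : S2, t ^ 2 * fderiv ℝ a (t • (ω : E3)) ω ^ 2 ∂σ := by
    refine continuous_integral_sphere ?_
    simp only [Function.uncurry_def]
    fun_prop
  have hlow : ∫ t in r..s, -∫ ω : S2, t ^ 2 * fderiv ℝ a (t • (ω : E3)) ω ^ 2 ∂σ ≤
      ∫ t in r..s, (sphSq a t +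
        t * ∫ ω : S2, 2 * a (t • (ω : E3)) * fderiv ℝ a (t • (ω : E3)) ω ∂σ) := by
    refine intervalIntegral.integral_mono_on hrs (hsq.neg.intervalIntegrable _ _)
      (hcont.intervalIntegrable _ _) fun t _ => ?_
    have hrt : Continuous fun ω : S2 => fderiv ℝ a (t • (ω : E3)) ω :=
      hr1.comp (by fun_prop : Continuous fun ω : S2 => (t, ω))
    rw [sphSq, ← integral_const_mul, ← integral_add (Continuous.integrable_sphere (by fun_prop))
      (Continuous.integrable_sphere (by fun_prop)), ← integral_neg]
    refine integral_mono (Continuous.integrable_sphere (by fun_prop))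
      (Continuous.integrable_sphere (by fun_prop)) fun ω => ?_
    simp only
    nlinarith [sq_nonneg (a (t • (ω : E3)) + t * fderiv ℝ a (t • (ω : E3)) ω)]
  have hup := shell_integral_le_of_lintegral_le hr.le hrs hK 0
    (fun t ω => r ^ γ * (t ^ 2 * fderiv ℝ a (t • (ω : E3)) ω ^ 2))
    (G := fun x => (1 + ‖x‖) ^ γ * D x) (by
      have := hD.measurable
      fun_prop) hDK ?_
  · simp only [integral_const_mul, intervalIntegral.integral_const_mul] at hup
    have h2 := (le_abs_self _).trans hup
    rw [intervalIntegral.integral_neg, hF] at hlow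
    have h3 : ∫ t in r..s, ∫ ω : S2, t ^ 2 * fderiv ℝ a (t • (ω : E3)) ω ^ 2 ∂σ ≤
        r ^ (-γ) * K := by
      rw [rpow_neg hr.le, ← div_eq_inv_mul, le_div_iff₀' (by positivity)]
      simpa only [integral_const_mul] using h2
    linarith
  · intro t ht ω
    have htp : 0 < t := hr.trans ht.1
    have h1 := haD (t • (ω : E3)) ω
    rw [norm_eq_of_mem_sphere, one_pow, mul_one] at h1
    rw [abs_of_nonneg (by positivity), zero_add, norm_smul_sphere ω htp.le]
    have h2 : r ^ γ ≤ (1 + t) ^ γ := rpow_le_rpow hr.le (by linarith [ht.1]) hγ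
    calc r ^ γ * (t ^ 2 * fderiv ℝ a (t • (ω : E3)) ω ^ 2)
        ≤ (1 + t) ^ γ * (t ^ 2 * D (t • (ω : E3))) := by gcongr
      _ = _ := by ring

theorem sq_le_add_rpow (hp : 1 < p) {l : ℝ} (hl : 0 < l) (y : ℝ) :
    l ^ ((p - 1) / 2) * (y ^ 2 - l) ≤ |y| ^ (p + 1) := by
  rcases le_or_gt (y ^ 2) l with h | h
  · have : 0 ≤ |y| ^ (p + 1) := by positivity
    exact le_trans (mul_nonpos_of_nonneg_of_nonpos (by positivity) (by linarith)) this
  · have hy : 0 < |y| := abs_pos.2 fun h0 => by simp [h0] at h; linarith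
    have e1 : |y| ^ (p + 1) = (y ^ 2) ^ ((p - 1) / 2) * y ^ 2 := by
      rw [← sq_abs y, ← rpow_natCast |y| 2, ← rpow_mul hy.le, ← rpow_add hy]
      congr 1
      push_cast
      ring
    rw [e1]
    have h1 : l ^ ((p - 1) / 2) ≤ (y ^ 2) ^ ((p - 1) / 2) :=
      rpow_le_rpow hl.le h.le (by linarith)
    exact mul_le_mul h1 (by linarith) (by linarith) (by positivity)

theorem exists_mul_sphSq_le (hp : 1 < p) (hp3 : p ≤ 3) (hγ : 1 ≤ γ) (ha : ContDiff ℝ 1 a)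
    (hK : 0 ≤ K)
    (hPK : ∫⁻ x, ENNReal.ofReal ((1 + ‖x‖) ^ γ * |a x| ^ (p + 1)) ≤ ENNReal.ofReal K)
    {δ N : ℝ} (hδ : 0 < δ) : ∃ s, N ≤ s ∧ s * sphSq a s ≤ δ := by
  by_contra! hcon
  have hc := ha.continuous
  set m : ℝ := (σ : Measure S2).real Set.univ + 1 with hm
  have hm0 : 0 < m := by positivity
  set N' := max N 1
  set k : ℝ := (δ / (2 * m)) ^ ((p - 1) / 2) * (δ / 2) with hk
  have hk0 : 0 < k := by positivity
  have hp1 : 0 ≤ p + 1 := by linarith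
  have hγ0 : 0 ≤ γ := by linarith
  have hcp : Continuous fun x => |a x| ^ (p + 1) :=
    (continuous_abs.comp hc).rpow_const fun x => Or.inr (by linarith)
  have key : ∀ s, N' ≤ s → k ≤ ∫ ω : S2, s ^ 2 * ((1 + s) ^ γ * |a (s • (ω : E3))| ^ (p + 1)) ∂σ := by
    intro s hs
    have hs1 : 1 ≤ s := (le_max_right _ _).trans hs
    have hs0 : 0 < s := by linarith
    have h1 := hcon s ((le_max_left _ _).trans hs)
    set l := δ / (2 * m * s) with hl
    have hl0 : 0 < l := by positivity
    have h2 : ∫ ω : S2, l ^ ((p - 1) / 2) * (a (s • (ω : E3)) ^ 2 - l) ∂σ ≤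
        ∫ ω : S2, |a (s • (ω : E3))| ^ (p + 1) ∂σ :=
      integral_mono (Continuous.integrable_sphere (by fun_prop))
        (Continuous.integrable_sphere (by fun_prop)) fun ω => sq_le_add_rpow hp hl0 _
    rw [integral_const_mul, integral_sub (Continuous.integrable_sphere (by fun_prop))
      (integrable_const _), integral_const, smul_eq_mul] at h2
    have h3 : (σ : Measure S2).real Set.univ * l ≤ δ / (2 * s) := by
      have : m * l = δ / (2 * s) := by rw [hl]; field_simp
      nlinarith
    have h4 : δ / s ≤ sphSq a s := by rw [div_le_iff₀ hs0]; linarith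
    have h5 : l ^ ((p - 1) / 2) = (δ / (2 * m)) ^ ((p - 1) / 2) * s ^ (-((p - 1) / 2)) := by
      rw [hl, ← div_div, div_rpow (by positivity) hs0.le, rpow_neg hs0.le, div_eq_mul_inv]
    have h6 : s⁻¹ ≤ s ^ (-((p - 1) / 2)) := by
      rw [← rpow_neg_one]
      exact rpow_le_rpow_of_exponent_le hs1 (by linarith)
    have h7 : (δ / (2 * m)) ^ ((p - 1) / 2) * s⁻¹ * (δ / (2 * s)) ≤
        ∫ ω : S2, |a (s • (ω : E3))| ^ (p + 1) ∂σ := by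
      refine le_trans ?_ h2
      rw [h5]
      have : δ / (2 * s) = δ / s - δ / (2 * s) := by field_simp; ring
      have h8 : δ / (2 * s) ≤ sphSq a s - (σ : Measure S2).real Set.univ * l := by linarith
      exact mul_le_mul (by gcongr) h8 (by positivity) (by positivity)
    have h9 : 1 ≤ (1 + s) ^ γ := one_le_rpow (by linarith) (by linarith)
    rw [integral_const_mul, integral_const_mul]
    have h10 : k = s ^ 2 * ((δ / (2 * m)) ^ ((p - 1) / 2) * s⁻¹ * (δ / (2 * s))) := by
      rw [hk]; field_simp
    rw [h10]
    have h11 : 0 ≤ ∫ ω : S2, |a (s • (ω : E3))| ^ (p + 1) ∂σ :=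
      integral_nonneg fun _ => by positivity
    have : ∫ ω : S2, |a (s • (ω : E3))| ^ (p + 1) ∂σ ≤
        (1 + s) ^ γ * ∫ ω : S2, |a (s • (ω : E3))| ^ (p + 1) ∂σ := le_mul_of_one_le_left h11 h9
    exact mul_le_mul_of_nonneg_left (h7.trans this) (by positivity)
  have hN1 : 1 ≤ N' := le_max_right _ _
  set M := N' + (K + 1) / k
  have hM : N' ≤ M := le_add_of_nonneg_right (by positivity)
  have hup := shell_integral_le_of_lintegral_le (by linarith) hM hK 0
    (fun s ω => s ^ 2 * ((1 + |s|) ^ γ * |a (s • (ω : E3))| ^ (p + 1)))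
    (G := fun x => (1 + ‖x‖) ^ γ * |a x| ^ (p + 1)) (by
      have := hcp.measurable
      fun_prop) hPK (fun s hs ω => by
      have hs0 : 0 < s := by linarith [hs.1]
      rw [zero_add, norm_smul_sphere ω hs0.le, abs_of_nonneg hs0.le, abs_of_nonneg (by positivity)])
  have hlow : ∫ s in N'..M, k ≤
      ∫ s in N'..M, ∫ ω : S2, s ^ 2 * ((1 + |s|) ^ γ * |a (s • (ω : E3))| ^ (p + 1)) ∂σ := by
    refine intervalIntegral.integral_mono_on hM (by simp) ?_ fun s hs => ?_
    · refine Continuous.intervalIntegrable (continuous_integral_sphere ?_) _ _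
      simp only [Function.uncurry_def]
      have h1 : Continuous fun s : ℝ => (1 + |s|) ^ γ :=
        Continuous.rpow_const (by fun_prop) fun s => Or.inr (by linarith)
      fun_prop
    · rw [abs_of_nonneg (by linarith [hs.1])]
      exact key s hs.1
  have h2 := hlow.trans ((le_abs_self _).trans hup)
  rw [intervalIntegral.integral_const, smul_eq_mul, add_sub_cancel_left, div_mul_cancel₀ _ hk0.ne']
    at h2
  linarith

theorem sphSq_le (hp : 1 < p) (hp3 : p ≤ 3) (hγ : 1 ≤ γ) (ha : ContDiff ℝ 1 a) (hD : Continuous D)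
    (haD : ∀ x v, fderiv ℝ a x v ^ 2 ≤ D x * ‖v‖ ^ 2) (hK : 0 ≤ K)
    (hDK : ∫⁻ x, ENNReal.ofReal ((1 + ‖x‖) ^ γ * D x) ≤ ENNReal.ofReal K)
    (hPK : ∫⁻ x, ENNReal.ofReal ((1 + ‖x‖) ^ γ * |a x| ^ (p + 1)) ≤ ENNReal.ofReal K)
    {r : ℝ} (hr : 0 < r) : sphSq a r ≤ r ^ (-(γ + 1)) * K := by
  have h : r * sphSq a r ≤ r ^ (-γ) * K := by
    refine le_of_forall_pos_le_add fun δ hδ => ?_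
    obtain ⟨s, hs, h1⟩ := exists_mul_sphSq_le hp hp3 hγ ha hK hPK (N := r) hδ
    linarith [mul_sphSq_le_add ha hD haD (by linarith : 0 ≤ γ) hK hDK hr hs]
  rw [neg_add, rpow_add hr, rpow_neg_one]
  have h2 : sphSq a r = r⁻¹ * (r * sphSq a r) := by field_simp
  rw [h2, mul_comm (r ^ (-γ)), mul_assoc]
  gcongr

end

theorem lintegral_sphere_eq_ofReal {a b : ℝ} (hab : a ≤ b) {F : ℝ → S2 → ℝ}
    (hF : ContinuousOn (Function.uncurry F) (Set.Icc a b ×ˢ Set.univ))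
    (hF0 : ∀ r ∈ Set.Icc a b, ∀ ω, 0 ≤ F r ω) :
    ∫⁻ r in Set.Ioc a b, ∫⁻ ω, ENNReal.ofReal (F r ω) ∂σ =
      ENNReal.ofReal (∫ r in a..b, ∫ ω, F r ω ∂σ) := by
  set F' : ℝ → S2 → ℝ := fun r ω => F (Set.projIcc a b hab r) ω with hF'
  have hc : Continuous (Function.uncurry F') := by
    have h1 : Continuous fun z : ℝ × S2 => ((Set.projIcc a b hab z.1 : ℝ), z.2) :=
      (continuous_subtype_val.comp (continuous_projIcc.comp continuous_fst)).prodMk continuous_snd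
    exact hF.comp_continuous h1 fun z => ⟨(Set.projIcc a b hab z.1).2, trivial⟩
  have hF'0 : ∀ r ω, 0 ≤ F' r ω := fun r ω => hF0 _ (Set.projIcc a b hab r).2 ω
  have heq : ∀ r ∈ Set.Icc a b, F' r = F r := fun r hr => by
    simp only [hF', Set.projIcc_of_mem hab hr]
  have hci := continuous_integral_sphere hc
  rw [intervalIntegral.integral_congr (g := fun r => ∫ ω, F' r ω ∂σ) (fun r hr => by
    rw [Set.uIcc_of_le hab] at hr
    simp only [heq r hr]), intervalIntegral.integral_of_le hab,
    ofReal_integral_eq_lintegral_ofReal (hci.intervalIntegrable a b).1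
      (Filter.Eventually.of_forall fun r => integral_nonneg (hF'0 r))]
  refine setLIntegral_congr_fun measurableSet_Ioc fun r hr => ?_
  have hi : Integrable (F' r) σ :=
    Continuous.integrable_sphere (hc.comp (by fun_prop : Continuous fun ω : S2 => (r, ω)))
  rw [ofReal_integral_eq_lintegral_ofReal hi
    (Filter.Eventually.of_forall (hF'0 r)), heq r ⟨hr.1.le, hr.2⟩]

section

variable {p γ K : ℝ} {a D : E3 → ℝ}

theorem integral_hardy_le (hp : 1 < p) (hp3 : p ≤ 3) (hγ : 1 ≤ γ) (ha : ContDiff ℝ 1 a)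
    (hD : Continuous D) (haD : ∀ x v, fderiv ℝ a x v ^ 2 ≤ D x * ‖v‖ ^ 2) (hK : 0 ≤ K)
    (hDK : ∫⁻ x, ENNReal.ofReal ((1 + ‖x‖) ^ γ * D x) ≤ ENNReal.ofReal K)
    (hPK : ∫⁻ x, ENNReal.ofReal ((1 + ‖x‖) ^ γ * |a x| ^ (p + 1)) ≤ ENNReal.ofReal K)
    {b : ℝ} (hb : 1 ≤ b) :
    ∫ r in (1 : ℝ)..b, ∫ ω : S2, |r| ^ γ *
      (r * fderiv ℝ a (r • (ω : E3)) ω + a (r • (ω : E3))) ^ 2 ∂σ ≤ 2 * K := by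
  have hc := ha.continuous
  have hr1 := continuous_radial ha
  have hγ0 : 0 ≤ γ := by linarith
  have hγ1 : 0 ≤ γ + 1 := by linarith
  have hd : ∀ t, HasDerivAt (fun t => t ^ (γ + 1) * sphSq a t)
      ((γ + 1) * t ^ γ * sphSq a t +
        t ^ (γ + 1) * ∫ ω : S2, 2 * a (t • (ω : E3)) * fderiv ℝ a (t • (ω : E3)) ω ∂σ) t :=
    fun t => ((hasDerivAt_rpow_const (p := γ + 1) (Or.inr (by linarith))).mul
      (hasDerivAt_sphSq ha t)).congr_deriv (by rw [add_sub_cancel_right])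
  have hg := continuous_sphSq ha
  have hg' := continuous_sphSq_deriv ha
  have hcont : Continuous fun t => (γ + 1) * t ^ γ * sphSq a t +
      t ^ (γ + 1) * ∫ ω : S2, 2 * a (t • (ω : E3)) * fderiv ℝ a (t • (ω : E3)) ω ∂σ := by
    fun_prop
  have hF := intervalIntegral.integral_eq_sub_of_hasDerivAt (fun t _ => hd t)
    (hcont.intervalIntegrable 1 b)
  have habs : Continuous fun r : ℝ => |r| ^ γ :=
    Continuous.rpow_const (by fun_prop) fun r => Or.inr hγ0
  have hsq : Continuous fun t : ℝ =>
      ∫ ω : S2, t ^ 2 * (|t| ^ γ * fderiv ℝ a (t • (ω : E3)) ω ^ 2) ∂σ := by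
    refine continuous_integral_sphere ?_
    simp only [Function.uncurry_def]
    fun_prop
  have hlow : ∫ r in (1 : ℝ)..b, ∫ ω : S2, |r| ^ γ *
      (r * fderiv ℝ a (r • (ω : E3)) ω + a (r • (ω : E3))) ^ 2 ∂σ ≤
      ∫ t in (1 : ℝ)..b, ((∫ ω : S2, t ^ 2 * (|t| ^ γ * fderiv ℝ a (t • (ω : E3)) ω ^ 2) ∂σ) +
        ((γ + 1) * t ^ γ * sphSq a t +
        t ^ (γ + 1) * ∫ ω : S2, 2 * a (t • (ω : E3)) * fderiv ℝ a (t • (ω : E3)) ω ∂σ)) := by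
    refine intervalIntegral.integral_mono_on hb
      (Continuous.intervalIntegrable (continuous_integral_sphere ?_) _ _)
      ((hsq.add hcont).intervalIntegrable _ _) fun t ht => ?_
    · simp only [Function.uncurry_def]
      fun_prop
    have ht0 : 0 < t := by linarith [ht.1]
    have hrt : Continuous fun ω : S2 => fderiv ℝ a (t • (ω : E3)) ω :=
      hr1.comp (by fun_prop : Continuous fun ω : S2 => (t, ω))
    rw [sphSq, ← integral_const_mul, ← integral_const_mul,
      ← integral_add (Continuous.integrable_sphere (by fun_prop))
      (Continuous.integrable_sphere (by fun_prop)),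
      ← integral_add (Continuous.integrable_sphere (by fun_prop))
      (Continuous.integrable_sphere (by fun_prop))]
    refine integral_mono (Continuous.integrable_sphere (by fun_prop))
      (Continuous.integrable_sphere (by fun_prop)) fun ω => ?_
    simp only
    rw [abs_of_pos ht0, rpow_add_one ht0.ne']
    have h1 : 0 ≤ γ * t ^ γ * a (t • (ω : E3)) ^ 2 := by positivity
    nlinarith [h1]
  have hup := shell_integral_le_of_lintegral_le zero_le_one hb hK 0
    (fun t ω => t ^ 2 * (|t| ^ γ * fderiv ℝ a (t • (ω : E3)) ω ^ 2))
    (G := fun x => (1 + ‖x‖) ^ γ * D x) (by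
      have := hD.measurable
      fun_prop) hDK (fun t ht ω => by
      have htp : 0 < t := zero_lt_one.trans ht.1
      have h1 := haD (t • (ω : E3)) ω
      rw [norm_eq_of_mem_sphere, one_pow, mul_one] at h1
      rw [abs_of_nonneg (by positivity), zero_add, norm_smul_sphere ω htp.le, abs_of_pos htp]
      have h2 : t ^ γ ≤ (1 + t) ^ γ := rpow_le_rpow htp.le (by linarith [ht.1]) hγ0
      gcongr)
  rw [intervalIntegral.integral_add (hsq.intervalIntegrable _ _) (hcont.intervalIntegrable _ _),
    hF] at hlow
  have h3 := sphSq_le hp hp3 hγ ha hD haD hK hDK hPK (by linarith : 0 < b)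
  have h4 : b ^ (γ + 1) * sphSq a b ≤ K := by
    rw [rpow_neg (by linarith), ← div_eq_inv_mul, le_div_iff₀' (by positivity)] at h3
    exact h3
  have h5 : 0 ≤ (1 : ℝ) ^ (γ + 1) * sphSq a 1 := mul_nonneg (by positivity) (sphSq_nonneg _ _)
  linarith [le_abs_self (∫ t in (1 : ℝ)..b,
    ∫ ω : S2, t ^ 2 * (|t| ^ γ * fderiv ℝ a (t • (ω : E3)) ω ^ 2) ∂σ)]

theorem lintegral_hardy_le (hp : 1 < p) (hp3 : p ≤ 3) (hγ : 1 ≤ γ) (ha : ContDiff ℝ 1 a)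
    (hD : Continuous D) (haD : ∀ x v, fderiv ℝ a x v ^ 2 ≤ D x * ‖v‖ ^ 2) (hK : 0 ≤ K)
    (hDK : ∫⁻ x, ENNReal.ofReal ((1 + ‖x‖) ^ γ * D x) ≤ ENNReal.ofReal K)
    (hPK : ∫⁻ x, ENNReal.ofReal ((1 + ‖x‖) ^ γ * |a x| ^ (p + 1)) ≤ ENNReal.ofReal K)
    {b : ℝ} (hb : 1 ≤ b) :
    ∫⁻ x in {x : E3 | ‖x - 0‖ ∈ Set.Ioc 1 b}, ENNReal.ofReal
      (‖x‖ ^ γ * (fderiv ℝ a x (‖x‖⁻¹ • x) + ‖x‖⁻¹ * a x) ^ 2) ≤ ENNReal.ofReal (2 * K) := by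
  have hc := ha.continuous
  have hr1 := continuous_radial ha
  have hγ0 : 0 ≤ γ := by linarith
  have hfd : Continuous (fderiv ℝ a) := ha.continuous_fderiv one_ne_zero
  have hmeas : Measurable fun x => fderiv ℝ a x (‖x‖⁻¹ • x) := by
    have h1 : Continuous fun z : E3 × E3 => fderiv ℝ a z.1 z.2 := by fun_prop
    exact h1.measurable.comp (measurable_id.prodMk (by fun_prop))
  have hcm := hc.measurable
  rw [← lintegral_polar_shell _ (by fun_prop) 0 _ measurableSet_Ioc
    fun r hr => Set.mem_Ioi.2 (zero_lt_one.trans hr.1)]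
  refine le_trans (le_of_eq ?_) (ENNReal.ofReal_le_ofReal
    (integral_hardy_le hp hp3 hγ ha hD haD hK hDK hPK hb))
  have habs : Continuous fun r : ℝ => |r| ^ γ :=
    Continuous.rpow_const (by fun_prop) fun r => Or.inr hγ0
  rw [← lintegral_sphere_eq_ofReal (F := fun r ω => |r| ^ γ *
      (r * fderiv ℝ a (r • (ω : E3)) ω + a (r • (ω : E3))) ^ 2) hb
    (by simp only [Function.uncurry_def]; fun_prop) fun r _ ω => by positivity]
  refine setLIntegral_congr_fun measurableSet_Ioc fun r hr => ?_
  have hr0 : 0 < r := zero_lt_one.trans hr.1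
  rw [← lintegral_const_mul' _ _ ENNReal.ofReal_ne_top]
  refine lintegral_congr fun ω => ?_
  rw [← ENNReal.ofReal_mul (by positivity), zero_add, norm_smul_sphere ω hr0.le, abs_of_pos hr0,
    smul_smul, inv_mul_cancel₀ hr0.ne', one_smul]
  congr 1
  field_simp

end

section

variable {p γ K T : ℝ} {f : ℝ × E3 → ℝ} {c : E3}

def datD (f : ℝ × E3 → ℝ) (x : E3) : ℝ := pd et f (0, x) ^ 2 + ∑ i, pd (es i) f (0, x) ^ 2

theorem datD_nonneg (f : ℝ × E3 → ℝ) (x : E3) : 0 ≤ datD f x := by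
  unfold datD
  positivity

theorem continuous_pd (hf : ContDiff ℝ (⊤ : ℕ∞) f) (v : ℝ × E3) : Continuous (pd v f) :=
  (hf.pd v).continuous

theorem continuous_datD (hf : ContDiff ℝ (⊤ : ℕ∞) f) : Continuous (datD f) := by
  have h1 := continuous_pd hf
  have h2 : ∀ v, Continuous fun x : E3 => pd v f (0, x) := fun v => (h1 v).comp (by fun_prop)
  exact ((h2 _).pow 2).add (continuous_finsetSum _ fun i _ => (h2 _).pow 2)

theorem contDiff_slice (hf : ContDiff ℝ (⊤ : ℕ∞) f) (t : ℝ) :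
    ContDiff ℝ (⊤ : ℕ∞) fun x => f (t, x) :=
  hf.comp (contDiff_const.prodMk contDiff_id)

theorem fderiv_slice_sq_le (hf : ContDiff ℝ (⊤ : ℕ∞) f) (x v : E3) :
    fderiv ℝ (fun y => f (0, y)) x v ^ 2 ≤ datD f x * ‖v‖ ^ 2 := by
  rw [fderiv_slice (hf.of_le (by exact_mod_cast le_top))]
  have h1 := Finset.sum_mul_sq_le_sq_mul_sq Finset.univ (fun i => v i)
    fun i => pd (es i) f (0, x)
  have h2 : ‖v‖ ^ 2 = ∑ i, v i ^ 2 := by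
    rw [EuclideanSpace.norm_sq_eq]
    simp
  rw [h2, mul_comm]
  refine h1.trans (mul_le_mul_of_nonneg_left ?_ (by positivity))
  unfold datD
  linarith [sq_nonneg (pd et f (0, x))]

theorem rwDen_zero_le (hp : 2 < p) (hf : ContDiff ℝ (⊤ : ℕ∞) f) {x : E3} (hx : x ≠ 0) :
    rwDen p γ f (0, x) ≤ ‖x‖ ^ γ * (datD f x + |f (0, x)| ^ (p + 1)) +
      ‖x‖ ^ γ * (fderiv ℝ (fun y => f (0, y)) x (‖x‖⁻¹ • x) + ‖x‖⁻¹ * f (0, x)) ^ 2 := by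
  have h1 : fderiv ℝ (fun y => f (0, y)) x (‖x‖⁻¹ • x) = prad f (0, x) := by
    rw [fderiv_slice (hf.of_le (by exact_mod_cast le_top))]
    simp only [prad, nn, PiLp.smul_apply, smul_eq_mul]
    exact Finset.sum_congr rfl fun i _ => by ring
  rw [h1, ← mul_add]
  unfold rwDen
  refine mul_le_mul_of_nonneg_left ?_ (by positivity)
  have h2 : ∑ i, nn i (0, x) ^ 2 = 1 := by
    simp only [nn, mul_pow]
    rw [← Finset.sum_mul]
    have h3 : ‖x‖ ^ 2 = ∑ i, x i ^ 2 := by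
      rw [EuclideanSpace.norm_sq_eq]
      simp
    rw [← h3]
    have : ‖x‖ ≠ 0 := norm_ne_zero_iff.2 hx
    field_simp
  have h4 : ∑ i, angd f i (0, x) ^ 2 = ∑ i, pd (es i) f (0, x) ^ 2 - prad f (0, x) ^ 2 := by
    have h5 : ∑ i, angd f i (0, x) ^ 2 = ∑ i, pd (es i) f (0, x) ^ 2 -
        2 * prad f (0, x) * (∑ i, nn i (0, x) * pd (es i) f (0, x)) +
        prad f (0, x) ^ 2 * ∑ i, nn i (0, x) ^ 2 := by
      rw [Finset.mul_sum, Finset.mul_sum, ← Finset.sum_sub_distrib, ← Finset.sum_add_distrib]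
      refine Finset.sum_congr rfl fun i _ => ?_
      unfold angd
      ring
    rw [h5, h2]
    have : ∑ i, nn i (0, x) * pd (es i) f (0, x) = prad f (0, x) := rfl
    rw [this]
    ring
  rw [h4]
  have h6 : pot p f (0, x) ≤ |f (0, x)| ^ (p + 1) :=
    div_le_self (by positivity) (by linarith)
  have h7 : outg f (0, x) = pd et f (0, x) + (prad f (0, x) + ‖x‖⁻¹ * f (0, x)) := by
    simp only [outg]
    ring
  rw [h7]
  unfold datD
  have h8 : 0 ≤ ∑ i, pd (es i) f (0, x) ^ 2 := by positivity
  nlinarith [sq_nonneg (pd et f (0, x) - (prad f (0, x) + ‖x‖⁻¹ * f (0, x))),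
    sq_nonneg (prad f (0, x))]

theorem enDen_zero_le (hp : 2 < p) (x : E3) :
    enDen p f (0, x) ≤ datD f x + |f (0, x)| ^ (p + 1) := by
  have h6 : pot p f (0, x) ≤ |f (0, x)| ^ (p + 1) :=
    div_le_self (by positivity) (by linarith)
  unfold enDen datD
  have h8 : 0 ≤ ∑ i, pd (es i) f (0, x) ^ 2 := by positivity
  linarith [sq_nonneg (pd et f (0, x))]

theorem weighted_cone_le (hp : 2 < p) (hp3 : p ≤ 3) (hγ : 1 ≤ γ) (hγp : γ ≤ p - 1)
    (hf : ContDiff ℝ (⊤ : ℕ∞) f) (h : SolvesNLW p f) (hK : 0 ≤ K)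
    (hDK : ∫⁻ x, ENNReal.ofReal ((1 + ‖x‖) ^ γ * (datD f x + |f (0, x)| ^ (p + 1))) ≤
      ENNReal.ofReal K) (hT : 0 ≤ T) (hc : T + 2 ≤ ‖c‖) :
    ∫ r in (0 : ℝ)..T, r ^ 2 * ∫ ω : S2, (1 + ⟪(ω : E3), ‖c‖⁻¹ • c⟫_ℝ) *
        (‖c‖ * (‖c‖ - r) ^ (γ - 1)) * pot p f (T - r, c + r • (ω : E3)) ∂σ ≤ 3 * K ∧
    (‖c‖ - T) ^ γ * ∫ r in (0 : ℝ)..T, r ^ 2 * ∫ ω : S2, pot p f (T - r, c + r • (ω : E3)) ∂σ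
      ≤ K := by
  have hγ0 : 0 ≤ γ := by linarith
  have hp1 : 0 ≤ p + 1 := by linarith
  have ha := contDiff_slice hf 0
  have ha1 : ContDiff ℝ 1 fun x => f (0, x) := ha.of_le (by exact_mod_cast le_top)
  have hac := ha.continuous
  have hacm := hac.measurable
  have hdc := continuous_datD hf
  have hdm := hdc.measurable
  have hpc : Continuous fun x => |f (0, x)| ^ (p + 1) :=
    (continuous_abs.comp hac).rpow_const fun x => Or.inr hp1
  have hpm := hpc.measurable
  have hDK1 : ∫⁻ x, ENNReal.ofReal ((1 + ‖x‖) ^ γ * datD f x) ≤ ENNReal.ofReal K := by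
    refine le_trans (lintegral_mono fun x => ENNReal.ofReal_le_ofReal ?_) hDK
    have : 0 ≤ |f (0, x)| ^ (p + 1) := by positivity
    gcongr
    linarith
  have hDK2 : ∫⁻ x, ENNReal.ofReal ((1 + ‖x‖) ^ γ * |f (0, x)| ^ (p + 1)) ≤
      ENNReal.ofReal K := by
    refine le_trans (lintegral_mono fun x => ENNReal.ofReal_le_ofReal ?_) hDK
    have := datD_nonneg f x
    gcongr
    linarith
  constructor
  · refine (rw_cone_le hp hγ (by linarith) hγp hf h hT hc).trans ?_
    have hfd : Continuous (fderiv ℝ fun y => f (0, y)) := ha1.continuous_fderiv one_ne_zero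
    have hmeas : Measurable fun x => fderiv ℝ (fun y => f (0, y)) x (‖x‖⁻¹ • x) := by
      have h1 : Continuous fun z : E3 × E3 => fderiv ℝ (fun y => f (0, y)) z.1 z.2 := by fun_prop
      exact h1.measurable.comp (measurable_id.prodMk (by fun_prop))
    have h1 := shell_integral_le le_rfl hT c (fun r ω => r ^ 2 * rwDen p γ f (0, c + r • (ω : E3)))
      (G := fun x => ‖x‖ ^ γ * (datD f x + |f (0, x)| ^ (p + 1)) + ‖x‖ ^ γ *
        (fderiv ℝ (fun y => f (0, y)) x (‖x‖⁻¹ • x) + ‖x‖⁻¹ * f (0, x)) ^ 2)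
      (Measurable.add (by fun_prop) (Measurable.mul (by fun_prop)
        ((hmeas.add (measurable_norm.inv.mul hacm)).pow_const 2))) (fun r hr ω => by
        have hne : c + r • (ω : E3) ≠ 0 := by
          have := norm_add_smul_ge c ω hr.1.le
          rw [← norm_pos_iff]
          linarith [hr.2]
        have h2 : 0 ≤ rwDen p γ f (0, c + r • (ω : E3)) := by
          have := pot_nonneg hp f (0, c + r • (ω : E3))
          unfold rwDen
          positivity
        rw [abs_of_nonneg (by positivity)]
        exact mul_le_mul_of_nonneg_left (rwDen_zero_le hp hf hne) (by positivity))
    simp only [integral_const_mul] at h1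
    refine (le_abs_self _).trans ((ENNReal.ofReal_le_ofReal_iff (by positivity)).1 (h1.trans ?_))
    have h3 : ∀ x, ENNReal.ofReal (‖x‖ ^ γ * (datD f x + |f (0, x)| ^ (p + 1)) + ‖x‖ ^ γ *
        (fderiv ℝ (fun y => f (0, y)) x (‖x‖⁻¹ • x) + ‖x‖⁻¹ * f (0, x)) ^ 2) =
        ENNReal.ofReal (‖x‖ ^ γ * (datD f x + |f (0, x)| ^ (p + 1))) + ENNReal.ofReal (‖x‖ ^ γ *
        (fderiv ℝ (fun y => f (0, y)) x (‖x‖⁻¹ • x) + ‖x‖⁻¹ * f (0, x)) ^ 2) := fun x => by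
      have := datD_nonneg f x
      exact ENNReal.ofReal_add (by positivity) (by positivity)
    simp only [h3]
    rw [lintegral_add_left (by fun_prop), show 3 * K = K + 2 * K by ring,
      ENNReal.ofReal_add hK (by positivity)]
    refine add_le_add ?_ ?_
    · refine (setLIntegral_le_lintegral _ _).trans (le_trans (lintegral_mono fun x =>
        ENNReal.ofReal_le_ofReal ?_) hDK)
      have := datD_nonneg f x
      gcongr
      linarith
    · refine le_trans (lintegral_mono_set ?_) (lintegral_hardy_le (by linarith) hp3 hγ ha1 hdc
        (fderiv_slice_sq_le hf) hK hDK1 hDK2 (b := max 1 (‖c‖ + T)) (le_max_left _ _))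
      intro x hx
      have hx2 : ‖x - c‖ ≤ T := hx.2
      have h4 : ‖c‖ ≤ ‖x‖ + ‖x - c‖ := by
        have := norm_sub_le x (x - c)
        rwa [sub_sub_cancel] at this
      have h5 : ‖x‖ ≤ ‖c‖ + ‖x - c‖ := by
        have := norm_add_le c (x - c)
        rwa [add_sub_cancel] at this
      rw [Set.mem_ofPred_eq, sub_zero]
      exact ⟨by linarith, le_max_of_le_right (by linarith)⟩
  · have hu : 0 < ‖c‖ - T := by linarith
    refine (mul_le_mul_of_nonneg_left (en_cone_le hp hf h hT hc) (by positivity)).trans ?_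
    have h1 := shell_integral_le_of_lintegral_le le_rfl hT hK c
      (fun r ω => (‖c‖ - T) ^ γ * (r ^ 2 * enDen p f (0, c + r • (ω : E3))))
      (G := fun x => (1 + ‖x‖) ^ γ * (datD f x + |f (0, x)| ^ (p + 1)))
      (by fun_prop) hDK (fun r hr ω => by
        have h2 : 0 ≤ enDen p f (0, c + r • (ω : E3)) := by
          have := pot_nonneg hp f (0, c + r • (ω : E3))
          unfold enDen
          positivity
        rw [abs_of_nonneg (by positivity), mul_left_comm]
        refine mul_le_mul_of_nonneg_left ?_ (by positivity)
        have h3 := norm_add_smul_ge c ω hr.1.le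
        have := datD_nonneg f (c + r • (ω : E3))
        refine mul_le_mul (rpow_le_rpow hu.le (by linarith [hr.2]) hγ0) (enDen_zero_le hp _) h2
          (by positivity))
    simp only [integral_const_mul, intervalIntegral.integral_const_mul] at h1
    exact (le_abs_self _).trans h1

end

section

variable {p γ K T : ℝ} {f : ℝ × E3 → ℝ} {c : E3}

def coneWt (γ T : ℝ) (c : E3) (r : ℝ) (ω : S2) : ℝ :=
  (1 + ⟪(ω : E3), ‖c‖⁻¹ • c⟫_ℝ) * (‖c‖ * (‖c‖ - r) ^ (γ - 1)) + (‖c‖ - T) ^ γ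

theorem norm_inv_smul_self {c : E3} (hc : c ≠ 0) : ‖‖c‖⁻¹ • c‖ = 1 := by
  have : ‖c‖ ≠ 0 := norm_ne_zero_iff.2 hc
  rw [norm_smul, norm_inv, norm_norm, inv_mul_cancel₀ this]

theorem coneWt_pos (hT : 0 ≤ T) (hc : T + 2 ≤ ‖c‖) {r : ℝ} (hr : r ≤ T) (ω : S2) :
    0 < coneWt γ T c r ω := by
  have hc0 : 0 < ‖c‖ := by linarith
  have h1 := (one_add_inner_mem (‖c‖⁻¹ • c) (norm_inv_smul_self (norm_pos_iff.1 hc0)) ω).1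
  have h2 : 0 < ‖c‖ - T := by linarith
  have h3 : 0 < ‖c‖ - r := by linarith
  unfold coneWt
  positivity

theorem continuousOn_coneWt_left (hc : T + 2 ≤ ‖c‖) (a : ℝ) :
    ContinuousOn (fun z : ℝ × S2 => (1 + ⟪(z.2 : E3), ‖c‖⁻¹ • c⟫_ℝ) *
      (‖c‖ * (‖c‖ - z.1) ^ (γ - 1))) (Set.Icc a T ×ˢ Set.univ) := by
  refine ContinuousOn.mul (by fun_prop) ?_
  refine continuousOn_const.mul (ContinuousOn.rpow_const (by fun_prop) ?_)
  rintro ⟨r, ω⟩ ⟨hr, -⟩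
  left
  simp only
  linarith [hr.2]

theorem measurable_coneWt_left : Measurable fun z : ℝ × S2 =>
    (1 + ⟪(z.2 : E3), ‖c‖⁻¹ • c⟫_ℝ) * (‖c‖ * (‖c‖ - z.1) ^ (γ - 1)) := by
  have h1 : Measurable fun z : ℝ × S2 => ⟪(z.2 : E3), ‖c‖⁻¹ • c⟫_ℝ :=
    (by fun_prop : Continuous fun z : ℝ × S2 => ⟪(z.2 : E3), ‖c‖⁻¹ • c⟫_ℝ).measurable
  fun_prop

theorem measurable_coneWt : Measurable fun z : ℝ × S2 => coneWt γ T c z.1 z.2 :=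
  measurable_coneWt_left.add_const _

theorem lintegral_cone_le (hp : 2 < p) (hp3 : p ≤ 3) (hγ : 1 ≤ γ) (hγp : γ ≤ p - 1)
    (hf : ContDiff ℝ (⊤ : ℕ∞) f) (h : SolvesNLW p f) (hK : 0 ≤ K)
    (hDK : ∫⁻ x, ENNReal.ofReal ((1 + ‖x‖) ^ γ * (datD f x + |f (0, x)| ^ (p + 1))) ≤
      ENNReal.ofReal K) (hT : 0 ≤ T) (hc : T + 2 ≤ ‖c‖) :
    ∫⁻ r in Set.Ioc 0 T, ∫⁻ ω : S2, ENNReal.ofReal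
        (r ^ 2 * (coneWt γ T c r ω * |f (T - r, c + r • (ω : E3))| ^ (p + 1))) ∂σ ≤
      ENNReal.ofReal (16 * K) := by
  have hp1 : 0 ≤ p + 1 := by linarith
  have hpc : Continuous fun z : ℝ × S2 => pot p f (T - z.1, c + z.1 • (z.2 : E3)) :=
    (contDiff_pot hp hf).continuous.comp (by fun_prop)
  have hw := continuousOn_coneWt_left (γ := γ) hc 0
  have hpm := hpc.measurable
  have hc0 : 0 < ‖c‖ := by linarith
  have hu : 0 < ‖c‖ - T := by linarith
  obtain ⟨h1, h2⟩ := weighted_cone_le hp hp3 hγ hγp hf h hK hDK hT hc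
  have hsplit : ∀ r ∈ Set.Ioc 0 T, ∫⁻ ω : S2, ENNReal.ofReal
        (r ^ 2 * (coneWt γ T c r ω * |f (T - r, c + r • (ω : E3))| ^ (p + 1))) ∂σ =
      ∫⁻ ω : S2, ENNReal.ofReal ((p + 1) * (r ^ 2 * ((1 + ⟪(ω : E3), ‖c‖⁻¹ • c⟫_ℝ) *
        (‖c‖ * (‖c‖ - r) ^ (γ - 1)) * pot p f (T - r, c + r • (ω : E3))))) ∂σ +
      ∫⁻ ω : S2, ENNReal.ofReal ((p + 1) * ((‖c‖ - T) ^ γ * (r ^ 2 *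
        pot p f (T - r, c + r • (ω : E3))))) ∂σ := by
    intro r hr
    have hpm' : Measurable fun ω : S2 => pot p f (T - r, c + r • (ω : E3)) :=
      hpm.comp (measurable_prodMk_left (x := r))
    rw [← lintegral_add_right _
      (((hpm'.const_mul _).const_mul _).const_mul _).ennreal_ofReal]
    refine lintegral_congr fun ω => ?_
    have h3 := pot_nonneg hp f (T - r, c + r • (ω : E3))
    have h4 := (one_add_inner_mem (‖c‖⁻¹ • c) (norm_inv_smul_self (norm_pos_iff.1 hc0)) ω).1
    have h5 : 0 < ‖c‖ - r := by linarith [hr.2]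
    rw [← ENNReal.ofReal_add (by positivity) (by positivity)]
    congr 1
    have habs : |f (T - r, c + r • (ω : E3))| ^ (p + 1) =
        (p + 1) * pot p f (T - r, c + r • (ω : E3)) := by
      unfold pot
      field_simp
    rw [habs, coneWt]
    ring
  rw [setLIntegral_congr_fun measurableSet_Ioc hsplit, lintegral_add_right]
  · rw [lintegral_sphere_eq_ofReal hT, lintegral_sphere_eq_ofReal hT, ← ENNReal.ofReal_add]
    · refine ENNReal.ofReal_le_ofReal ?_
      simp only [integral_const_mul, intervalIntegral.integral_const_mul]
      nlinarith
    · exact intervalIntegral.integral_nonneg hT fun r hr => integral_nonneg fun ω => by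
        have h3 := pot_nonneg hp f (T - r, c + r • (ω : E3))
        have h4 := (one_add_inner_mem (‖c‖⁻¹ • c) (norm_inv_smul_self (norm_pos_iff.1 hc0)) ω).1
        have h5 : 0 < ‖c‖ - r := by linarith [hr.2]
        positivity
    · exact intervalIntegral.integral_nonneg hT fun r hr => integral_nonneg fun ω => by
        have h3 := pot_nonneg hp f (T - r, c + r • (ω : E3))
        positivity
    · exact continuousOn_const.mul (continuousOn_const.mul
        ((continuousOn_fst.pow 2).mul hpc.continuousOn))
    · intro r hr ω
      have h3 := pot_nonneg hp f (T - r, c + r • (ω : E3))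
      positivity
    · exact continuousOn_const.mul ((continuousOn_fst.pow 2).mul (hw.mul hpc.continuousOn))
    · intro r hr ω
      have h3 := pot_nonneg hp f (T - r, c + r • (ω : E3))
      have h4 := (one_add_inner_mem (‖c‖⁻¹ • c) (norm_inv_smul_self (norm_pos_iff.1 hc0)) ω).1
      have h5 : 0 < ‖c‖ - r := by linarith [hr.2]
      positivity
  · exact Measurable.lintegral_prod_right' (f := fun z : ℝ × S2 => ENNReal.ofReal
      ((p + 1) * ((‖c‖ - T) ^ γ * (z.1 ^ 2 * pot p f (T - z.1, c + z.1 • (z.2 : E3))))))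
      ((((measurable_fst.pow_const 2).mul hpm).const_mul _).const_mul _).ennreal_ofReal

theorem lintegral_cone_holder (hp : 2 < p) (hp3 : p ≤ 3) (hγ : 1 ≤ γ) (hγp : γ ≤ p - 1)
    (hf : ContDiff ℝ (⊤ : ℕ∞) f) (h : SolvesNLW p f) (hK : 0 ≤ K)
    (hDK : ∫⁻ x, ENNReal.ofReal ((1 + ‖x‖) ^ γ * (datD f x + |f (0, x)| ^ (p + 1))) ≤
      ENNReal.ofReal K) (hT : 0 ≤ T) (hc : T + 2 ≤ ‖c‖) {m a b : ℝ} (hm : 0 < m) (hmp : m < p + 1)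
    (ha : 0 ≤ a) (hb : b ≤ T) :
    ∫⁻ r in Set.Ioc a b, ∫⁻ ω : S2, ENNReal.ofReal
        (r * |f (T - r, c + r • (ω : E3))| ^ m) ∂σ ≤
      ENNReal.ofReal (16 * K) ^ (m / (p + 1)) *
      (∫⁻ r in Set.Ioc a b, ∫⁻ ω : S2, ENNReal.ofReal (r ^ ((p + 1 - 2 * m) / (p + 1 - m)) *
        coneWt γ T c r ω ^ (-(m / (p + 1 - m)))) ∂σ) ^ ((p + 1 - m) / (p + 1)) := by
  have hp1 : 0 < p + 1 := by linarith
  have hpm1 : 0 < p + 1 - m := by linarith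
  have hfm : Measurable fun z : ℝ × S2 => f (T - z.1, c + z.1 • (z.2 : E3)) :=
    (hf.continuous.comp (by fun_prop : Continuous fun z : ℝ × S2 =>
      (T - z.1, c + z.1 • (z.2 : E3)))).measurable
  have hwm := measurable_coneWt (γ := γ) (c := c) (T := T)
  set F : ℝ × S2 → ℝ≥0∞ := fun z => ENNReal.ofReal
    (z.1 ^ 2 * (coneWt γ T c z.1 z.2 * |f (T - z.1, c + z.1 • (z.2 : E3))| ^ (p + 1))) with hF
  set G : ℝ × S2 → ℝ≥0∞ := fun z => ENNReal.ofReal (z.1 ^ ((p + 1 - 2 * m) / (p + 1 - m)) *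
        coneWt γ T c z.1 z.2 ^ (-(m / (p + 1 - m)))) with hG
  have hFm : Measurable F := ((measurable_fst.pow_const 2).mul
    (hwm.mul ((measurable_abs.comp hfm).pow_const _))).ennreal_ofReal
  have hGm : Measurable G := ((measurable_fst.pow_const _).mul (hwm.pow_const _)).ennreal_ofReal
  have hfm' : ∀ z ∈ Set.Ioc a b ×ˢ (Set.univ : Set S2),
      ENNReal.ofReal (z.1 * |f (T - z.1, c + z.1 • (z.2 : E3))| ^ m) =
      F z ^ (m / (p + 1)) * G z ^ ((p + 1 - m) / (p + 1)) := by
    rintro ⟨r, ω⟩ ⟨hr, -⟩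
    have hr0 : 0 < r := ha.trans_lt hr.1
    have hw := coneWt_pos (γ := γ) hT hc (hr.2.trans hb) ω
    simp only [hF, hG]
    rw [ENNReal.ofReal_rpow_of_nonneg (by positivity) (by positivity),
      ENNReal.ofReal_rpow_of_nonneg (by positivity) (by positivity),
      ← ENNReal.ofReal_mul (by positivity)]
    congr 1
    set y := |f (T - r, c + r • (ω : E3))|
    have hy : 0 ≤ y := abs_nonneg _
    rw [mul_rpow (by positivity) (by positivity), mul_rpow hw.le (by positivity),
      mul_rpow (by positivity) (by positivity), ← rpow_mul hy, ← rpow_mul hr0.le, ← rpow_mul hw.le,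
      ← rpow_natCast r 2, ← rpow_mul hr0.le]
    have e1 : (p + 1) * (m / (p + 1)) = m := by field_simp
    have e2 : -(m / (p + 1 - m)) * ((p + 1 - m) / (p + 1)) = -(m / (p + 1)) := by field_simp
    have e3 : (p + 1 - 2 * m) / (p + 1 - m) * ((p + 1 - m) / (p + 1)) =
      1 - ((2 : ℕ) : ℝ) * (m / (p + 1)) := by push_cast; field_simp
    rw [e1, e2, e3, rpow_sub hr0, rpow_one, rpow_neg hw.le]
    have h1 : r ^ (((2 : ℕ) : ℝ) * (m / (p + 1))) ≠ 0 := (rpow_pos_of_pos hr0 _).ne'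
    have h2 : coneWt γ T c r ω ^ (m / (p + 1)) ≠ 0 := (rpow_pos_of_pos hw _).ne'
    field_simp
  have hprod : ∀ {H : ℝ × S2 → ℝ≥0∞}, Measurable H →
      ∫⁻ r in Set.Ioc a b, ∫⁻ ω : S2, H (r, ω) ∂σ =
        ∫⁻ z, H z ∂((volume.restrict (Set.Ioc a b)).prod σ) := fun hH =>
    (lintegral_prod _ hH.aemeasurable).symm
  have h1 := ENNReal.lintegral_mul_norm_pow_le (μ := (volume.restrict (Set.Ioc a b)).prod σ)
    hFm.aemeasurable hGm.aemeasurable (p := m / (p + 1)) (q := (p + 1 - m) / (p + 1))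
    (by positivity) (by positivity) (by field_simp; ring)
  rw [← hprod hFm, ← hprod hGm, ← hprod (H := fun z => F z ^ (m / (p + 1)) * G z ^ ((p + 1 - m) / (p + 1)))
    ((hFm.pow_const _).mul (hGm.pow_const _))] at h1
  refine le_trans (le_of_eq (setLIntegral_congr_fun measurableSet_Ioc fun r hr =>
    lintegral_congr fun ω => hfm' (r, ω) ⟨hr, trivial⟩)) (h1.trans ?_)
  gcongr
  refine (lintegral_mono_set (Set.Ioc_subset_Ioc ha hb)).trans ?_
  exact lintegral_cone_le hp hp3 hγ hγp hf h hK hDK hT hc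

end

theorem lintegral_Ioc_rpow_le {s R L : ℝ} (hs : s < -1) (hR : 0 < R) (hL : R ≤ L) :
    ∫⁻ r in Set.Ioc R L, ENNReal.ofReal (r ^ s) ≤ ENNReal.ofReal ((-(s + 1))⁻¹ * R ^ (s + 1)) := by
  have h0 : (0 : ℝ) ∉ Set.uIcc R L := by
    rw [Set.uIcc_of_le hL]
    exact fun h => absurd h.1 (not_le.2 hR)
  have hi : IntervalIntegrable (fun r : ℝ => r ^ s) volume R L :=
    intervalIntegral.intervalIntegrable_rpow (Or.inr h0)
  rw [← ofReal_integral_eq_lintegral_ofReal ((intervalIntegrable_iff_integrableOn_Ioc_of_le hL).1 hi)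
    ((ae_restrict_iff' measurableSet_Ioc).2 (Filter.Eventually.of_forall fun r hr =>
      rpow_nonneg (hR.le.trans hr.1.le) _)), ← intervalIntegral.integral_of_le hL,
    integral_rpow (Or.inr ⟨hs.ne, h0⟩)]
  refine ENNReal.ofReal_le_ofReal ?_
  have h1 : 0 ≤ L ^ (s + 1) := rpow_nonneg (hR.le.trans hL) _
  have h2 : 0 < -(s + 1) := by linarith
  rw [← neg_div_neg_eq, div_eq_inv_mul]
  gcongr
  linarith

theorem lintegral_Ioc_sub_rpow_le {s R L : ℝ} (hs : -1 < s) (hR : 0 ≤ R) (hL : R ≤ L) :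
    ∫⁻ r in Set.Ioc R L, ENNReal.ofReal ((L - r) ^ s) ≤
      ENNReal.ofReal ((s + 1)⁻¹ * L ^ (s + 1)) := by
  have hi : IntervalIntegrable (fun r : ℝ => (L - r) ^ s) volume R L := by
    have := (intervalIntegral.intervalIntegrable_rpow' (a := L - R) (b := 0) hs).comp_sub_left L
    simpa using this
  have h0 : 0 < s + 1 := by linarith
  rw [← ofReal_integral_eq_lintegral_ofReal ((intervalIntegrable_iff_integrableOn_Ioc_of_le hL).1 hi)
    ((ae_restrict_iff' measurableSet_Ioc).2 (Filter.Eventually.of_forall fun r hr =>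
      rpow_nonneg (by linarith [hr.2]) _)), ← intervalIntegral.integral_of_le hL,
    intervalIntegral.integral_comp_sub_left (fun r => r ^ s), sub_self,
    integral_rpow (Or.inl hs), zero_rpow h0.ne', sub_zero, div_eq_inv_mul]
  refine ENNReal.ofReal_le_ofReal ?_
  gcongr
  linarith

theorem lintegral_Ioc_mul_rpow_le {p γ R L T : ℝ} (hp : 2 < p) (hγ : 1 ≤ γ) (hγ2 : γ < 2)
    (hR : 0 < R) (hRL : 2 * R ≤ L) (hT : T ≤ L) :
    ∫⁻ r in Set.Ioc R T, ENNReal.ofReal (r ^ (1 - p) * (L - r) ^ (1 - γ)) ≤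
      ENNReal.ofReal ((2 / (p - 2) + 2 ^ (p - 1) / (2 - γ)) * (R ^ (2 - p) * L ^ (1 - γ))) := by
  have hL : 0 < L := by linarith
  have hp2 : 0 < p - 2 := by linarith
  have hg2 : 0 < 2 - γ := by linarith
  have hpt : ∀ r ∈ Set.Ioc R L, ENNReal.ofReal (r ^ (1 - p) * (L - r) ^ (1 - γ)) ≤
      ENNReal.ofReal ((L / 2) ^ (1 - γ)) * ENNReal.ofReal (r ^ (1 - p)) +
      ENNReal.ofReal ((L / 2) ^ (1 - p)) * ENNReal.ofReal ((L - r) ^ (1 - γ)) := by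
    intro r hr
    have hr0 : 0 < r := hR.trans hr.1
    have hLr : 0 ≤ L - r := by linarith [hr.2]
    rw [← ENNReal.ofReal_mul (by positivity), ← ENNReal.ofReal_mul (by positivity),
      ← ENNReal.ofReal_add (by positivity) (by positivity)]
    refine ENNReal.ofReal_le_ofReal ?_
    rcases le_total r (L / 2) with h | h
    · have : (L - r) ^ (1 - γ) ≤ (L / 2) ^ (1 - γ) :=
        rpow_le_rpow_of_nonpos (by positivity) (by linarith) (by linarith)
      have h2 : 0 ≤ (L / 2) ^ (1 - p) * (L - r) ^ (1 - γ) := by positivity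
      have h3 : r ^ (1 - p) * (L - r) ^ (1 - γ) ≤ (L / 2) ^ (1 - γ) * r ^ (1 - p) := by
        rw [mul_comm]
        gcongr
      linarith
    · have : r ^ (1 - p) ≤ (L / 2) ^ (1 - p) :=
        rpow_le_rpow_of_nonpos (by positivity) (by linarith) (by linarith)
      have h2 : 0 ≤ (L / 2) ^ (1 - γ) * r ^ (1 - p) := by positivity
      have h3 : r ^ (1 - p) * (L - r) ^ (1 - γ) ≤ (L / 2) ^ (1 - p) * (L - r) ^ (1 - γ) := by
        gcongr
      linarith
  refine (lintegral_mono_set (Set.Ioc_subset_Ioc_right hT)).trans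
    ((setLIntegral_mono' measurableSet_Ioc hpt).trans ?_)
  rw [lintegral_add_left (by fun_prop), lintegral_const_mul' _ _ ENNReal.ofReal_ne_top,
    lintegral_const_mul' _ _ ENNReal.ofReal_ne_top]
  refine (add_le_add (mul_le_mul_right (lintegral_Ioc_rpow_le (by linarith) hR (by linarith)) _)
    (mul_le_mul_right (lintegral_Ioc_sub_rpow_le (by linarith) hR.le (by linarith)) _)).trans ?_
  have e0 : 0 < -(1 - p + 1) := by linarith
  have e0' : 0 < 1 - γ + 1 := by linarith
  rw [← ENNReal.ofReal_mul (by positivity), ← ENNReal.ofReal_mul (by positivity),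
      ← ENNReal.ofReal_add (by positivity) (by positivity)]
  refine ENNReal.ofReal_le_ofReal ?_
  rw [add_mul]
  have e1 : 1 - p + 1 = 2 - p := by ring
  have e2 : 1 - γ + 1 = 2 - γ := by ring
  rw [e1, e2, neg_sub]
  refine add_le_add ?_ ?_
  · have : (L / 2) ^ (1 - γ) ≤ 2 * L ^ (1 - γ) := by
      rw [div_rpow hL.le (by norm_num), div_eq_mul_inv, ← rpow_neg (by norm_num), mul_comm]
      have : (2 : ℝ) ^ (-(1 - γ)) ≤ 2 ^ (1 : ℝ) :=
        rpow_le_rpow_of_exponent_le (by norm_num) (by linarith)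
      rw [rpow_one] at this
      gcongr
    calc (L / 2) ^ (1 - γ) * ((p - 2)⁻¹ * R ^ (2 - p))
        ≤ 2 * L ^ (1 - γ) * ((p - 2)⁻¹ * R ^ (2 - p)) := by gcongr
      _ = _ := by ring
  · have h1 : (L / 2) ^ (1 - p) = 2 ^ (p - 1) * L ^ (1 - p) := by
      rw [div_rpow hL.le (by norm_num), div_eq_mul_inv, ← rpow_neg (by norm_num), mul_comm, neg_sub]
    have h2 : L ^ (1 - p) * L ^ (2 - γ) = L ^ (2 - p) * L ^ (1 - γ) := by
      rw [← rpow_add hL, ← rpow_add hL]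
      ring_nf
    have h3 : L ^ (2 - p) ≤ R ^ (2 - p) :=
      rpow_le_rpow_of_nonpos hR (by linarith) (by linarith)
    calc (L / 2) ^ (1 - p) * ((2 - γ)⁻¹ * L ^ (2 - γ))
        = 2 ^ (p - 1) / (2 - γ) * (L ^ (1 - p) * L ^ (2 - γ)) := by rw [h1]; ring
      _ ≤ _ := by rw [h2]; gcongr

section

variable {p γ K T R : ℝ} {f : ℝ × E3 → ℝ} {c : E3}

theorem lintegral_cone_long_le (hp : 2 < p) (hp3 : p ≤ 3) (hγ : 1 ≤ γ) (hγ2 : γ < 2)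
    (hγp : γ ≤ p - 1)
    (hf : ContDiff ℝ (⊤ : ℕ∞) f) (h : SolvesNLW p f) (hK : 0 ≤ K)
    (hDK : ∫⁻ x, ENNReal.ofReal ((1 + ‖x‖) ^ γ * (datD f x + |f (0, x)| ^ (p + 1))) ≤
      ENNReal.ofReal K) (hT : 0 ≤ T) (hc : T + 2 ≤ ‖c‖) (hR : 0 < R) (hRc : 2 * R ≤ ‖c‖) :
    ∫⁻ r in Set.Ioc R T, ∫⁻ ω : S2, ENNReal.ofReal
        (r * |f (T - r, c + r • (ω : E3))| ^ p) ∂σ ≤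
      ENNReal.ofReal ((16 * K) ^ (p / (p + 1)) *
        (48 / (p - 1) * (2 / (p - 2) + 2 ^ (p - 1) / (2 - γ)) *
          (R ^ (2 - p) * ‖c‖ ^ (-γ) * ((‖c‖ - T) ^ γ) ^ (1 - p))) ^ (1 / (p + 1))) := by
  have hc0 : 0 < ‖c‖ := by linarith
  have hu : 0 < ‖c‖ - T := by linarith
  have hp2 : 0 < p - 2 := by linarith
  have hp1 : 0 < p - 1 := by linarith
  have hg2 : 0 < 2 - γ := by linarith
  have he := norm_inv_smul_self (norm_pos_iff.1 hc0)
  refine (lintegral_cone_holder hp hp3 hγ hγp hf h hK hDK hT hc (m := p) (by linarith)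
    (by linarith) hR.le le_rfl).trans ?_
  have e1 : p + 1 - p = 1 := by ring
  have e2 : p + 1 - 2 * p = 1 - p := by ring
  rw [e1, e2, div_one, div_one]
  have hin : ∀ r ∈ Set.Ioc R T, ∫⁻ ω : S2, ENNReal.ofReal (r ^ (1 - p) *
      coneWt γ T c r ω ^ (-p)) ∂σ ≤
      ENNReal.ofReal (48 / (p - 1) * ‖c‖⁻¹ * ((‖c‖ - T) ^ γ) ^ (1 - p)) *
        ENNReal.ofReal (r ^ (1 - p) * (‖c‖ - r) ^ (1 - γ)) := by
    intro r hr
    have hr0 : 0 < r := hR.trans hr.1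
    have h1 : 0 < ‖c‖ - r := by linarith [hr.2]
    have h2 := lintegral_zonal_rpow_le_of_one_lt (‖c‖⁻¹ • c) he (q := p)
      (A := ‖c‖ * (‖c‖ - r) ^ (γ - 1)) (b := (‖c‖ - T) ^ γ) (by linarith) (by positivity)
      (by positivity)
    simp only [ENNReal.ofReal_mul (rpow_nonneg hr0.le (1 - p))]
    rw [lintegral_const_mul' _ _ ENNReal.ofReal_ne_top]
    refine (mul_le_mul_right h2 _).trans (le_of_eq ?_)
    rw [← ENNReal.ofReal_mul (by positivity), ← ENNReal.ofReal_mul (by positivity),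
      ← ENNReal.ofReal_mul (by positivity), ← neg_sub γ 1, rpow_neg h1.le (γ - 1), mul_inv]
    congr 1
    ring
  have hout := (setLIntegral_mono' (μ := volume) measurableSet_Ioc hin).trans (le_of_eq
    (lintegral_const_mul' _ _ ENNReal.ofReal_ne_top))
  have hout2 := hout.trans (mul_le_mul_right (lintegral_Ioc_mul_rpow_le hp hγ hγ2 hR hRc
    (by linarith : T ≤ ‖c‖)) _)
  rw [← ENNReal.ofReal_mul (by positivity)] at hout2
  have e3 : 48 / (p - 1) * ‖c‖⁻¹ * ((‖c‖ - T) ^ γ) ^ (1 - p) *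
      ((2 / (p - 2) + 2 ^ (p - 1) / (2 - γ)) * (R ^ (2 - p) * ‖c‖ ^ (1 - γ))) =
      48 / (p - 1) * (2 / (p - 2) + 2 ^ (p - 1) / (2 - γ)) *
          (R ^ (2 - p) * ‖c‖ ^ (-γ) * ((‖c‖ - T) ^ γ) ^ (1 - p)) := by
    rw [sub_eq_neg_add 1 γ, rpow_add_one hc0.ne']
    field_simp
  rw [e3] at hout2
  rw [ENNReal.ofReal_mul (p := (16 * K) ^ (p / (p + 1))) (by positivity),
    ← ENNReal.ofReal_rpow_of_nonneg (by positivity)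
    (by positivity), ← ENNReal.ofReal_rpow_of_nonneg (by positivity) (by positivity)]
  gcongr

theorem lintegral_cone_short_le (hp : 2 < p) (hp3 : p < 3) (hγ : 1 ≤ γ) (hγ2 : γ < 2)
    (hγp : γ ≤ p - 1)
    (hf : ContDiff ℝ (⊤ : ℕ∞) f) (h : SolvesNLW p f) (hK : 0 ≤ K)
    (hDK : ∫⁻ x, ENNReal.ofReal ((1 + ‖x‖) ^ γ * (datD f x + |f (0, x)| ^ (p + 1))) ≤
      ENNReal.ofReal K) (hT : 0 ≤ T) (hc : T + 2 ≤ ‖c‖) (hR : 0 < R) (hRc : 2 * R ≤ ‖c‖)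
    {b : ℝ} (hbR : b ≤ R) (hbT : b ≤ T) :
    ∫⁻ r in Set.Ioc 0 b, ∫⁻ ω : S2, ENNReal.ofReal
        (r * |f (T - r, c + r • (ω : E3))| ^ (p - 1)) ∂σ ≤
      ENNReal.ofReal ((16 * K) ^ ((p - 1) / (p + 1)) *
        (96 * (2 ^ (1 - (p - 1) / 2) / (1 - (p - 1) / 2)) *
          (R ^ ((5 - p) / 2) * ‖c‖ ^ (-(γ * ((p - 1) / 2))))) ^ (2 / (p + 1))) := by
  have hc0 : 0 < ‖c‖ := by linarith
  have hq1 : 0 < 1 - (p - 1) / 2 := by linarith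
  have hu : 0 < ‖c‖ - T := by linarith
  have hp1 : 0 < p - 1 := by linarith
  have he := norm_inv_smul_self (norm_pos_iff.1 hc0)
  refine (lintegral_cone_holder hp hp3.le hγ hγp hf h hK hDK hT hc (m := p - 1) (by linarith)
    (by linarith) le_rfl hbT).trans ?_
  have e1 : p + 1 - (p - 1) = 2 := by ring
  have e2 : p + 1 - 2 * (p - 1) = 3 - p := by ring
  rw [e1, e2]
  have hin : ∀ r ∈ Set.Ioc 0 b, ∫⁻ ω : S2, ENNReal.ofReal (r ^ ((3 - p) / 2) *
      coneWt γ T c r ω ^ (-((p - 1) / 2))) ∂σ ≤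
      ENNReal.ofReal (R ^ ((3 - p) / 2) * (96 * (2 ^ (1 - (p - 1) / 2) / (1 - (p - 1) / 2)) *
        ‖c‖ ^ (-(γ * ((p - 1) / 2))))) := by
    intro r hr
    have hr0 : 0 < r := hr.1
    have h1 : 0 < ‖c‖ - r := by linarith [hr.2]
    have h2 := lintegral_zonal_rpow_le_of_lt_one (‖c‖⁻¹ • c) he (q := (p - 1) / 2)
      (A := ‖c‖ * (‖c‖ - r) ^ (γ - 1)) (b := (‖c‖ - T) ^ γ) (by linarith) (by linarith)
      (by positivity) (by positivity)
    simp only [ENNReal.ofReal_mul (rpow_nonneg hr0.le ((3 - p) / 2))]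
    rw [lintegral_const_mul' _ _ ENNReal.ofReal_ne_top]
    refine (mul_le_mul_right h2 _).trans ?_
    rw [← ENNReal.ofReal_mul (by positivity)]
    refine ENNReal.ofReal_le_ofReal ?_
    have hA : ‖c‖ * (‖c‖ / 2) ^ (γ - 1) ≤ ‖c‖ * (‖c‖ - r) ^ (γ - 1) := by
      gcongr
      linarith [hr.2]
    have hA2 : (‖c‖ * (‖c‖ - r) ^ (γ - 1)) ^ (-((p - 1) / 2)) ≤
        2 * ‖c‖ ^ (-(γ * ((p - 1) / 2))) := by
      refine (rpow_le_rpow_of_nonpos (by positivity) hA (by linarith)).trans ?_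
      have e3 : ‖c‖ * (‖c‖ / 2) ^ (γ - 1) = ‖c‖ ^ γ * 2 ^ (-(γ - 1)) := by
        rw [div_rpow hc0.le (by norm_num), rpow_neg (by norm_num), div_eq_mul_inv, ← mul_assoc,
          rpow_sub_one hc0.ne']
        field_simp
      rw [e3, mul_rpow (by positivity) (by positivity), ← rpow_mul hc0.le,
        ← rpow_mul (by norm_num), mul_comm, mul_neg γ]
      have : (2 : ℝ) ^ (-(γ - 1) * -((p - 1) / 2)) ≤ 2 ^ (1 : ℝ) :=
        rpow_le_rpow_of_exponent_le (by norm_num) (by nlinarith)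
      rw [rpow_one] at this
      gcongr
    have hr2 : r ^ ((3 - p) / 2) ≤ R ^ ((3 - p) / 2) :=
      rpow_le_rpow hr0.le (hr.2.trans hbR) (by linarith)
    calc _ ≤ R ^ ((3 - p) / 2) * (48 * (2 ^ (1 - (p - 1) / 2) / (1 - (p - 1) / 2)) *
          (2 * ‖c‖ ^ (-(γ * ((p - 1) / 2))))) := by gcongr
      _ = _ := by ring
  have hout := (setLIntegral_mono' (μ := volume) measurableSet_Ioc hin).trans (le_of_eq
    (setLIntegral_const _ _))
  rw [Real.volume_Ioc, sub_zero] at hout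
  have hout2 := hout.trans (mul_le_mul_right (ENNReal.ofReal_le_ofReal hbR) _)
  rw [← ENNReal.ofReal_mul (by positivity)] at hout2
  have e3 : R ^ ((3 - p) / 2) * (96 * (2 ^ (1 - (p - 1) / 2) / (1 - (p - 1) / 2)) *
        ‖c‖ ^ (-(γ * ((p - 1) / 2)))) * R =
      96 * (2 ^ (1 - (p - 1) / 2) / (1 - (p - 1) / 2)) *
          (R ^ ((5 - p) / 2) * ‖c‖ ^ (-(γ * ((p - 1) / 2)))) := by
    have : (5 - p) / 2 = (3 - p) / 2 + 1 := by ring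
    rw [this, rpow_add_one hR.ne']
    ring
  rw [e3] at hout2
  rw [ENNReal.ofReal_mul (p := (16 * K) ^ ((p - 1) / (p + 1))) (by positivity),
    ← ENNReal.ofReal_rpow_of_nonneg (by positivity)
    (by positivity), ← ENNReal.ofReal_rpow_of_nonneg (by positivity) (by positivity)]
  gcongr

end

theorem abs_le_mean_add_integral {g g' G G' : ℝ → ℝ} (hg : ∀ r, HasDerivAt g (g' r) r)
    (hg' : Continuous g') (hG : Continuous G) (hG' : Continuous G') {T R : ℝ} (hT : 0 ≤ T)
    (hTR : T ≤ R) (hR : 0 < R) (h : ∀ r ∈ Set.Icc 0 R, |g r| ≤ G r)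
    (h' : ∀ r ∈ Set.Icc 0 R, |g' r| ≤ G' r) :
    R ^ 3 * |g T| ≤ (∫ r in (0 : ℝ)..R, (3 * r ^ 2 * G r + r ^ 3 * G' r)) +
      R ^ 3 * ∫ r in T..R, G' r := by
  have hgc : Continuous g := continuous_iff_continuousAt.2 fun r => (hg r).continuousAt
  have h1 : R ^ 3 * g R = ∫ r in (0 : ℝ)..R, (3 * r ^ 2 * g r + r ^ 3 * g' r) := by
    rw [intervalIntegral.integral_eq_sub_of_hasDerivAt (f := fun r => r ^ 3 * g r)]
    · simp
    · intro r _
      exact ((hasDerivAt_pow 3 r).mul (hg r)).congr_deriv (by simp)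
    · exact Continuous.intervalIntegrable (by fun_prop) _ _
  have h2 : g R - g T = ∫ r in T..R, g' r :=
    (intervalIntegral.integral_eq_sub_of_hasDerivAt (fun r _ => hg r)
      (hg'.intervalIntegrable _ _)).symm
  have h3 : |R ^ 3 * g R| ≤ ∫ r in (0 : ℝ)..R, (3 * r ^ 2 * G r + r ^ 3 * G' r) := by
    rw [h1, ← Real.norm_eq_abs]
    refine intervalIntegral.norm_integral_le_of_norm_le hR.le
      (Filter.Eventually.of_forall fun r hr => ?_)
      (Continuous.intervalIntegrable (by fun_prop) _ _)
    have hr0 := hr.1.le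
    have hm : r ∈ Set.Icc 0 R := ⟨hr0, hr.2⟩
    rw [Real.norm_eq_abs]
    refine (abs_add_le _ _).trans (add_le_add ?_ ?_)
    · rw [abs_mul, abs_of_nonneg (by positivity)]
      exact mul_le_mul_of_nonneg_left (h r hm) (by positivity)
    · rw [abs_mul, abs_of_nonneg (by positivity)]
      exact mul_le_mul_of_nonneg_left (h' r hm) (by positivity)
  have h4 : |g R - g T| ≤ ∫ r in T..R, G' r := by
    rw [h2, ← Real.norm_eq_abs]
    exact intervalIntegral.norm_integral_le_of_norm_le hTR
      (Filter.Eventually.of_forall fun r hr => h' r ⟨hT.trans hr.1.le, hr.2⟩)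
      (hG'.intervalIntegrable _ _)
  rw [abs_mul, abs_of_pos (by positivity)] at h3
  have h5 : |g T| ≤ |g R| + |g R - g T| := by
    have := abs_sub_abs_le_abs_sub (g T) (g R)
    rw [abs_sub_comm] at this
    linarith
  calc R ^ 3 * |g T| ≤ R ^ 3 * (|g R| + |g R - g T|) := by gcongr
    _ ≤ _ := by rw [mul_add]; gcongr

theorem pd_comp_snd {a : E3 → ℝ} (ha : Differentiable ℝ a) (v : ℝ × E3) :
    pd v (fun q => a q.2) = fun q => fderiv ℝ a q.2 v.2 := by
  ext q
  have := (ha q.2).hasFDerivAt.comp q (hasFDerivAt_snd (𝕜 := ℝ) (E := ℝ) (F := E3))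
  have h2 : fderiv ℝ (fun q : ℝ × E3 => a q.2) q = _ := this.fderiv
  rw [pd, h2]
  rfl

theorem abs_fderiv_fderiv_le {a : E3 → ℝ} (ha : ContDiff ℝ (⊤ : ℕ∞) a) (x v w : E3) :
    |fderiv ℝ (fun y => fderiv ℝ a y v) x w| ≤ ‖iteratedFDeriv ℝ 2 a x‖ * (‖w‖ * ‖v‖) := by
  have h1 : DifferentiableAt ℝ (fderiv ℝ a) x :=
    (ha.fderiv_right (m := (⊤ : ℕ∞)) (by simp)).differentiable (by simp) x
  have h2 : fderiv ℝ (fun y => fderiv ℝ a y v) x w = iteratedFDeriv ℝ 2 a x ![w, v] := by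
    rw [iteratedFDeriv_two_apply, fderiv_clm_apply h1 (differentiableAt_const v)]
    simp
  rw [h2, ← Real.norm_eq_abs]
  refine (ContinuousMultilinearMap.le_opNorm _ _).trans (le_of_eq ?_)
  simp [Fin.prod_univ_two]

theorem sphere_lap_deriv {a : E3 → ℝ} (ha : ContDiff ℝ (⊤ : ℕ∞) a) (c : E3) (r : ℝ) :
    HasDerivAt (fun r : ℝ => ∫ ω : S2, (a (c + r • (ω : E3)) +
        r * ∑ i, (ω : E3) i * fderiv ℝ a (c + r • (ω : E3)) (ee i)) ∂σ)
      (r * ∫ ω : S2, ∑ i, fderiv ℝ (fun y => fderiv ℝ a y (ee i)) (c + r • (ω : E3)) (ee i) ∂σ)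
      r := by
  have hd : Differentiable ℝ a := ha.differentiable (by simp)
  have hd2 : ∀ v, Differentiable ℝ fun y => fderiv ℝ a y v := fun v =>
    ((ha.fderiv_right (m := (⊤ : ℕ∞)) (by simp)).clm_apply contDiff_const).differentiable (by simp)
  have h := hasDerivAt_kirchhoff (f := fun q => a q.2) (ha.comp contDiff_snd) 0 c r
  have h0 : kirchhoff (fun q => a q.2) 0 c = fun r : ℝ => ∫ ω : S2, (a (c + r • (ω : E3)) +
        r * ∑ i, (ω : E3) i * fderiv ℝ a (c + r • (ω : E3)) (ee i)) ∂σ := by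
    ext r
    simp [kirchhoff, pd_comp_snd hd]
  rw [h0] at h
  refine h.congr_deriv ?_
  simp only [pd_comp_snd hd]
  simp only [pd_comp_snd (hd2 _)]
  simp

/-- Size of the first-order derivatives of the data `(a, b)`. -/
def datNorm1 (a b : E3 → ℝ) (x : E3) : ℝ := ‖fderiv ℝ a x‖ + |b x|

/-- Size of the second-order derivatives of the data `(a, b)`. -/
def datNorm2 (a b : E3 → ℝ) (x : E3) : ℝ := ‖iteratedFDeriv ℝ 2 a x‖ + ‖fderiv ℝ b x‖

theorem continuous_datNorm1 {a b : E3 → ℝ} (ha : ContDiff ℝ (⊤ : ℕ∞) a)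
    (hb : ContDiff ℝ (⊤ : ℕ∞) b) : Continuous (datNorm1 a b) :=
  ((ha.continuous_fderiv (by simp)).norm).add hb.continuous.abs

theorem continuous_datNorm2 {a b : E3 → ℝ} (ha : ContDiff ℝ (⊤ : ℕ∞) a)
    (hb : ContDiff ℝ (⊤ : ℕ∞) b) : Continuous (datNorm2 a b) :=
  (((contDiff_infty.1 ha 2).continuous_iteratedFDeriv le_rfl).norm).add
    (hb.continuous_fderiv (by simp)).norm

theorem datNorm1_nonneg (a b : E3 → ℝ) (x : E3) : 0 ≤ datNorm1 a b x := by
  unfold datNorm1; positivity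

theorem datNorm2_nonneg (a b : E3 → ℝ) (x : E3) : 0 ≤ datNorm2 a b x := by
  unfold datNorm2; positivity

theorem mean_bounds_combine {m0 m1 m2 : ℝ → ℝ} (hm0 : Continuous m0) (hm1 : Continuous m1)
    (hm2 : Continuous m2) (h1 : ∀ r, 0 ≤ m1 r) (h2 : ∀ r, 0 ≤ m2 r) {T R n v : ℝ} (hT : 0 ≤ T)
    (hTR : T ≤ R)
    (A1 : R ^ 3 * n ≤ (∫ r in (0 : ℝ)..R, (3 * r ^ 2 * (m0 r + R * m1 r) + r ^ 3 * (3 * r * m2 r))) +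
      R ^ 3 * ∫ r in T..R, 3 * r * m2 r)
    (A2 : R ^ 3 * v ≤ (∫ r in (0 : ℝ)..R, (3 * r ^ 2 * m1 r + r ^ 3 * m2 r)) +
      R ^ 3 * ∫ r in T..R, m2 r) :
    R ^ 3 * (T * v + n) ≤ 3 * (∫ r in (0 : ℝ)..R, r ^ 2 * m0 r) +
      6 * R * (∫ r in (0 : ℝ)..R, r ^ 2 * m1 r) +
      4 * R ^ 2 * (∫ r in (0 : ℝ)..R, r ^ 2 * m2 r) + 4 * R ^ 3 * (∫ r in T..R, r * m2 r) := by
  have hR : 0 ≤ R := hT.trans hTR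
  have i0 : IntervalIntegrable (fun r : ℝ => 3 * (r ^ 2 * m0 r)) volume 0 R :=
    Continuous.intervalIntegrable (by fun_prop) _ _
  have i1 : ∀ k : ℝ, IntervalIntegrable (fun r : ℝ => k * (r ^ 2 * m1 r)) volume 0 R :=
    fun k => Continuous.intervalIntegrable (by fun_prop) _ _
  have i2 : ∀ k : ℝ, IntervalIntegrable (fun r : ℝ => k * (r ^ 2 * m2 r)) volume 0 R :=
    fun k => Continuous.intervalIntegrable (by fun_prop) _ _
  have B1 : (∫ r in (0 : ℝ)..R, (3 * r ^ 2 * (m0 r + R * m1 r) + r ^ 3 * (3 * r * m2 r))) ≤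
      ∫ r in (0 : ℝ)..R, (3 * (r ^ 2 * m0 r) + 3 * R * (r ^ 2 * m1 r) +
        3 * R ^ 2 * (r ^ 2 * m2 r)) := by
    refine intervalIntegral.integral_mono_on hR (Continuous.intervalIntegrable (by fun_prop) _ _)
      (Continuous.intervalIntegrable (by fun_prop) _ _) fun r hr => ?_
    have e1 : r ^ 2 ≤ R ^ 2 := pow_le_pow_left₀ hr.1 hr.2 2
    have := mul_le_mul_of_nonneg_right e1 (mul_nonneg (sq_nonneg r) (h2 r))
    nlinarith
  have B2 : T * (∫ r in (0 : ℝ)..R, (3 * r ^ 2 * m1 r + r ^ 3 * m2 r)) ≤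
      ∫ r in (0 : ℝ)..R, (3 * R * (r ^ 2 * m1 r) + R ^ 2 * (r ^ 2 * m2 r)) := by
    rw [← intervalIntegral.integral_const_mul]
    refine intervalIntegral.integral_mono_on hR (Continuous.intervalIntegrable (by fun_prop) _ _)
      (Continuous.intervalIntegrable (by fun_prop) _ _) fun r hr => ?_
    have e1 : T * r ≤ R ^ 2 := by nlinarith [hr.1, hr.2]
    have e2 := mul_le_mul_of_nonneg_right e1 (mul_nonneg (sq_nonneg r) (h2 r))
    have e3 := mul_le_mul_of_nonneg_right hTR (mul_nonneg (sq_nonneg r) (h1 r))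
    nlinarith
  have B3 : T * (∫ r in T..R, m2 r) ≤ ∫ r in T..R, r * m2 r := by
    rw [← intervalIntegral.integral_const_mul]
    refine intervalIntegral.integral_mono_on hTR (Continuous.intervalIntegrable (by fun_prop) _ _)
      (Continuous.intervalIntegrable (by fun_prop) _ _) fun r hr => ?_
    exact mul_le_mul_of_nonneg_right hr.1 (h2 r)
  have B4 : (∫ r in T..R, 3 * r * m2 r) = 3 * ∫ r in T..R, r * m2 r := by
    simp_rw [mul_assoc]
    rw [intervalIntegral.integral_const_mul]
  rw [intervalIntegral.integral_add (i0.add (i1 _)) (i2 _),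
    intervalIntegral.integral_add i0 (i1 _)] at B1
  rw [intervalIntegral.integral_add (i1 _) (i2 _)] at B2
  simp only [intervalIntegral.integral_const_mul] at B1 B2
  rw [B4] at A1
  have A3 := mul_le_mul_of_nonneg_left A2 hT
  have B5 := mul_le_mul_of_nonneg_left B3 (pow_nonneg hR 3)
  linarith

theorem abs_kirchhoff_data_le {a b : E3 → ℝ} (ha : ContDiff ℝ (⊤ : ℕ∞) a)
    (hb : ContDiff ℝ (⊤ : ℕ∞) b) (c : E3) {T R : ℝ} (hT : 0 ≤ T) (hTR : T ≤ R) (hR : 0 < R) :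
    R ^ 3 * |∫ ω : S2, (T * b (c + T • (ω : E3)) + a (c + T • (ω : E3)) +
      T * ∑ i, (ω : E3) i * fderiv ℝ a (c + T • (ω : E3)) (ee i)) ∂σ| ≤
    3 * (∫ r in (0 : ℝ)..R, r ^ 2 * ∫ ω : S2, |a (c + r • (ω : E3))| ∂σ) +
    6 * R * (∫ r in (0 : ℝ)..R, r ^ 2 * ∫ ω : S2, datNorm1 a b (c + r • (ω : E3)) ∂σ) +
    4 * R ^ 2 * (∫ r in (0 : ℝ)..R, r ^ 2 * ∫ ω : S2, datNorm2 a b (c + r • (ω : E3)) ∂σ) +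
    4 * R ^ 3 * (∫ r in T..R, r * ∫ ω : S2, datNorm2 a b (c + r • (ω : E3)) ∂σ) := by
  have hcomp : ∀ {g : E3 → ℝ}, Continuous g → Continuous (Function.uncurry fun (r : ℝ) (ω : S2) =>
      g (c + r • (ω : E3))) := fun hg => hg.comp (by fun_prop)
  have hcr : ∀ {g : E3 → ℝ}, Continuous g → ∀ r : ℝ, Continuous fun ω : S2 =>
      g (c + r • (ω : E3)) := fun hg r => hg.comp (by fun_prop)
  have hmean : ∀ {g : E3 → ℝ}, Continuous g → Continuous fun r : ℝ => ∫ ω : S2,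
      g (c + r • (ω : E3)) ∂σ := fun hg => continuous_integral_sphere (hcomp hg)
  have h_integ : ∀ {g : E3 → ℝ}, Continuous g → ∀ r : ℝ, Integrable (fun ω : S2 =>
      g (c + r • (ω : E3))) σ := fun hg r => (hcr hg r).integrable_sphere
  have hH1 := continuous_datNorm1 ha hb
  have hH2 := continuous_datNorm2 ha hb
  have hfa : Continuous (fderiv ℝ a) := ha.continuous_fderiv (by simp)
  have hfb : Continuous (fderiv ℝ b) := hb.continuous_fderiv (by simp)
  have hm0 := hmean ha.continuous.abs
  have hm1 := hmean hH1
  have hm2 := hmean hH2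
  have hfa1 : ∀ v, ContDiff ℝ (⊤ : ℕ∞) fun y => fderiv ℝ a y v := fun v =>
    (ha.fderiv_right (m := (⊤ : ℕ∞)) (by simp)).clm_apply contDiff_const
  have hlap : Continuous fun x => ∑ i, fderiv ℝ (fun y => fderiv ℝ a y (ee i)) x (ee i) :=
    continuous_finsetSum _ fun i _ => ((hfa1 (ee i)).continuous_fderiv (by simp)).clm_apply
      continuous_const
  have hn : ∀ r : ℝ, 0 ≤ r → r ≤ R → |∫ ω : S2, (a (c + r • (ω : E3)) +
        r * ∑ i, (ω : E3) i * fderiv ℝ a (c + r • (ω : E3)) (ee i)) ∂σ| ≤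
      (∫ ω : S2, |a (c + r • (ω : E3))| ∂σ) +
        R * ∫ ω : S2, datNorm1 a b (c + r • (ω : E3)) ∂σ := by
    intro r hr hrR
    rw [← integral_const_mul, ← integral_add (h_integ ha.continuous.abs r)
      ((h_integ hH1 r).const_mul R), ← Real.norm_eq_abs]
    refine norm_integral_le_of_norm_le ((h_integ ha.continuous.abs r).add
      ((h_integ hH1 r).const_mul R)) (Filter.Eventually.of_forall fun ω => ?_)
    rw [← clm_eq_sum, Real.norm_eq_abs]
    refine (abs_add_le _ _).trans (add_le_add le_rfl ?_)
    rw [abs_mul, abs_of_nonneg hr]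
    have h1 : |fderiv ℝ a (c + r • (ω : E3)) ω| ≤ datNorm1 a b (c + r • (ω : E3)) := by
      have := (fderiv ℝ a (c + r • (ω : E3))).le_opNorm ω
      rw [norm_eq_of_mem_sphere, mul_one, Real.norm_eq_abs] at this
      have h3 := abs_nonneg (b (c + r • (ω : E3)))
      rw [datNorm1]
      linarith
    gcongr
  have hn' : ∀ r : ℝ, 0 ≤ r → |r * ∫ ω : S2, ∑ i, fderiv ℝ (fun y => fderiv ℝ a y (ee i))
      (c + r • (ω : E3)) (ee i) ∂σ| ≤ 3 * r * ∫ ω : S2, datNorm2 a b (c + r • (ω : E3)) ∂σ := by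
    intro r hr
    rw [abs_mul, abs_of_nonneg hr, mul_comm 3 r, mul_assoc, ← integral_const_mul,
      ← Real.norm_eq_abs]
    refine mul_le_mul_of_nonneg_left (norm_integral_le_of_norm_le ((h_integ hH2 r).const_mul 3)
      (Filter.Eventually.of_forall fun ω => ?_)) hr
    rw [Real.norm_eq_abs]
    refine (Finset.abs_sum_le_sum_abs _ _).trans ?_
    have h1 : ∀ i ∈ Finset.univ, |fderiv ℝ (fun y => fderiv ℝ a y (ee i))
        (c + r • (ω : E3)) (ee i)| ≤ datNorm2 a b (c + r • (ω : E3)) := by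
      intro i _
      refine (abs_fderiv_fderiv_le ha _ _ _).trans ?_
      simp only [PiLp.norm_single, norm_one, mul_one]
      exact le_add_of_nonneg_right (norm_nonneg _)
    refine (Finset.sum_le_card_nsmul _ _ _ h1).trans (le_of_eq ?_)
    simp
  have hv : ∀ r : ℝ, |∫ ω : S2, b (c + r • (ω : E3)) ∂σ| ≤
      ∫ ω : S2, datNorm1 a b (c + r • (ω : E3)) ∂σ := by
    intro r
    rw [← Real.norm_eq_abs]
    refine norm_integral_le_of_norm_le (h_integ hH1 r) (Filter.Eventually.of_forall fun ω => ?_)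
    exact le_add_of_nonneg_left (norm_nonneg _)
  have hv' : ∀ r : ℝ, |∫ ω : S2, fderiv ℝ b (c + r • (ω : E3)) ω ∂σ| ≤
      ∫ ω : S2, datNorm2 a b (c + r • (ω : E3)) ∂σ := by
    intro r
    rw [← Real.norm_eq_abs]
    refine norm_integral_le_of_norm_le (h_integ hH2 r) (Filter.Eventually.of_forall fun ω => ?_)
    have := (fderiv ℝ b (c + r • (ω : E3))).le_opNorm ω
    rw [norm_eq_of_mem_sphere, mul_one] at this
    have h3 := norm_nonneg (iteratedFDeriv ℝ 2 a (c + r • (ω : E3)))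
    rw [datNorm2]
    linarith
  have hvd : ∀ r : ℝ, HasDerivAt (fun r : ℝ => ∫ ω : S2, b (c + r • (ω : E3)) ∂σ)
      (∫ ω : S2, fderiv ℝ b (c + r • (ω : E3)) ω ∂σ) r := by
    refine hasDerivAt_integral_sphere (hcr hb.continuous) ?_ ?_
    · exact (hfb.comp (by fun_prop : Continuous fun q : ℝ × S2 => c + q.1 • (q.2 : E3))).clm_apply
        (by fun_prop)
    · intro r ω
      have h1 : HasDerivAt (fun r : ℝ => c + r • (ω : E3)) ω r := by
        simpa using ((hasDerivAt_id r).smul_const (ω : E3)).const_add c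
      exact ((hb.differentiable (by simp) _).hasFDerivAt).comp_hasDerivAt r h1
  have A1 := abs_le_mean_add_integral (sphere_lap_deriv ha c)
    (continuous_id.mul (hmean hlap))
    (hm0.add (continuous_const.mul hm1))
    ((continuous_const.mul continuous_id).mul hm2) hT hTR hR
    (fun r hr => hn r hr.1 hr.2) (fun r hr => hn' r hr.1)
  have A2 := abs_le_mean_add_integral hvd
    (continuous_integral_sphere ((hfb.comp (by fun_prop :
      Continuous fun q : ℝ × S2 => c + q.1 • (q.2 : E3))).clm_apply (by fun_prop))) hm1 hm2 hT hTR hR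
    (fun r _ => hv r) (fun r _ => hv' r)
  refine le_trans ?_ (mean_bounds_combine hm0 hm1 hm2
    (fun r => integral_nonneg fun ω => datNorm1_nonneg _ _ _)
    (fun r => integral_nonneg fun ω => datNorm2_nonneg _ _ _) hT hTR A1 A2)
  refine mul_le_mul_of_nonneg_left ?_ (by positivity)
  have hda : Continuous fun ω : S2 => ∑ i, (ω : E3) i * fderiv ℝ a (c + T • (ω : E3)) (ee i) := by
    simp only [← clm_eq_sum]
    exact (hfa.comp (by fun_prop)).clm_apply (by fun_prop)
  simp only [add_assoc]
  have hi : Integrable (fun ω : S2 => a (c + T • (ω : E3)) +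
      T * ∑ i, (ω : E3) i * fderiv ℝ a (c + T • (ω : E3)) (ee i)) σ :=
    ((hcr ha.continuous T).add (continuous_const.mul hda)).integrable_sphere
  rw [integral_add ((h_integ hb.continuous T).const_mul T) hi, integral_const_mul]
  refine (abs_add_le _ _).trans (add_le_add ?_ le_rfl)
  rw [abs_mul, abs_of_nonneg hT]

theorem le_sqrt_of_forall_mul_add {x K L : ℝ} (hK : 0 ≤ K) (hL : 0 ≤ L)
    (h : ∀ l : ℝ, 0 < l → 2 * x ≤ l * K + l⁻¹ * L) : x ≤ √(K * L) := by
  rcases le_or_gt x 0 with hx | hx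
  · exact hx.trans (sqrt_nonneg _)
  refine le_sqrt_of_sq_le ?_
  rcases hL.eq_or_lt with rfl | hL
  · have := h (x / (K + 1)) (by positivity)
    have h2 : x / (K + 1) * K ≤ x := by
      rw [div_mul_eq_mul_div, div_le_iff₀ (by positivity)]
      nlinarith
    linarith
  · have := h (L / x) (by positivity)
    rw [inv_div, div_mul_cancel₀ _ hL.ne', div_mul_eq_mul_div] at this
    have h2 : x ≤ L * K / x := by linarith
    rw [le_div_iff₀ hx] at h2
    nlinarith

theorem shell_cauchy_schwarz {a b : ℝ} (ha : 0 ≤ a) (hab : a ≤ b) (c : E3) {G w : E3 → ℝ}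
    (hG : Continuous G) (hG0 : ∀ x, 0 ≤ G x) (hw : Continuous w) (hw0 : ∀ x, 0 < w x)
    {h : ℝ → ℝ} (hh : Continuous h) (hh0 : ∀ r, 0 ≤ r → 0 ≤ h r) {K L : ℝ} (hK : 0 ≤ K)
    (hL : 0 ≤ L)
    (hGK : ∫⁻ x in {x : E3 | ‖x - c‖ ∈ Set.Ioc a b}, ENNReal.ofReal (w x * G x ^ 2) ≤
      ENNReal.ofReal K)
    (hhL : ∫⁻ r in Set.Ioc a b, ∫⁻ ω : S2, ENNReal.ofReal (h r ^ 2 / w (c + r • (ω : E3))) ∂σ ≤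
      ENNReal.ofReal L) :
    ∫ r in a..b, r * h r * ∫ ω : S2, G (c + r • (ω : E3)) ∂σ ≤ √(K * L) := by
  refine le_sqrt_of_forall_mul_add hK hL fun l hl => ?_
  have hq : Continuous fun q : ℝ × S2 => c + q.1 • (q.2 : E3) := by fun_prop
  have hGq : Continuous fun q : ℝ × S2 => G (c + q.1 • (q.2 : E3)) := hG.comp hq
  have hwq : Continuous fun q : ℝ × S2 => w (c + q.1 • (q.2 : E3)) := hw.comp hq
  have hcont : Continuous (Function.uncurry fun (r : ℝ) (ω : S2) =>
      r * h r * G (c + r • (ω : E3))) :=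
    (continuous_fst.mul (hh.comp continuous_fst)).mul hGq
  have h1 := lintegral_sphere_eq_ofReal hab (F := fun r ω => r * h r * G (c + r • (ω : E3)))
    hcont.continuousOn
    fun r hr ω => mul_nonneg (mul_nonneg (ha.trans hr.1) (hh0 r (ha.trans hr.1))) (hG0 _)
  simp only [integral_const_mul] at h1
  have hpt : ∀ r ∈ Set.Ioc a b, ENNReal.ofReal 2 * ∫⁻ ω : S2, ENNReal.ofReal
      (r * h r * G (c + r • (ω : E3))) ∂σ ≤
      ENNReal.ofReal l * (ENNReal.ofReal (r ^ 2) * ∫⁻ ω : S2, ENNReal.ofReal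
        (w (c + r • (ω : E3)) * G (c + r • (ω : E3)) ^ 2) ∂σ) +
      ENNReal.ofReal l⁻¹ * ∫⁻ ω : S2, ENNReal.ofReal (h r ^ 2 / w (c + r • (ω : E3))) ∂σ := by
    intro r hr
    rw [← lintegral_const_mul' _ _ ENNReal.ofReal_ne_top,
      ← lintegral_const_mul' _ _ ENNReal.ofReal_ne_top,
      ← lintegral_const_mul' _ _ ENNReal.ofReal_ne_top,
      ← lintegral_const_mul' _ _ ENNReal.ofReal_ne_top, ← lintegral_add_left']
    · refine lintegral_mono fun ω => ?_
      have hw1 := hw0 (c + r • (ω : E3))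
      rw [← ENNReal.ofReal_mul (by positivity), ← ENNReal.ofReal_mul (by positivity),
        ← ENNReal.ofReal_mul (by positivity), ← ENNReal.ofReal_mul (by positivity),
        ← ENNReal.ofReal_add (by positivity) (by positivity)]
      refine ENNReal.ofReal_le_ofReal ?_
      have e1 : 0 ≤ (l * r * w (c + r • (ω : E3)) * G (c + r • (ω : E3)) - h r) ^ 2 := sq_nonneg _
      have e2 : l * (r ^ 2 * (w (c + r • (ω : E3)) * G (c + r • (ω : E3)) ^ 2)) +
          l⁻¹ * (h r ^ 2 / w (c + r • (ω : E3))) - 2 * (r * h r * G (c + r • (ω : E3))) =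
          (l * r * w (c + r • (ω : E3)) * G (c + r • (ω : E3)) - h r) ^ 2 /
            (l * w (c + r • (ω : E3))) := by
        field_simp
        ring
      have e3 : 0 ≤ (l * r * w (c + r • (ω : E3)) * G (c + r • (ω : E3)) - h r) ^ 2 /
            (l * w (c + r • (ω : E3))) := by positivity
      linarith
    · have hcr : Continuous fun ω : S2 => c + r • (ω : E3) := by fun_prop
      exact ((((hw.comp hcr).mul ((hG.comp hcr).pow 2)).measurable.ennreal_ofReal.const_mul
        _).const_mul _).aemeasurable
  have h2 := setLIntegral_mono' (μ := volume) measurableSet_Ioc hpt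
  have hm : Measurable fun r : ℝ => ENNReal.ofReal l * (ENNReal.ofReal (r ^ 2) *
      ∫⁻ ω : S2, ENNReal.ofReal (w (c + r • (ω : E3)) * G (c + r • (ω : E3)) ^ 2) ∂σ) := by
    refine Measurable.const_mul (Measurable.mul (by fun_prop) ?_) _
    exact Measurable.lintegral_prod_right' (f := fun q : ℝ × S2 => ENNReal.ofReal
      (w (c + q.1 • (q.2 : E3)) * G (c + q.1 • (q.2 : E3)) ^ 2))
      (hwq.mul (hGq.pow 2)).measurable.ennreal_ofReal
  rw [lintegral_add_left hm, lintegral_const_mul' _ _ ENNReal.ofReal_ne_top,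
    lintegral_const_mul' _ _ ENNReal.ofReal_ne_top, lintegral_const_mul' _ _ ENNReal.ofReal_ne_top,
    h1, lintegral_polar_shell (fun x => ENNReal.ofReal (w x * G x ^ 2))
      (hw.mul (hG.pow 2)).measurable.ennreal_ofReal c _ measurableSet_Ioc
      fun r hr => ha.trans_lt hr.1,
    ← ENNReal.ofReal_mul (by norm_num)] at h2
  have h3 := h2.trans (add_le_add (mul_le_mul_right hGK _) (mul_le_mul_right hhL _))
  rw [← ENNReal.ofReal_mul hl.le, ← ENNReal.ofReal_mul (by positivity),
    ← ENNReal.ofReal_add (by positivity) (by positivity),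
    ENNReal.ofReal_le_ofReal_iff (by positivity)] at h3
  exact h3

theorem lintegral_annulus_rpow {α β : ℝ} (hα : 0 ≤ α) (s : ℝ) :
    ∫⁻ x in {x : E3 | ‖x‖ ∈ Set.Ioc α β}, ENNReal.ofReal (‖x‖ ^ s) =
      ENNReal.ofReal ((σ : Measure S2).real Set.univ) *
        ∫⁻ r in Set.Ioc α β, ENNReal.ofReal (r ^ (s + 2)) := by
  have h := lintegral_polar_shell (fun x => ENNReal.ofReal (‖x‖ ^ s))
    (measurable_norm.pow_const s).ennreal_ofReal 0 (Set.Ioc α β) measurableSet_Ioc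
    fun r hr => hα.trans_lt hr.1
  simp only [sub_zero, zero_add] at h
  rw [← h, ← lintegral_const_mul' _ _ ENNReal.ofReal_ne_top]
  refine setLIntegral_congr_fun measurableSet_Ioc fun r hr => ?_
  have hr0 : 0 < r := hα.trans_lt hr.1
  simp only [norm_smul_sphere _ hr0.le, lintegral_const]
  rw [ofReal_measureReal, mul_comm, mul_comm (ENNReal.ofReal _) (σ Set.univ), mul_assoc,
    ← ENNReal.ofReal_mul (by positivity), rpow_add hr0, rpow_two]

theorem lintegral_Ioc_zero_rpow_le {s L : ℝ} (hs : -1 < s) (hL : 0 ≤ L) :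
    ∫⁻ r in Set.Ioc 0 L, ENNReal.ofReal (r ^ s) ≤ ENNReal.ofReal ((s + 1)⁻¹ * L ^ (s + 1)) := by
  have hi : IntervalIntegrable (fun r : ℝ => r ^ s) volume 0 L :=
    intervalIntegral.intervalIntegrable_rpow' hs
  have h0 : 0 < s + 1 := by linarith
  rw [← ofReal_integral_eq_lintegral_ofReal ((intervalIntegrable_iff_integrableOn_Ioc_of_le hL).1 hi)
    ((ae_restrict_iff' measurableSet_Ioc).2 (Filter.Eventually.of_forall fun r hr =>
      rpow_nonneg hr.1.le _)), ← intervalIntegral.integral_of_le hL,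
    integral_rpow (Or.inl hs), zero_rpow h0.ne', sub_zero, div_eq_inv_mul]

theorem integral_shell_weighted_le {R s α β : ℝ} (hR : 0 ≤ R) (hs : 0 ≤ s) (hα : 0 ≤ α) {c : E3}
    (hαR : α + R < ‖c‖) (hβ : ‖c‖ + R ≤ β) {G : E3 → ℝ}
    (hG : Continuous G) (hG0 : ∀ x, 0 ≤ G x) {K L : ℝ} (hK : 0 ≤ K) (hL : 0 ≤ L)
    (hGK : ∫⁻ x in {x : E3 | ‖x - c‖ ∈ Set.Ioc 0 R}, ENNReal.ofReal ((1 + ‖x‖) ^ s * G x ^ 2) ≤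
      ENNReal.ofReal K)
    (hL' : ∫⁻ x in {x : E3 | ‖x‖ ∈ Set.Ioc α β}, ENNReal.ofReal (‖x‖ ^ (-s)) ≤
      ENNReal.ofReal L) :
    ∫ r in (0 : ℝ)..R, r ^ 2 * ∫ ω : S2, G (c + r • (ω : E3)) ∂σ ≤ √(K * L) := by
  have hw : Continuous fun x : E3 => (1 + ‖x‖) ^ s :=
    (by fun_prop : Continuous fun x : E3 => 1 + ‖x‖).rpow_const fun x => Or.inr hs
  have hw0 : ∀ x : E3, 0 < (1 + ‖x‖) ^ s := fun x => by positivity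
  have := shell_cauchy_schwarz le_rfl hR c hG hG0 hw hw0 (h := fun r => r) continuous_id
    (fun r hr => hr) hK hL hGK ?_
  · simpa only [← sq] using this
  · have h1 := lintegral_polar_shell (fun x => ENNReal.ofReal (((1 + ‖x‖) ^ s)⁻¹))
      (hw.inv₀ fun x => (hw0 x).ne').measurable.ennreal_ofReal c (Set.Ioc 0 R) measurableSet_Ioc
      fun r hr => hr.1
    have h2 : ∀ r : ℝ, ∫⁻ ω : S2, ENNReal.ofReal (r ^ 2 / (1 + ‖c + r • (ω : E3)‖) ^ s) ∂σ =
        ENNReal.ofReal (r ^ 2) *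
          ∫⁻ ω : S2, ENNReal.ofReal (((1 + ‖c + r • (ω : E3)‖) ^ s)⁻¹) ∂σ := by
      intro r
      simp only [div_eq_mul_inv, ENNReal.ofReal_mul (sq_nonneg r)]
      rw [lintegral_const_mul' _ _ ENNReal.ofReal_ne_top]
    simp only [h2]
    rw [h1]
    refine le_trans ?_ hL'
    have hsub : {x : E3 | ‖x - c‖ ∈ Set.Ioc 0 R} ⊆ {x : E3 | ‖x‖ ∈ Set.Ioc α β} := by
      intro x hx
      have hx2 : ‖x - c‖ ≤ R := hx.2
      have e1 : ‖c‖ ≤ ‖x‖ + ‖x - c‖ := by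
        have := norm_sub_le x (x - c)
        rwa [sub_sub_cancel] at this
      have e2 : ‖x‖ ≤ ‖c‖ + ‖x - c‖ := by
        have := norm_add_le c (x - c)
        rwa [add_sub_cancel] at this
      exact ⟨by linarith, by linarith⟩
    refine (lintegral_mono_set hsub).trans
      (setLIntegral_mono' (measurable_norm measurableSet_Ioc) fun x hx => ?_)
    have hx0 : 0 < ‖x‖ := hα.trans_lt hx.1
    refine ENNReal.ofReal_le_ofReal ?_
    rw [rpow_neg hx0.le]
    gcongr
    linarith

/-- The radial profile bound integrates to an `L²` bound on balls. -/
theorem lintegral_ball_sq_le {p γ K : ℝ} (hp : 1 < p) (hp3 : p ≤ 3) (hγ : 1 ≤ γ) (hγ2 : γ < 2)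
    {a D : E3 → ℝ} (ha : ContDiff ℝ 1 a) (hD : Continuous D)
    (haD : ∀ x v, fderiv ℝ a x v ^ 2 ≤ D x * ‖v‖ ^ 2) (hK : 0 ≤ K)
    (hDK : ∫⁻ x, ENNReal.ofReal ((1 + ‖x‖) ^ γ * D x) ≤ ENNReal.ofReal K)
    (hPK : ∫⁻ x, ENNReal.ofReal ((1 + ‖x‖) ^ γ * |a x| ^ (p + 1)) ≤ ENNReal.ofReal K)
    {L : ℝ} (hL : 0 ≤ L) :
    ∫⁻ x in {x : E3 | ‖x‖ ∈ Set.Ioc 0 L}, ENNReal.ofReal (a x ^ 2) ≤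
      ENNReal.ofReal (K * ((2 - γ)⁻¹ * L ^ (2 - γ))) := by
  have h := lintegral_polar_shell (fun x => ENNReal.ofReal (a x ^ 2))
    (ha.continuous.pow 2).measurable.ennreal_ofReal 0 (Set.Ioc 0 L) measurableSet_Ioc
    fun r hr => hr.1
  simp only [sub_zero, zero_add] at h
  rw [← h]
  have h1 : ∀ r ∈ Set.Ioc 0 L, ENNReal.ofReal (r ^ 2) *
      ∫⁻ ω : S2, ENNReal.ofReal (a (r • (ω : E3)) ^ 2) ∂σ ≤
      ENNReal.ofReal K * ENNReal.ofReal (r ^ (1 - γ)) := by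
    intro r hr
    have hr0 : 0 < r := hr.1
    have hc : Continuous fun ω : S2 => a (r • (ω : E3)) ^ 2 :=
      (ha.continuous.comp (by fun_prop)).pow 2
    rw [← ofReal_integral_eq_lintegral_ofReal hc.integrable_sphere
      (Filter.Eventually.of_forall fun ω => sq_nonneg _), ← ENNReal.ofReal_mul (by positivity),
      ← ENNReal.ofReal_mul hK]
    refine ENNReal.ofReal_le_ofReal ?_
    have h2 := sphSq_le hp hp3 hγ ha hD haD hK hDK hPK hr0
    calc r ^ 2 * ∫ ω : S2, a (r • (ω : E3)) ^ 2 ∂σ ≤ r ^ 2 * (r ^ (-(γ + 1)) * K) := by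
          gcongr
          exact h2
      _ = K * r ^ (1 - γ) := by
          rw [← mul_assoc, ← rpow_two, ← rpow_add hr0]
          ring_nf
  refine (setLIntegral_mono' (μ := volume) measurableSet_Ioc h1).trans ?_
  rw [lintegral_const_mul' _ _ ENNReal.ofReal_ne_top, ENNReal.ofReal_mul hK]
  have h3 := lintegral_Ioc_zero_rpow_le (s := 1 - γ) (by linarith) hL
  rw [show 1 - γ + 1 = 2 - γ by ring] at h3
  exact mul_le_mul_right h3 _

theorem sqrt_mul_le_mul_sqrt {K L x N : ℝ} (hK : 0 ≤ K) (hx : 0 ≤ x) (h : L ≤ x ^ 2 * N) :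
    √(K * L) ≤ x * √(K * N) := by
  have h1 : x * √(K * N) = √(x ^ 2 * (K * N)) := by rw [sqrt_mul (sq_nonneg x), sqrt_sq hx]
  rw [h1]
  refine sqrt_le_sqrt ?_
  nlinarith [mul_le_mul_of_nonneg_left h hK]

theorem two_mul_rpow_le {x s : ℝ} {n : ℕ} (hx : 0 ≤ x) (hs : s ≤ n) :
    (2 * x) ^ s ≤ 2 ^ n * x ^ s := by
  rw [mul_rpow (by norm_num) hx, ← rpow_natCast]
  exact mul_le_mul_of_nonneg_right (rpow_le_rpow_of_exponent_le (by norm_num) hs)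
    (rpow_nonneg hx _)

/-- The constant in the bound for the free evolution. -/
def linConst (γ : ℝ) : ℝ :=
  (sphereMeasure : Measure S2).real Set.univ * (64 + 400 / (2 - γ) + 16 / (γ - 1))

theorem linear_decay {p γ K : ℝ} (hp : 1 < p) (hp3 : p ≤ 3) (hγ : 1 < γ) (hγ2 : γ < 2)
    {a b : E3 → ℝ} (ha : ContDiff ℝ (⊤ : ℕ∞) a) (hb : ContDiff ℝ (⊤ : ℕ∞) b) (hK : 0 ≤ K)
    (hK1 : ∫⁻ x, ENNReal.ofReal ((1 + ‖x‖) ^ γ * datNorm1 a b x ^ 2) ≤ ENNReal.ofReal K)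
    (hK2 : ∫⁻ x, ENNReal.ofReal ((1 + ‖x‖) ^ (γ + 2) * datNorm2 a b x ^ 2) ≤ ENNReal.ofReal K)
    (hPK : ∫⁻ x, ENNReal.ofReal ((1 + ‖x‖) ^ γ * |a x| ^ (p + 1)) ≤ ENNReal.ofReal K)
    {T : ℝ} {c : E3} (hT : 0 ≤ T) (hc : T + 2 ≤ ‖c‖) :
    |∫ ω : S2, (T * b (c + T • (ω : E3)) + a (c + T • (ω : E3)) +
      T * ∑ i, (ω : E3) i * fderiv ℝ a (c + T • (ω : E3)) (ee i)) ∂σ| ≤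
    17 * √(K * (linConst γ * (‖c‖ ^ (-2 : ℝ) * (‖c‖ - T) ^ (1 - γ)))) := by
  set S := (sphereMeasure : Measure S2).real Set.univ with hS
  have hS0 : 0 ≤ S := measureReal_nonneg
  have hc0 : 0 < ‖c‖ := by linarith
  have hu : 0 < ‖c‖ - T := by linarith
  have hg1 : 0 < γ - 1 := by linarith
  have hg2 : 0 < 2 - γ := by linarith
  have hg3 : 1 ≤ 3 - γ := by linarith
  set R := max T (‖c‖ / 2) with hRdef
  have hTR : T ≤ R := le_max_left _ _
  have hcR : ‖c‖ / 2 ≤ R := le_max_right _ _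
  have hRc : R ≤ ‖c‖ := max_le (by linarith) (by linarith)
  have hR : 0 < R := by linarith
  have hRu : (‖c‖ - T) / 4 + R < ‖c‖ := by
    rcases max_cases T (‖c‖ / 2) with h | h <;> rw [hRdef, h.1] <;> linarith
  set M := linConst γ with hM
  have hM1 : S * 64 ≤ M := by
    have : 0 ≤ 400 / (2 - γ) + 16 / (γ - 1) := by positivity
    rw [hM, linConst]
    gcongr
    linarith
  have hM2 : S * (400 / (2 - γ)) ≤ M := by
    have : 0 ≤ 16 / (γ - 1) := by positivity
    rw [hM, linConst]
    gcongr
    linarith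
  have hM3 : S * (16 / (γ - 1)) ≤ M := by
    have : 0 ≤ 400 / (2 - γ) := by positivity
    rw [hM, linConst]
    gcongr
    linarith
  have hM0 : 0 ≤ M := le_trans (by positivity) hM1
  set Q := ‖c‖ ^ (-2 : ℝ) * (‖c‖ - T) ^ (1 - γ) with hQ
  have hQ0 : 0 ≤ Q := by positivity
  have hQc : ‖c‖ ^ (-1 - γ) ≤ Q := by
    have : ‖c‖ ^ (-1 - γ) = ‖c‖ ^ (-2 : ℝ) * ‖c‖ ^ (1 - γ) := by
      rw [← rpow_add hc0]; ring_nf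
    rw [this]
    exact mul_le_mul_of_nonneg_left (rpow_le_rpow_of_nonpos hu (by linarith) (by linarith))
      (by positivity)
  have hD : Continuous fun x => datNorm1 a b x ^ 2 := (continuous_datNorm1 ha hb).pow 2
  have haD : ∀ x v, fderiv ℝ a x v ^ 2 ≤ datNorm1 a b x ^ 2 * ‖v‖ ^ 2 := by
    intro x v
    rw [← mul_pow, ← sq_abs]
    have h1 := (fderiv ℝ a x).le_opNorm v
    rw [Real.norm_eq_abs] at h1
    refine pow_le_pow_left₀ (abs_nonneg _) (h1.trans ?_) 2
    gcongr
    exact le_add_of_nonneg_right (abs_nonneg _)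
  have J0 : ∫ r in (0 : ℝ)..R, r ^ 2 * ∫ ω : S2, |a (c + r • (ω : E3))| ∂σ ≤
      R ^ 3 * √(K * (M * Q)) := by
    have hL : ∫⁻ x in {x : E3 | ‖x‖ ∈ Set.Ioc 0 (2 * ‖c‖)}, ENNReal.ofReal (‖x‖ ^ (-(0 : ℝ))) ≤
        ENNReal.ofReal (S * (3⁻¹ * (2 * ‖c‖) ^ (3 : ℝ))) := by
      rw [lintegral_annulus_rpow le_rfl, ENNReal.ofReal_mul hS0]
      refine mul_le_mul_right ((lintegral_Ioc_zero_rpow_le (by norm_num)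
        (by positivity)).trans (le_of_eq ?_)) _
      norm_num
    have hGK : ∫⁻ x in {x : E3 | ‖x - c‖ ∈ Set.Ioc 0 R}, ENNReal.ofReal
        ((1 + ‖x‖) ^ (0 : ℝ) * |a x| ^ 2) ≤
        ENNReal.ofReal (K * ((2 - γ)⁻¹ * (2 * ‖c‖) ^ (2 - γ))) := by
      simp only [rpow_zero, one_mul, sq_abs]
      refine (lintegral_mono_set ?_).trans (lintegral_ball_sq_le hp hp3 hγ.le hγ2
        (ha.of_le (by exact_mod_cast le_top)) hD haD hK hK1 hPK (by positivity))
      intro x hx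
      have hx2 : ‖x - c‖ ≤ R := hx.2
      have e1 : ‖c‖ ≤ ‖x‖ + ‖x - c‖ := by
        have := norm_sub_le x (x - c)
        rwa [sub_sub_cancel] at this
      have e2 : ‖x‖ ≤ ‖c‖ + ‖x - c‖ := by
        have := norm_add_le c (x - c)
        rwa [add_sub_cancel] at this
      exact ⟨by linarith, by linarith⟩
    refine (integral_shell_weighted_le hR.le le_rfl le_rfl (by linarith) (by linarith)
      ha.continuous.abs (fun x => abs_nonneg _) (by positivity) (by positivity) hGK hL).trans ?_
    rw [mul_assoc K]
    refine sqrt_mul_le_mul_sqrt hK (by positivity) ?_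
    have e1 : (2 * ‖c‖) ^ (2 - γ) ≤ 2 * ‖c‖ ^ (2 - γ) := by
      simpa using two_mul_rpow_le (n := 1) hc0.le (s := 2 - γ) (by norm_num; linarith)
    have e2 : (2 * ‖c‖) ^ (3 : ℝ) = 8 * ‖c‖ ^ 3 := by
      rw [show (3 : ℝ) = (3 : ℕ) by norm_num, rpow_natCast, mul_pow]; norm_num
    have e3 : ‖c‖ ^ (2 - γ) * ‖c‖ ^ 3 = ‖c‖ ^ 6 * ‖c‖ ^ (-1 - γ) := by
      rw [← rpow_natCast, ← rpow_natCast, ← rpow_add hc0, ← rpow_add hc0]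
      push_cast; ring_nf
    have e4 : ‖c‖ ^ 6 ≤ 64 * R ^ 6 := by
      have := pow_le_pow_left₀ (by positivity) hcR 6
      rw [div_pow] at this
      linarith
    rw [e2]
    calc (2 - γ)⁻¹ * (2 * ‖c‖) ^ (2 - γ) * (S * (3⁻¹ * (8 * ‖c‖ ^ 3)))
        ≤ (2 - γ)⁻¹ * (2 * ‖c‖ ^ (2 - γ)) * (S * (3⁻¹ * (8 * ‖c‖ ^ 3))) := by gcongr
      _ = (2 - γ)⁻¹ * S * (16 / 3) * (‖c‖ ^ (2 - γ) * ‖c‖ ^ 3) := by ring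
      _ ≤ (2 - γ)⁻¹ * S * (16 / 3) * (64 * R ^ 6 * Q) := by rw [e3]; gcongr
      _ ≤ R ^ 6 * ((S * (400 / (2 - γ))) * Q) := by
          have : 0 ≤ (2 - γ)⁻¹ * S * (R ^ 6 * Q) := by positivity
          have e : R ^ 6 * ((S * (400 / (2 - γ))) * Q) = 400 * ((2 - γ)⁻¹ * S * (R ^ 6 * Q)) := by
            ring
          rw [e]
          linarith
      _ ≤ R ^ 6 * (M * Q) := by gcongr
      _ = _ := by ring
  have J1 : ∫ r in (0 : ℝ)..R, r ^ 2 * ∫ ω : S2, datNorm1 a b (c + r • (ω : E3)) ∂σ ≤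
      R ^ 2 * √(K * (M * Q)) := by
    have hL : ∫⁻ x in {x : E3 | ‖x‖ ∈ Set.Ioc 0 (2 * ‖c‖)}, ENNReal.ofReal (‖x‖ ^ (-γ)) ≤
        ENNReal.ofReal (S * ((3 - γ)⁻¹ * (2 * ‖c‖) ^ (3 - γ))) := by
      rw [lintegral_annulus_rpow le_rfl, ENNReal.ofReal_mul hS0]
      refine mul_le_mul_right ((lintegral_Ioc_zero_rpow_le (by linarith)
        (by positivity)).trans (le_of_eq ?_)) _
      ring_nf
    have h3 : (0 : ℝ) < 3 - γ := by linarith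
    refine (integral_shell_weighted_le hR.le (by linarith) le_rfl (by linarith) (by linarith)
      (continuous_datNorm1 ha hb) (datNorm1_nonneg a b) hK (by positivity)
      ((setLIntegral_le_lintegral _ _).trans hK1) hL).trans ?_
    refine sqrt_mul_le_mul_sqrt hK (by positivity) ?_
    have e1 : (2 * ‖c‖) ^ (3 - γ) ≤ 4 * ‖c‖ ^ (3 - γ) := by
      have := two_mul_rpow_le (n := 2) hc0.le (s := 3 - γ) (by norm_num; linarith)
      norm_num at this
      exact this
    have e3 : ‖c‖ ^ (3 - γ) = ‖c‖ ^ 4 * ‖c‖ ^ (-1 - γ) := by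
      rw [← rpow_natCast, ← rpow_add hc0]
      push_cast; ring_nf
    have e4 : ‖c‖ ^ 4 ≤ 16 * R ^ 4 := by
      have := pow_le_pow_left₀ (by positivity) hcR 4
      rw [div_pow] at this
      linarith
    have e5 : (3 - γ)⁻¹ ≤ 1 := inv_le_one_of_one_le₀ hg3
    calc S * ((3 - γ)⁻¹ * (2 * ‖c‖) ^ (3 - γ)) ≤ S * (1 * (4 * ‖c‖ ^ (3 - γ))) := by gcongr
      _ ≤ S * (1 * (4 * (16 * R ^ 4 * Q))) := by rw [e3]; gcongr
      _ = R ^ 4 * (S * 64 * Q) := by ring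
      _ ≤ R ^ 4 * (M * Q) := by gcongr
      _ = _ := by ring
  have J2 : ∫ r in (0 : ℝ)..R, r ^ 2 * ∫ ω : S2, datNorm2 a b (c + r • (ω : E3)) ∂σ ≤
      R * √(K * (M * Q)) := by
    have hL : ∫⁻ x in {x : E3 | ‖x‖ ∈ Set.Ioc ((‖c‖ - T) / 4) (2 * ‖c‖)},
        ENNReal.ofReal (‖x‖ ^ (-(γ + 2))) ≤
        ENNReal.ofReal (S * ((γ - 1)⁻¹ * ((‖c‖ - T) / 4) ^ (1 - γ))) := by
      rw [lintegral_annulus_rpow (by positivity), ENNReal.ofReal_mul hS0]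
      refine mul_le_mul_right ((lintegral_Ioc_rpow_le (by linarith)
        (by positivity) (by linarith)).trans (le_of_eq ?_)) _
      ring_nf
    refine (integral_shell_weighted_le hR.le (by linarith) (by positivity) hRu (by linarith)
      (continuous_datNorm2 ha hb) (datNorm2_nonneg a b) hK (by positivity)
      ((setLIntegral_le_lintegral _ _).trans hK2) hL).trans ?_
    refine sqrt_mul_le_mul_sqrt hK (by positivity) ?_
    have e1 : ((‖c‖ - T) / 4) ^ (1 - γ) ≤ 4 * (‖c‖ - T) ^ (1 - γ) := by
      rw [div_rpow hu.le (by norm_num), div_eq_mul_inv, ← rpow_neg (by norm_num), mul_comm]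
      have : (4 : ℝ) ^ (-(1 - γ)) ≤ 4 ^ (1 : ℝ) :=
        rpow_le_rpow_of_exponent_le (by norm_num) (by linarith)
      rw [rpow_one] at this
      gcongr
    have e3 : (‖c‖ - T) ^ (1 - γ) = ‖c‖ ^ 2 * Q := by
      rw [hQ, ← mul_assoc, ← rpow_natCast, ← rpow_add hc0]
      norm_num
    have e4 : ‖c‖ ^ 2 ≤ 4 * R ^ 2 := by
      have := pow_le_pow_left₀ (by positivity) hcR 2
      rw [div_pow] at this
      linarith
    calc S * ((γ - 1)⁻¹ * ((‖c‖ - T) / 4) ^ (1 - γ))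
        ≤ S * ((γ - 1)⁻¹ * (4 * (‖c‖ - T) ^ (1 - γ))) := by gcongr
      _ ≤ S * ((γ - 1)⁻¹ * (4 * (4 * R ^ 2 * Q))) := by rw [e3]; gcongr
      _ = R ^ 2 * (S * (16 / (γ - 1)) * Q) := by ring
      _ ≤ R ^ 2 * (M * Q) := by gcongr
  have J3 : ∫ r in T..R, r * ∫ ω : S2, datNorm2 a b (c + r • (ω : E3)) ∂σ ≤
      √(K * (M * Q)) := by
    rcases le_total (‖c‖ / 2) T with h | h
    · rw [hRdef, max_eq_left h, intervalIntegral.integral_same]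
      positivity
    have hRe : R = ‖c‖ / 2 := max_eq_right h
    have hw : Continuous fun x : E3 => (1 + ‖x‖) ^ (γ + 2) :=
      (by fun_prop : Continuous fun x : E3 => 1 + ‖x‖).rpow_const fun x => Or.inr (by linarith)
    have hhL : ∫⁻ r in Set.Ioc T R, ∫⁻ ω : S2, ENNReal.ofReal
        ((1 : ℝ) ^ 2 / (1 + ‖c + r • (ω : E3)‖) ^ (γ + 2)) ∂σ ≤
        ENNReal.ofReal (S * R ^ (-1 - γ)) := by
      have h1 : ∀ r ∈ Set.Ioc T R, ∫⁻ ω : S2, ENNReal.ofReal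
          ((1 : ℝ) ^ 2 / (1 + ‖c + r • (ω : E3)‖) ^ (γ + 2)) ∂σ ≤
          ENNReal.ofReal (S * R ^ (-2 - γ)) := by
        intro r hr
        have h2 : ∀ ω : S2, ENNReal.ofReal ((1 : ℝ) ^ 2 / (1 + ‖c + r • (ω : E3)‖) ^ (γ + 2)) ≤
            ENNReal.ofReal (R ^ (-2 - γ)) := by
          intro ω
          have h3 := norm_add_smul_ge c ω (hT.trans hr.1.le)
          have h4 : R ≤ 1 + ‖c + r • (ω : E3)‖ := by linarith [hr.2]
          refine ENNReal.ofReal_le_ofReal ?_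
          rw [show -2 - γ = -(γ + 2) by ring, rpow_neg hR.le, one_pow, one_div]
          gcongr
        refine (lintegral_mono h2).trans (le_of_eq ?_)
        rw [lintegral_const, ENNReal.ofReal_mul hS0, hS, ofReal_measureReal, mul_comm]
      refine (setLIntegral_mono' (μ := volume) measurableSet_Ioc h1).trans ?_
      rw [setLIntegral_const, Real.volume_Ioc, ← ENNReal.ofReal_mul (by positivity)]
      refine ENNReal.ofReal_le_ofReal ?_
      have e : R ^ (-1 - γ) = R ^ (-2 - γ) * R := by
        rw [← rpow_add_one hR.ne']; ring_nf
      rw [e, mul_assoc]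
      gcongr
      linarith
    have h2 := shell_cauchy_schwarz hT hTR c (continuous_datNorm2 ha hb) (datNorm2_nonneg a b) hw
      (fun x => by positivity) (h := fun _ => 1) continuous_const (fun _ _ => zero_le_one) hK
      (by positivity) ((setLIntegral_le_lintegral _ _).trans hK2) hhL
    simp only [mul_one] at h2
    refine h2.trans ?_
    have h3 : S * R ^ (-1 - γ) ≤ (1 : ℝ) ^ 2 * (M * Q) := by
      have e1 : R ^ (-1 - γ) ≤ 8 * ‖c‖ ^ (-1 - γ) := by
        rw [hRe, div_rpow hc0.le (by norm_num), div_eq_mul_inv, ← rpow_neg (by norm_num), mul_comm]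
        have : (2 : ℝ) ^ (-(-1 - γ)) ≤ 2 ^ (3 : ℝ) :=
          rpow_le_rpow_of_exponent_le (by norm_num) (by linarith)
        norm_num at this
        gcongr
        norm_num
        exact this
      calc S * R ^ (-1 - γ) ≤ S * (8 * Q) := by
            gcongr
            exact e1.trans (by gcongr)
        _ ≤ S * 64 * Q := by nlinarith [mul_nonneg hS0 hQ0]
        _ ≤ M * Q := by gcongr
        _ = _ := by ring
    simpa using sqrt_mul_le_mul_sqrt hK zero_le_one h3
  have h := abs_kirchhoff_data_le ha hb c hT hTR hR
  refine le_of_mul_le_mul_left (h.trans ?_) (pow_pos hR 3)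
  have k1 := mul_le_mul_of_nonneg_left J1 (by positivity : 0 ≤ 6 * R)
  have k2 := mul_le_mul_of_nonneg_left J2 (by positivity : 0 ≤ 4 * R ^ 2)
  have k3 := mul_le_mul_of_nonneg_left J3 (by positivity : 0 ≤ 4 * R ^ 3)
  linarith

section

variable {p γ : ℝ} {φ : ℝ → E3 → ℝ}

theorem contDiff_dt1_zero (hφ : ContDiff ℝ (⊤ : ℕ∞) fun q : ℝ × E3 => φ q.1 q.2) :
    ContDiff ℝ (⊤ : ℕ∞) (dt1 φ 0) := by
  have : dt1 φ 0 = fun x => pd et (fun q : ℝ × E3 => φ q.1 q.2) (0, x) :=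
    funext fun x => dt1_eq_pd hφ 0 x
  rw [this]
  exact (hφ.pd et).comp (contDiff_prodMk_right 0)

theorem wEnergy_zero_eq : wEnergy p 0 γ φ =
    (∫⁻ x : E3, ENNReal.ofReal ((1 + ‖x‖) ^ γ * (‖fderiv ℝ (φ 0) x‖ ^ 2 + |dt1 φ 0 x| ^ 2))) +
    ∫⁻ x : E3, ENNReal.ofReal ((1 + ‖x‖) ^ γ * |φ 0 x| ^ (p + 1)) := by
  simp [wEnergy, norm_iteratedFDeriv_one]

theorem wEnergy_one_eq : wEnergy p 1 γ φ = wEnergy p 0 γ φ +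
    ∫⁻ x : E3, ENNReal.ofReal ((1 + ‖x‖) ^ (γ + 2) *
      (‖iteratedFDeriv ℝ 2 (φ 0) x‖ ^ 2 + ‖fderiv ℝ (dt1 φ 0) x‖ ^ 2)) := by
  simp [wEnergy, norm_iteratedFDeriv_one, Finset.sum_range_succ]
  ring

theorem wEnergy_zero_le_one : wEnergy p 0 γ φ ≤ wEnergy p 1 γ φ := by
  rw [wEnergy_one_eq]
  exact le_self_add

theorem lintegral_ofReal_le_mul {k : ℝ} (hk : 0 ≤ k) {F G : E3 → ℝ} (h : ∀ x, F x ≤ k * G x) :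
    ∫⁻ x, ENNReal.ofReal (F x) ≤ ENNReal.ofReal k * ∫⁻ x, ENNReal.ofReal (G x) := by
  rw [← lintegral_const_mul' _ _ ENNReal.ofReal_ne_top]
  refine lintegral_mono fun x => ?_
  rw [← ENNReal.ofReal_mul hk]
  exact ENNReal.ofReal_le_ofReal (h x)

theorem lintegral_datNorm1_le {E : ℝ} (hE : wEnergy p 0 γ φ ≤ ENNReal.ofReal E) :
    ∫⁻ x, ENNReal.ofReal ((1 + ‖x‖) ^ γ * datNorm1 (φ 0) (dt1 φ 0) x ^ 2) ≤
      ENNReal.ofReal (3 * E) := by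
  rw [wEnergy_zero_eq] at hE
  rw [ENNReal.ofReal_mul (by norm_num)]
  refine (lintegral_ofReal_le_mul (by norm_num) fun x => ?_).trans
    (mul_le_mul_right (le_self_add.trans hE) _)
  rw [← mul_assoc, mul_comm 3, mul_assoc]
  refine mul_le_mul_of_nonneg_left ?_ (by positivity)
  rw [datNorm1]
  nlinarith [sq_nonneg (‖fderiv ℝ (φ 0) x‖ - |dt1 φ 0 x|), sq_nonneg ‖fderiv ℝ (φ 0) x‖,
    sq_nonneg |dt1 φ 0 x|]

theorem lintegral_datNorm2_le {E : ℝ} (hE : wEnergy p 1 γ φ ≤ ENNReal.ofReal E) :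
    ∫⁻ x, ENNReal.ofReal ((1 + ‖x‖) ^ (γ + 2) * datNorm2 (φ 0) (dt1 φ 0) x ^ 2) ≤
      ENNReal.ofReal (3 * E) := by
  rw [wEnergy_one_eq] at hE
  rw [ENNReal.ofReal_mul (by norm_num)]
  refine (lintegral_ofReal_le_mul (by norm_num) fun x => ?_).trans
    (mul_le_mul_right (le_add_self.trans hE) _)
  rw [← mul_assoc, mul_comm 3, mul_assoc]
  refine mul_le_mul_of_nonneg_left ?_ (by positivity)
  rw [datNorm2]
  nlinarith [sq_nonneg (‖iteratedFDeriv ℝ 2 (φ 0) x‖ - ‖fderiv ℝ (dt1 φ 0) x‖),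
    sq_nonneg ‖iteratedFDeriv ℝ 2 (φ 0) x‖, sq_nonneg ‖fderiv ℝ (dt1 φ 0) x‖]

theorem lintegral_pot_le {E : ℝ} (hE : wEnergy p 0 γ φ ≤ ENNReal.ofReal E) :
    ∫⁻ x, ENNReal.ofReal ((1 + ‖x‖) ^ γ * |φ 0 x| ^ (p + 1)) ≤ ENNReal.ofReal E := by
  rw [wEnergy_zero_eq] at hE
  exact le_add_self.trans hE

theorem lintegral_datD_le (hφ : ContDiff ℝ (⊤ : ℕ∞) fun q : ℝ × E3 => φ q.1 q.2) {E : ℝ}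
    (hE : wEnergy p 0 γ φ ≤ ENNReal.ofReal E) :
    ∫⁻ x, ENNReal.ofReal ((1 + ‖x‖) ^ γ * (datD (fun q => φ q.1 q.2) x + |φ 0 x| ^ (p + 1))) ≤
      ENNReal.ofReal (3 * E) := by
  have ha : Continuous (φ 0) := (contDiff_slice hφ 0).continuous
  have hfa : Continuous (fderiv ℝ (φ 0)) :=
    (contDiff_slice hφ 0).continuous_fderiv (by simp)
  have hb := (contDiff_dt1_zero hφ).continuous
  rw [wEnergy_zero_eq, ← lintegral_add_left] at hE
  · rw [ENNReal.ofReal_mul (by norm_num)]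
    refine le_trans ?_ (mul_le_mul_right hE _)
    have h0 : ∀ x : E3, ENNReal.ofReal ((1 + ‖x‖) ^ γ *
        (‖fderiv ℝ (φ 0) x‖ ^ 2 + |dt1 φ 0 x| ^ 2)) +
        ENNReal.ofReal ((1 + ‖x‖) ^ γ * |φ 0 x| ^ (p + 1)) =
        ENNReal.ofReal ((1 + ‖x‖) ^ γ *
        (‖fderiv ℝ (φ 0) x‖ ^ 2 + |dt1 φ 0 x| ^ 2) + (1 + ‖x‖) ^ γ * |φ 0 x| ^ (p + 1)) :=
      fun x => (ENNReal.ofReal_add (by positivity) (by positivity)).symm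
    simp only [h0]
    refine lintegral_ofReal_le_mul (by norm_num) fun x => ?_
    rw [← mul_add, ← mul_assoc, mul_comm 3, mul_assoc]
    refine mul_le_mul_of_nonneg_left ?_ (by positivity)
    have h1 : ∀ i, pd (es i) (fun q : ℝ × E3 => φ q.1 q.2) (0, x) ^ 2 ≤
        ‖fderiv ℝ (φ 0) x‖ ^ 2 := by
      intro i
      rw [← fderiv_slice_ee hφ 0 x i, ← sq_abs]
      refine pow_le_pow_left₀ (abs_nonneg _) ?_ 2
      have := (fderiv ℝ (φ 0) x).le_opNorm (ee i)
      simpa [PiLp.norm_single] using this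
    have h2 := Finset.sum_le_card_nsmul Finset.univ _ _ fun i _ => h1 i
    simp only [Finset.card_univ, Fintype.card_fin, nsmul_eq_mul, Nat.cast_ofNat] at h2
    have h3 : 0 ≤ |φ 0 x| ^ (p + 1) := by positivity
    rw [datD, ← dt1_eq_pd hφ, sq_abs]
    nlinarith [sq_nonneg (dt1 φ 0 x)]
  · have h1 : Measurable fun x : E3 => (1 + ‖x‖) ^ γ := (by fun_prop : Measurable fun x : E3 =>
      1 + ‖x‖).pow_const γ
    exact (h1.mul ((hfa.norm.pow 2).add (hb.abs.pow 2)).measurable).ennreal_ofReal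

theorem kirchhoff_eq_data (hφ : ContDiff ℝ (⊤ : ℕ∞) fun q : ℝ × E3 => φ q.1 q.2) (T : ℝ) (c : E3) :
    kirchhoff (fun q => φ q.1 q.2) T c T =
      ∫ ω : S2, (T * dt1 φ 0 (c + T • (ω : E3)) + φ 0 (c + T • (ω : E3)) +
        T * ∑ i, (ω : E3) i * fderiv ℝ (φ 0) (c + T • (ω : E3)) (ee i)) ∂σ := by
  simp only [kirchhoff, sub_self, dt1_eq_pd hφ]
  simp only [← fderiv_slice_ee hφ]

end

theorem duhamel_le {p T R N A L M : ℝ} {f : ℝ × E3 → ℝ} {c : E3} (hp : 2 < p)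
    (hf : ContDiff ℝ (⊤ : ℕ∞) f) (h : SolvesNLW p f) (hT : 0 ≤ T) (hR : 0 < R) (hN : 0 ≤ N)
    (hL : 0 ≤ L) (hM : 0 ≤ M)
    (hA : |kirchhoff f T c T| ≤ A)
    (hNf : ∀ r : ℝ, 0 < r → r ≤ min R T → ∀ ω : S2, |f (T - r, c + r • (ω : E3))| ≤ N)
    (hlong : ∫⁻ r in Set.Ioc R T, ∫⁻ ω : S2, ENNReal.ofReal
        (r * |f (T - r, c + r • (ω : E3))| ^ p) ∂σ ≤ ENNReal.ofReal L)
    (hshort : ∫⁻ r in Set.Ioc 0 (min R T), ∫⁻ ω : S2, ENNReal.ofReal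
        (r * |f (T - r, c + r • (ω : E3))| ^ (p - 1)) ∂σ ≤ ENNReal.ofReal M) :
    (σ : Measure S2).real Set.univ * |f (T, c)| ≤ A + L + N * M := by
  have hq : Continuous fun q : ℝ × S2 => f (T - q.1, c + q.1 • (q.2 : E3)) :=
    hf.continuous.comp (by fun_prop)
  have hqp : Continuous fun q : ℝ × S2 => |f (T - q.1, c + q.1 • (q.2 : E3))| ^ p :=
    hq.abs.rpow_const fun _ => Or.inr (by linarith)
  have hb : 0 ≤ min R T := le_min hR.le hT
  have hF : ContinuousOn (Function.uncurry fun (r : ℝ) (ω : S2) =>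
      r * |f (T - r, c + r • (ω : E3))| ^ p) (Set.Icc 0 T ×ˢ Set.univ) :=
    (continuous_fst.mul hqp).continuousOn
  have h1 := lintegral_sphere_eq_ofReal hT (F := fun r ω => r * |f (T - r, c + r • (ω : E3))| ^ p)
    hF fun r hr ω => mul_nonneg hr.1 (by positivity)
  have hs : ∀ r ∈ Set.Ioc 0 (min R T), ∫⁻ ω : S2, ENNReal.ofReal
      (r * |f (T - r, c + r • (ω : E3))| ^ p) ∂σ ≤ ENNReal.ofReal N * ∫⁻ ω : S2, ENNReal.ofReal
        (r * |f (T - r, c + r • (ω : E3))| ^ (p - 1)) ∂σ := by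
    intro r hr
    rw [← lintegral_const_mul' _ _ ENNReal.ofReal_ne_top]
    refine lintegral_mono fun ω => ?_
    rw [← ENNReal.ofReal_mul hN]
    refine ENNReal.ofReal_le_ofReal ?_
    have e1 : |f (T - r, c + r • (ω : E3))| ^ p =
        |f (T - r, c + r • (ω : E3))| ^ (p - 1) * |f (T - r, c + r • (ω : E3))| := by
      rw [← rpow_add_one' (abs_nonneg _) (by linarith)]
      ring_nf
    have e2 : 0 ≤ r * |f (T - r, c + r • (ω : E3))| ^ (p - 1) :=
      mul_nonneg hr.1.le (by positivity)
    have e3 := mul_le_mul_of_nonneg_left (hNf r hr.1 hr.2 ω) e2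
    rw [e1]
    linarith
  have hs2 := (setLIntegral_mono' (μ := volume) measurableSet_Ioc hs)
  rw [lintegral_const_mul' _ _ ENNReal.ofReal_ne_top] at hs2
  have hs3 := hs2.trans (mul_le_mul_right hshort _)
  rw [← ENNReal.ofReal_mul hN] at hs3
  have hsub : Set.Ioc 0 T ⊆ Set.Ioc 0 (min R T) ∪ Set.Ioc R T := by
    intro r hr
    rcases le_or_gt r R with h | h
    · exact Or.inl ⟨hr.1, le_min h hr.2⟩
    · exact Or.inr ⟨h, hr.2⟩
  have h2 := (lintegral_mono_set hsub).trans ((lintegral_union_le _ _ _).trans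
    (add_le_add hs3 hlong))
  rw [h1, ← ENNReal.ofReal_add (by positivity) hL,
    ENNReal.ofReal_le_ofReal_iff (by positivity)] at h2
  have hk := kirchhoff_formula hf T c
  have h3 : |∫ ρ in (0 : ℝ)..T, ρ * ∫ ω : S2, (∑ i, pd (es i) (pd (es i) f)
      (T - ρ, c + ρ • (ω : E3)) - pd et (pd et f) (T - ρ, c + ρ • (ω : E3))) ∂σ| ≤
      ∫ r in (0 : ℝ)..T, ∫ ω : S2, r * |f (T - r, c + r • (ω : E3))| ^ p ∂σ := by
    rw [← Real.norm_eq_abs]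
    refine intervalIntegral.norm_integral_le_of_norm_le hT
      (Filter.Eventually.of_forall fun r hr => ?_)
      ((continuous_integral_sphere (continuous_fst.mul hqp)).intervalIntegrable _ _)
    rw [integral_const_mul, norm_mul, Real.norm_eq_abs r, abs_of_pos hr.1]
    refine mul_le_mul_of_nonneg_left ?_ hr.1.le
    have hi : Integrable (fun ω : S2 => |f (T - r, c + r • (ω : E3))| ^ p) σ :=
      (hqp.comp (Continuous.prodMk_right r)).integrable_sphere
    refine norm_integral_le_of_norm_le hi (Filter.Eventually.of_forall fun ω => ?_)
    have e1 := h (T - r, c + r • (ω : E3)) (by simpa using hr.2)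
    have e2 : |f (T - r, c + r • (ω : E3))| ^ p =
        |f (T - r, c + r • (ω : E3))| ^ (p - 1) * |f (T - r, c + r • (ω : E3))| := by
      rw [← rpow_add_one' (abs_nonneg _) (by linarith)]
      ring_nf
    have e3 : ∑ i, pd (es i) (pd (es i) f)
      (T - r, c + r • (ω : E3)) - pd et (pd et f) (T - r, c + r • (ω : E3)) =
      |f (T - r, c + r • (ω : E3))| ^ (p - 1) * f (T - r, c + r • (ω : E3)) := by linarith
    rw [e3, e2, norm_mul, Real.norm_eq_abs, Real.norm_eq_abs, abs_of_nonneg (by positivity)]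
  rw [← abs_of_nonneg (measureReal_nonneg : 0 ≤ (σ : Measure S2).real Set.univ), ← abs_mul, hk]
  refine (abs_sub _ _).trans ?_
  linarith

/-- The rate of decay in `r = |x|`. -/
def radialRate (p γ : ℝ) : ℝ := (3 + (p - 2) ^ 2) / ((p + 1) * (5 - p)) * γ

/-- The rate of decay in `u = |x| - t`. -/
def coneRate (p γ : ℝ) : ℝ := (p - 1) * γ / (p + 1)

/-- The expected pointwise decay as a function of `r = |x|` and `u = |x| - t`. -/
def decayWeight (p γ r u : ℝ) : ℝ := r ^ (-radialRate p γ) * u ^ (-coneRate p γ)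

/-- The exponent of the radius separating the two parts of the backward light cone. -/
def splitRate (p γ : ℝ) : ℝ := γ * (p - 1) / (5 - p)

lemma sq_sub_le_four {p : ℝ} (hp : 2 < p) (hp' : p ≤ (1 + √17) / 2) : p ^ 2 - p ≤ 4 := by
  have h := Real.sq_sqrt (show (0 : ℝ) ≤ 17 by norm_num)
  nlinarith [Real.sqrt_nonneg 17]

section Rates

variable {p γ : ℝ}

lemma lt_three_of_sq_sub_le (hp2 : p ^ 2 - p ≤ 4) : p < 3 := by
  nlinarith

lemma splitRate_le_one (hp : 2 < p) (hp2 : p ^ 2 - p ≤ 4) (hγ : γ < p - 1) :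
    splitRate p γ ≤ 1 := by
  have h3 := lt_three_of_sq_sub_le hp2
  rw [splitRate, div_le_one (by linarith)]
  nlinarith

lemma radialRate_nonneg (hp : 2 < p) (h3 : p < 3) (hγ : 0 ≤ γ) : 0 ≤ radialRate p γ := by
  have : 0 < 5 - p := by linarith
  have : 0 < p + 1 := by linarith
  rw [radialRate]
  positivity

lemma radialRate_add_coneRate (hp : 2 < p) (h3 : p < 3) :
    radialRate p γ + coneRate p γ = 2 * γ / (5 - p) := by
  have : 5 - p ≠ 0 := by linarith
  have : p + 1 ≠ 0 := by linarith
  rw [radialRate, coneRate]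
  field_simp
  ring

lemma radialRate_le_one (hp : 2 < p) (hp2 : p ^ 2 - p ≤ 4) (hγ : γ < p - 1) :
    radialRate p γ ≤ 1 := by
  have h3 := lt_three_of_sq_sub_le hp2
  have h5 : 0 < 5 - p := by linarith
  have h1 : 0 < p + 1 := by linarith
  have h : 0 < (p + 1) * (5 - p) := by positivity
  rw [radialRate, div_mul_eq_mul_div, div_le_one h]
  have h2 : (3 + (p - 2) ^ 2) * γ ≤ (3 + (p - 2) ^ 2) * (p - 1) :=
    mul_le_mul_of_nonneg_left hγ.le (by positivity)
  nlinarith [mul_nonneg (sub_nonneg.2 hp.le) (sub_nonneg.2 h3.le)]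

lemma rate_sum_le (hp : 2 < p) (hp2 : p ^ 2 - p ≤ 4) (hγ : 1 < γ) (hγp : γ < p - 1) :
    2 * (radialRate p γ + coneRate p γ) ≤ γ + 1 := by
  have h3 := lt_three_of_sq_sub_le hp2
  have h5 : 0 < 5 - p := by linarith
  rw [radialRate_add_coneRate hp h3, ← mul_div_assoc, div_le_iff₀ h5]
  nlinarith

lemma decayWeight_pos {r u : ℝ} (hr : 0 < r) (hu : 0 < u) : 0 < decayWeight p γ r u := by
  rw [decayWeight]
  positivity

lemma linear_weight_le (hp : 2 < p) (hp2 : p ^ 2 - p ≤ 4) (hγ : 1 < γ) (hγp : γ < p - 1)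
    {r u : ℝ} (hu : 1 ≤ u) (hr : u ≤ r) :
    r ^ (-2 : ℝ) * u ^ (1 - γ) ≤ decayWeight p γ r u ^ 2 := by
  have h1 := radialRate_le_one hp hp2 hγp
  have h2 := rate_sum_le hp hp2 hγ hγp
  have hu0 : 0 < u := by linarith
  have hr0 : 0 < r := by linarith
  have e1 : r ^ (-2 : ℝ) = r ^ (-(2 * radialRate p γ)) * r ^ (-(2 - 2 * radialRate p γ)) := by
    rw [← rpow_add hr0]
    ring_nf
  have e2 : decayWeight p γ r u ^ 2 = r ^ (-(2 * radialRate p γ)) * u ^ (-(2 * coneRate p γ)) := by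
    rw [decayWeight, mul_pow, ← rpow_natCast, ← rpow_natCast, ← rpow_mul hr0.le,
      ← rpow_mul hu0.le]
    congr 2 <;> push_cast <;> ring
  rw [e1, e2, mul_assoc]
  refine mul_le_mul_of_nonneg_left ?_ (by positivity)
  calc r ^ (-(2 - 2 * radialRate p γ)) * u ^ (1 - γ)
      ≤ u ^ (-(2 - 2 * radialRate p γ)) * u ^ (1 - γ) :=
        mul_le_mul_of_nonneg_right
          (rpow_le_rpow_of_nonpos hu0 hr (by linarith)) (by positivity)
    _ = u ^ (-(2 - 2 * radialRate p γ) + (1 - γ)) := (rpow_add hu0 _ _).symm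
    _ ≤ u ^ (-(2 * coneRate p γ)) := rpow_le_rpow_of_exponent_le hu (by linarith)

lemma long_weight_eq (hp : 2 < p) (h3 : p < 3) {A c r u : ℝ} (hA : 0 ≤ A) (hc : 0 < c)
    (hr : 0 < r) (hu : 0 < u) :
    (A * ((c * r ^ splitRate p γ) ^ (2 - p) * r ^ (-γ) * (u ^ γ) ^ (1 - p))) ^ (1 / (p + 1)) =
      (A * c ^ (2 - p)) ^ (1 / (p + 1)) * decayWeight p γ r u := by
  have h5 : 5 - p ≠ 0 := by linarith
  have h1 : p + 1 ≠ 0 := by linarith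
  rw [mul_rpow hc.le (by positivity), ← rpow_mul hr.le, ← rpow_mul hu.le]
  have e : A * (c ^ (2 - p) * r ^ (splitRate p γ * (2 - p)) * r ^ (-γ) * u ^ (γ * (1 - p))) =
      A * c ^ (2 - p) * (r ^ (splitRate p γ * (2 - p) + -γ) * u ^ (γ * (1 - p))) := by
    rw [rpow_add hr]
    ring
  rw [e, mul_rpow (mul_nonneg hA (by positivity)) (by positivity),
    mul_rpow (rpow_nonneg hr.le _) (by positivity),
    ← rpow_mul hr.le, ← rpow_mul hu.le, decayWeight]
  congr 3
  · rw [splitRate, radialRate]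
    field_simp
    ring
  · rw [coneRate]
    field_simp
    ring

lemma short_weight_eq (h3 : p < 3) {c r : ℝ} (hc : 0 < c) (hr : 0 < r) :
    (c * r ^ splitRate p γ) ^ ((5 - p) / 2) * r ^ (-(γ * ((p - 1) / 2))) = c ^ ((5 - p) / 2) := by
  have h5 : 5 - p ≠ 0 := by linarith
  rw [mul_rpow hc.le (by positivity), ← rpow_mul hr.le, mul_assoc, ← rpow_add hr]
  have e : splitRate p γ * ((5 - p) / 2) + -(γ * ((p - 1) / 2)) = 0 := by
    rw [splitRate]
    field_simp
    ring
  rw [e, rpow_zero, mul_one]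

lemma decayWeight_le_two_mul (hp : 2 < p) (hp2 : p ^ 2 - p ≤ 4) (hγ : 1 < γ) (hγp : γ < p - 1)
    {r r' u u' : ℝ} (hr : 0 < r) (hr' : r / 2 ≤ r') (hu : 0 < u) (hu' : u ≤ u') :
    decayWeight p γ r' u' ≤ 2 * decayWeight p γ r u := by
  have h3 := lt_three_of_sq_sub_le hp2
  have h1 := radialRate_le_one hp hp2 hγp
  have h0 := radialRate_nonneg hp h3 (by linarith : 0 ≤ γ)
  have hk : 0 ≤ coneRate p γ := by
    rw [coneRate]
    exact div_nonneg (mul_nonneg (by linarith) (by linarith)) (by linarith)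
  have e1 : r' ^ (-radialRate p γ) ≤ 2 * r ^ (-radialRate p γ) := by
    refine (rpow_le_rpow_of_nonpos (half_pos hr) hr' (by linarith)).trans ?_
    rw [div_rpow hr.le (by norm_num), div_eq_mul_inv, ← rpow_neg (by norm_num), neg_neg, mul_comm]
    refine mul_le_mul_of_nonneg_right ?_ (by positivity)
    calc (2 : ℝ) ^ radialRate p γ ≤ 2 ^ (1 : ℝ) := rpow_le_rpow_of_exponent_le (by norm_num) h1
      _ = 2 := rpow_one 2
  have e2 : u' ^ (-coneRate p γ) ≤ u ^ (-coneRate p γ) :=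
    rpow_le_rpow_of_nonpos hu hu' (by linarith)
  rw [decayWeight, decayWeight, ← mul_assoc]
  exact mul_le_mul e1 e2 (by have : 0 < u' := by linarith
                             positivity) (by positivity)

end Rates

lemma exists_small_rpow {X s δ : ℝ} (hs : 0 < s) (hδ : 0 < δ) :
    ∃ c : ℝ, 0 < c ∧ c ≤ 1 / 2 ∧ X * c ^ s ≤ δ := by
  have h : Filter.Tendsto (fun c : ℝ => X * c ^ s) (nhdsWithin 0 (Set.Ioi 0)) (nhds 0) := by
    have h1 : ContinuousAt (fun c : ℝ => X * c ^ s) 0 :=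
      continuousAt_const.mul (continuousAt_rpow_const _ _ (Or.inr hs.le))
    have h2 := h1.tendsto
    simp only [zero_rpow hs.ne', mul_zero] at h2
    exact h2.mono_left nhdsWithin_le_nhds
  have h1 := h.eventually (ge_mem_nhds hδ)
  have h2 : ∀ᶠ c : ℝ in nhdsWithin 0 (Set.Ioi 0), c ∈ Set.Ioc (0 : ℝ) (1 / 2) :=
    Ioc_mem_nhdsGT (by norm_num)
  obtain ⟨c, hc1, hc2⟩ := (h1.and h2).exists
  exact ⟨c, hc2.1, hc2.2, hc1⟩

lemma isCompact_backward_cone (t₀ : ℝ) (x₀ : E3) :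
    IsCompact {q : ℝ × E3 | 0 ≤ q.1 ∧ q.1 + ‖q.2 - x₀‖ ≤ t₀} := by
  have hc : IsClosed {q : ℝ × E3 | 0 ≤ q.1 ∧ q.1 + ‖q.2 - x₀‖ ≤ t₀} :=
    (isClosed_le continuous_const continuous_fst).inter
      (isClosed_le (continuous_fst.add (continuous_snd.sub continuous_const).norm) continuous_const)
  refine ((isCompact_Icc (a := (0 : ℝ)) (b := t₀)).prod
    (isCompact_closedBall x₀ t₀)).of_isClosed_subset hc fun q hq => ?_
  refine ⟨⟨hq.1, ?_⟩, ?_⟩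
  · have := norm_nonneg (q.2 - x₀)
    linarith [hq.2]
  · rw [Metric.mem_closedBall, dist_eq_norm]
    linarith [hq.1, hq.2]

/-- A function controlled at every exterior point by the weight plus a small multiple of its size on
the backward light cone is bounded by a multiple of the weight. -/
lemma decay_of_absorption {p γ P m s : ℝ} (hp : 2 < p) (hp2 : p ^ 2 - p ≤ 4) (hγ : 1 < γ)
    (hγp : γ < p - 1) {f : ℝ × E3 → ℝ} (hf : Continuous f) {ρ : E3 → ℝ}
    (hρ : ∀ c : E3, 2 ≤ ‖c‖ → 2 * ρ c ≤ ‖c‖) (hs : 0 ≤ s) (hm : 4 * m ≤ s)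
    (H : ∀ (T : ℝ) (c : E3), 0 ≤ T → T + 2 ≤ ‖c‖ → ∀ N : ℝ, 0 ≤ N →
      (∀ r : ℝ, 0 < r → r ≤ min (ρ c) T → ∀ ω : S2, |f (T - r, c + r • (ω : E3))| ≤ N) →
      s * |f (T, c)| ≤ P * decayWeight p γ ‖c‖ (‖c‖ - T) + N * m)
    {t₀ : ℝ} {x₀ : E3} (ht₀ : 0 ≤ t₀) (hx₀ : t₀ + 2 ≤ ‖x₀‖) :
    s * |f (t₀, x₀)| ≤ 2 * P * decayWeight p γ ‖x₀‖ (‖x₀‖ - t₀) := by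
  set D : Set (ℝ × E3) := {q : ℝ × E3 | 0 ≤ q.1 ∧ q.1 + ‖q.2 - x₀‖ ≤ t₀} with hD
  set w : ℝ × E3 → ℝ := fun q => decayWeight p γ ‖q.2‖ (‖q.2‖ - q.1) with hw
  have hext : ∀ q ∈ D, q.1 + 2 ≤ ‖q.2‖ := by
    intro q hq
    have h1 := norm_sub_norm_le x₀ q.2
    rw [norm_sub_rev] at h1
    linarith [hq.2]
  have hwpos : ∀ q ∈ D, 0 < w q := fun q hq =>
    decayWeight_pos (by linarith [hext q hq, hq.1]) (by linarith [hext q hq])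
  have hwc : ContinuousOn w D := by
    refine ContinuousOn.mul (ContinuousOn.rpow_const continuous_snd.norm.continuousOn fun q hq => ?_)
      (ContinuousOn.rpow_const (continuous_snd.norm.sub continuous_fst).continuousOn fun q hq => ?_)
    · exact Or.inl (by linarith [hext q hq, hq.1])
    · exact Or.inl (by linarith [hext q hq])
  have hmem : (t₀, x₀) ∈ D := ⟨ht₀, by simp⟩
  obtain ⟨⟨T, c⟩, hq, hmax⟩ := (isCompact_backward_cone t₀ x₀).exists_isMaxOn ⟨_, hmem⟩
    (hf.abs.continuousOn.div hwc fun q hq => (hwpos q hq).ne')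
  have hW := hwpos _ hq
  have hTc := hext _ hq
  have hT : 0 ≤ T := hq.1
  dsimp only at hTc
  set M := |f (T, c)| / w (T, c) with hM
  have hM0 : 0 ≤ M := by positivity
  have hle : ∀ q ∈ D, |f q| ≤ M * w q := fun q hq => (div_le_iff₀ (hwpos q hq)).1 (hmax hq)
  have hfM : |f (T, c)| = M * w (T, c) := (div_mul_cancel₀ _ hW.ne').symm
  have h1 := H T c hT hTc (M * (2 * w (T, c))) (by positivity) fun r hr hrm ω => by
    have hrT := hrm.trans (min_le_right _ _)
    have hrR := hrm.trans (min_le_left _ _)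
    have hge := norm_add_smul_ge c ω hr.le
    have hhalf := hρ c (by linarith)
    refine (hle (T - r, c + r • (ω : E3)) ⟨sub_nonneg.2 hrT, ?_⟩).trans
      (mul_le_mul_of_nonneg_left ?_ hM0)
    · have h2 := norm_add_le (c - x₀) (r • (ω : E3))
      rw [norm_smul_sphere ω hr.le, ← add_sub_right_comm] at h2
      have h3 := hq.2
      dsimp only at h3 ⊢
      linarith
    · exact decayWeight_le_two_mul hp hp2 hγ hγp (by linarith) (by linarith) (by linarith)
        (by linarith)
  have h2 : s * M ≤ 2 * P := by
    rw [hfM] at h1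
    have h3 : (s * M) * w (T, c) ≤ (P + 2 * M * m) * w (T, c) := by
      have e : decayWeight p γ ‖c‖ (‖c‖ - T) = w (T, c) := rfl
      rw [e] at h1
      linarith
    have h4 := le_of_mul_le_mul_right h3 hW
    nlinarith
  calc s * |f (t₀, x₀)| ≤ s * (M * w (t₀, x₀)) := mul_le_mul_of_nonneg_left (hle _ hmem) hs
    _ = (s * M) * w (t₀, x₀) := by ring
    _ ≤ 2 * P * w (t₀, x₀) := mul_le_mul_of_nonneg_right h2 (hwpos _ hmem).le

/-- The uniform constant in the estimate of the far part of the Duhamel term. -/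
def longConst (p γ B c : ℝ) : ℝ :=
  (48 * B) ^ (p / (p + 1) - 1 / 2) * √48 *
    (48 / (p - 1) * (2 / (p - 2) + 2 ^ (p - 1) / (2 - γ)) * c ^ (2 - p)) ^ (1 / (p + 1))

lemma linConst_nonneg {γ : ℝ} (hγ : 1 < γ) (hγ2 : γ < 2) : 0 ≤ linConst γ :=
  mul_nonneg measureReal_nonneg
    (add_nonneg (add_nonneg (by norm_num) (div_nonneg (by norm_num) (by linarith)))
      (div_nonneg (by norm_num) (by linarith)))

lemma rpow_le_sqrt_mul {p B E0 E1 : ℝ} (hp : 2 < p) (hE00 : 0 ≤ E0) (hE01 : E0 ≤ E1)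
    (hE0B : E0 ≤ B) :
    (16 * (3 * E0)) ^ (p / (p + 1)) ≤ (48 * B) ^ (p / (p + 1) - 1 / 2) * (√48 * √E1) := by
  have hB : 0 ≤ B := hE00.trans hE0B
  have hex : 0 ≤ p / (p + 1) - 1 / 2 := by
    rw [sub_nonneg, div_le_div_iff₀ (by norm_num) (by linarith)]
    linarith
  calc (16 * (3 * E0)) ^ (p / (p + 1))
      = (48 * E0) ^ ((p / (p + 1) - 1 / 2) + 1 / 2) := by ring_nf
    _ = (48 * E0) ^ (p / (p + 1) - 1 / 2) * √(48 * E0) := by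
      rw [rpow_add_of_nonneg (by positivity) hex (by norm_num), ← Real.sqrt_eq_rpow]
    _ ≤ (48 * B) ^ (p / (p + 1) - 1 / 2) * √(48 * E1) :=
      mul_le_mul (rpow_le_rpow (by positivity) (by linarith) hex)
        (Real.sqrt_le_sqrt (by linarith)) (Real.sqrt_nonneg _) (by positivity)
    _ = _ := by rw [Real.sqrt_mul (by norm_num)]

lemma kirchhoff_weight_le {p γ E : ℝ} (hp : 2 < p) (hp2 : p ^ 2 - p ≤ 4) (hγ : 1 < γ)
    (hγp : γ < p - 1) {φ : ℝ → E3 → ℝ} (hφ : ContDiff ℝ (⊤ : ℕ∞) fun q : ℝ × E3 => φ q.1 q.2)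
    (hE : 0 ≤ E) (h0 : wEnergy p 0 γ φ ≤ ENNReal.ofReal E)
    (h1 : wEnergy p 1 γ φ ≤ ENNReal.ofReal E) {T : ℝ} {c : E3} (hT : 0 ≤ T) (hc : T + 2 ≤ ‖c‖) :
    |kirchhoff (fun q : ℝ × E3 => φ q.1 q.2) T c T| ≤
      17 * √(3 * linConst γ) * √E * decayWeight p γ ‖c‖ (‖c‖ - T) := by
  have h3 := lt_three_of_sq_sub_le hp2
  have hlin0 := linConst_nonneg hγ (by linarith : γ < 2)
  have hW := decayWeight_pos (p := p) (γ := γ) (by linarith : 0 < ‖c‖)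
    (by linarith : 0 < ‖c‖ - T)
  have h := linear_decay (K := 3 * E) (a := φ 0) (b := dt1 φ 0) (by linarith : 1 < p) h3.le hγ
    (by linarith) (contDiff_slice hφ 0) (contDiff_dt1_zero hφ) (by positivity)
    (lintegral_datNorm1_le h0) (lintegral_datNorm2_le h1)
    ((lintegral_pot_le h0).trans (ENNReal.ofReal_le_ofReal (by linarith))) hT hc
  have hs : √(3 * E * (linConst γ * (‖c‖ ^ (-2 : ℝ) * (‖c‖ - T) ^ (1 - γ)))) ≤
      √(3 * linConst γ * E * decayWeight p γ ‖c‖ (‖c‖ - T) ^ 2) := by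
    refine Real.sqrt_le_sqrt ?_
    have := linear_weight_le hp hp2 hγ hγp (by linarith : 1 ≤ ‖c‖ - T) (by linarith : _ ≤ ‖c‖)
    calc _ = 3 * linConst γ * E * (‖c‖ ^ (-2 : ℝ) * (‖c‖ - T) ^ (1 - γ)) := by ring
      _ ≤ _ := mul_le_mul_of_nonneg_left this (by positivity)
  rw [Real.sqrt_mul (by positivity : 0 ≤ 3 * linConst γ * E), Real.sqrt_sq hW.le,
    Real.sqrt_mul (by positivity : 0 ≤ 3 * linConst γ)] at hs
  rw [kirchhoff_eq_data hφ]
  linarith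

/-- The main a priori estimate: the size of a solution at an exterior point in terms of the weight
and of its size on the top of the backward light cone. -/
lemma exterior_apriori {p γ B c₀ m : ℝ} (hp : 2 < p) (hp2 : p ^ 2 - p ≤ 4) (hγ : 1 < γ)
    (hγp : γ < p - 1) (hB : 0 ≤ B) (hc₀ : 0 < c₀) (hc₀' : c₀ ≤ 1 / 2)
    (hm : (48 * B) ^ ((p - 1) / (p + 1)) *
      (96 * (2 ^ (1 - (p - 1) / 2) / (1 - (p - 1) / 2)) * c₀ ^ ((5 - p) / 2)) ^ (2 / (p + 1)) ≤ m)
    {φ : ℝ → E3 → ℝ} (hφ : IsNLWSolution p φ) (h0 : wEnergy p 0 γ φ ≤ ENNReal.ofReal B)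
    (h1 : wEnergy p 1 γ φ < ⊤) {T : ℝ} {c : E3} (hT : 0 ≤ T) (hc : T + 2 ≤ ‖c‖) {N : ℝ}
    (hN : 0 ≤ N) (hNf : ∀ r : ℝ, 0 < r → r ≤ min (c₀ * ‖c‖ ^ splitRate p γ) T → ∀ ω : S2,
      |φ (T - r) (c + r • (ω : E3))| ≤ N) :
    (σ : Measure S2).real Set.univ * |φ T c| ≤
      (17 * √(3 * linConst γ) + longConst p γ B c₀) * √(wEnergy p 1 γ φ).toReal *
        decayWeight p γ ‖c‖ (‖c‖ - T) + N * m := by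
  have h3 := lt_three_of_sq_sub_le hp2
  have hp1 : 0 < p + 1 := by linarith
  set E1 := (wEnergy p 1 γ φ).toReal with hE1
  set E0 := (wEnergy p 0 γ φ).toReal with hE0
  have h0t : wEnergy p 0 γ φ ≠ ⊤ := (wEnergy_zero_le_one.trans_lt h1).ne
  have e0 : wEnergy p 0 γ φ ≤ ENNReal.ofReal E0 := (ENNReal.ofReal_toReal h0t).ge
  have e1 : wEnergy p 1 γ φ ≤ ENNReal.ofReal E1 := (ENNReal.ofReal_toReal h1.ne).ge
  have hE00 : 0 ≤ E0 := ENNReal.toReal_nonneg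
  have hE10 : 0 ≤ E1 := ENNReal.toReal_nonneg
  have hE01 : E0 ≤ E1 := ENNReal.toReal_mono h1.ne wEnergy_zero_le_one
  have hE0B : E0 ≤ B := ENNReal.toReal_le_of_le_ofReal hB h0
  have e01 : wEnergy p 0 γ φ ≤ ENNReal.ofReal E1 := wEnergy_zero_le_one.trans e1
  have hr : 0 < ‖c‖ := by linarith
  have hu : 0 < ‖c‖ - T := by linarith
  have hR : 0 < c₀ * ‖c‖ ^ splitRate p γ := by positivity
  have hRc : 2 * (c₀ * ‖c‖ ^ splitRate p γ) ≤ ‖c‖ := by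
    have h := rpow_le_rpow_of_exponent_le (by linarith : 1 ≤ ‖c‖)
      (splitRate_le_one hp hp2 hγp)
    rw [rpow_one] at h
    have h' : 0 ≤ ‖c‖ ^ splitRate p γ := by positivity
    nlinarith
  have hW := decayWeight_pos (p := p) (γ := γ) hr hu
  have hS : 0 ≤ (σ : Measure S2).real Set.univ := measureReal_nonneg
  have hA := kirchhoff_weight_le hp hp2 hγ hγp hφ.1 hE10 e01 e1 hT hc
  have hdat := lintegral_datD_le hφ.1 e0
  have hpos1 : 0 ≤ 48 / (p - 1) * (2 / (p - 2) + 2 ^ (p - 1) / (2 - γ)) :=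
    mul_nonneg (div_nonneg (by norm_num) (by linarith))
      (add_nonneg (div_nonneg (by norm_num) (by linarith))
        (div_nonneg (by positivity) (by linarith)))
  have hlong := lintegral_cone_long_le hp h3.le hγ.le (by linarith) hγp.le hφ.1 hφ.solvesNLW
    (by positivity : 0 ≤ 3 * E0) hdat hT hc hR hRc
  rw [long_weight_eq hp h3 hpos1 hc₀ hr hu] at hlong
  have hL : (16 * (3 * E0)) ^ (p / (p + 1)) *
      ((48 / (p - 1) * (2 / (p - 2) + 2 ^ (p - 1) / (2 - γ)) * c₀ ^ (2 - p)) ^ (1 / (p + 1)) *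
        decayWeight p γ ‖c‖ (‖c‖ - T)) ≤
      longConst p γ B c₀ * √E1 * decayWeight p γ ‖c‖ (‖c‖ - T) := by
    have hK := rpow_le_sqrt_mul hp hE00 hE01 hE0B
    rw [longConst]
    refine (mul_le_mul_of_nonneg_right hK
      (mul_nonneg (rpow_nonneg (mul_nonneg hpos1 (by positivity)) _) hW.le)).trans_eq ?_
    ring
  have hL0 : 0 ≤ longConst p γ B c₀ * √E1 * decayWeight p γ ‖c‖ (‖c‖ - T) := by
    refine mul_nonneg (mul_nonneg ?_ (Real.sqrt_nonneg _)) hW.le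
    rw [longConst]
    exact mul_nonneg (by positivity) (rpow_nonneg (mul_nonneg hpos1 (by positivity)) _)
  have hpos2 : 0 ≤ 96 * ((2 : ℝ) ^ (1 - (p - 1) / 2) / (1 - (p - 1) / 2)) :=
    mul_nonneg (by norm_num) (div_nonneg (by positivity) (by linarith))
  have hshort := lintegral_cone_short_le hp h3 hγ.le (by linarith) hγp.le hφ.1 hφ.solvesNLW
    (by positivity : 0 ≤ 3 * E0) hdat hT hc hR hRc (min_le_left _ T) (min_le_right _ T)
  rw [short_weight_eq h3 hc₀ hr] at hshort
  have hM : (16 * (3 * E0)) ^ ((p - 1) / (p + 1)) *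
      (96 * (2 ^ (1 - (p - 1) / 2) / (1 - (p - 1) / 2)) * c₀ ^ ((5 - p) / 2)) ^ (2 / (p + 1)) ≤
      m := by
    refine (mul_le_mul_of_nonneg_right ?_
      (rpow_nonneg (mul_nonneg hpos2 (by positivity)) _)).trans hm
    exact rpow_le_rpow (by positivity) (by linarith) (div_nonneg (by linarith) hp1.le)
  have hm0 : 0 ≤ m := (mul_nonneg (by positivity)
    (rpow_nonneg (mul_nonneg hpos2 (by positivity)) _)).trans hM
  have hd := duhamel_le hp hφ.1 hφ.solvesNLW hT hR hN hL0 hm0 hA hNf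
    (hlong.trans (ENNReal.ofReal_le_ofReal hL)) (hshort.trans (ENNReal.ofReal_le_ofReal hM))
  dsimp only at hd
  linarith

lemma sphere_area_pos : 0 < (σ : Measure S2).real Set.univ := by
  have : Nonempty S2 := ⟨⟨EuclideanSpace.single 0 1, by simp⟩⟩
  exact ENNReal.toReal_pos (isOpen_univ.measure_ne_zero _ Set.univ_nonempty) (measure_ne_top _ _)

/-- Pointwise decay in the exterior region `{t₀ ≥ 0, |x₀| ≥ t₀ + 2}`
for `2 < p ≤ (1+√17)/2` and `1 < γ₀ < p−1`, with `α_p = (3+(p−2)²)/((p+1)(5−p))`. -/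
theorem nlw_exterior_decay_small_p (p γ₀ B : ℝ)
    (hp2 : 2 < p) (hp' : p ≤ (1 + Real.sqrt 17) / 2)
    (hγ₁ : 1 < γ₀) (hγ₂ : γ₀ < p - 1) (hB : 0 < B) :
    ∃ C : ℝ, 0 < C ∧ ∀ φ : ℝ → E3 → ℝ, IsNLWSolution p φ →
      wEnergy p 0 γ₀ φ ≤ ENNReal.ofReal B → wEnergy p 1 γ₀ φ < ⊤ →
      ∀ t₀ : ℝ, 0 ≤ t₀ → ∀ x₀ : E3, t₀ + 2 ≤ ‖x₀‖ →
        |φ t₀ x₀| ≤ C * ‖x₀‖ ^ (-((3 + (p - 2) ^ 2) / ((p + 1) * (5 - p)) * γ₀))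
          * (‖x₀‖ - t₀) ^ (-((p - 1) * γ₀ / (p + 1)))
          * Real.sqrt (wEnergy p 1 γ₀ φ).toReal := by
  have hsq := sq_sub_le_four hp2 hp'
  have h3 := lt_three_of_sq_sub_le hsq
  have hp1 : 0 < p + 1 := by linarith
  have hS := sphere_area_pos
  set S := (sphereMeasure : Measure (Metric.sphere (0 : E3) 1)).real Set.univ with hS_def
  have hpos2 : 0 ≤ 96 * ((2 : ℝ) ^ (1 - (p - 1) / 2) / (1 - (p - 1) / 2)) :=
    mul_nonneg (by norm_num) (div_nonneg (by positivity) (by linarith))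
  obtain ⟨c₀, hc₀, hc₀', hsmall⟩ := exists_small_rpow
    (X := (48 * B) ^ ((p - 1) / (p + 1)) *
      (96 * (2 ^ (1 - (p - 1) / 2) / (1 - (p - 1) / 2))) ^ (2 / (p + 1)))
    (s := (5 - p) / 2 * (2 / (p + 1))) (δ := S / 4)
    (mul_pos (by linarith) (by positivity)) (by positivity)
  rw [rpow_mul hc₀.le, mul_assoc, ← mul_rpow hpos2 (by positivity)] at hsmall
  set Q := 17 * √(3 * linConst γ₀) + longConst p γ₀ B c₀ with hQ
  refine ⟨2 * |Q| / S + 1, by positivity, fun φ hφ h0 h1 t₀ ht₀ x₀ hx₀ => ?_⟩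
  have hW := decayWeight_pos (p := p) (γ := γ₀) (by linarith : 0 < ‖x₀‖)
    (by linarith : 0 < ‖x₀‖ - t₀)
  have key := decay_of_absorption hp2 hsq hγ₁ hγ₂ (f := fun q => φ q.1 q.2) hφ.1.continuous
    (ρ := fun c => c₀ * ‖c‖ ^ splitRate p γ₀) (fun c hc => by
      have h := rpow_le_rpow_of_exponent_le (by linarith : 1 ≤ ‖c‖)
        (splitRate_le_one hp2 hsq hγ₂)
      rw [rpow_one] at h
      have h' : 0 ≤ ‖c‖ ^ splitRate p γ₀ := by positivity
      nlinarith) hS.le (by linarith : 4 * (S / 4) ≤ S)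
    (fun T c hT hc N hN hNf => exterior_apriori hp2 hsq hγ₁ hγ₂ hB.le hc₀ hc₀' hsmall hφ h0 h1
      hT hc hN hNf) ht₀ hx₀
  dsimp only at key
  set e := √(wEnergy p 1 γ₀ φ).toReal
  have he : 0 ≤ e := Real.sqrt_nonneg _
  have h4 : S * |φ t₀ x₀| ≤ S * ((2 * |Q| / S + 1) * decayWeight p γ₀ ‖x₀‖ (‖x₀‖ - t₀) * e) := by
    have e2 : S * ((2 * |Q| / S + 1) * decayWeight p γ₀ ‖x₀‖ (‖x₀‖ - t₀) * e) =
        (2 * |Q| + S) * (e * decayWeight p γ₀ ‖x₀‖ (‖x₀‖ - t₀)) := by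
      field_simp
    rw [e2]
    have h5 : 0 ≤ e * decayWeight p γ₀ ‖x₀‖ (‖x₀‖ - t₀) := by positivity
    nlinarith [le_abs_self Q]
  have h6 := le_of_mul_le_mul_left h4 hS
  rw [decayWeight, ← mul_assoc (2 * |Q| / S + 1)] at h6
  exact h6
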